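/- Let (R,m) be a complete Noetherian local domain of mixed characteristic p > 0 (char R = 0 and char R/m = p) with perfect residue field k = R/m, of dimension d, and let p, x₂, …, x_d be a system of parameters of R. Then there exist a nonzero element g ∈ R and an R-subalgebra T of the absolute integral closure R^+ with R ⊆ T ⊆ R^+ such that: (1) T admits compatible systems of p-power roots p^{1/p^n} ∈ T and g^{1/p^n} ∈ T; (2) the Frobenius endomorphism of T/pT is surjective; (3) T is a normal domain that is (pg)^{1/p^∞}-almost Cohen-Macaulay with respect to p, x₂, …, x_d; (4) T[1/(pg)] is the union of a directed family of R[1/(pg)]-subalgebras each of which is finite étale over R[1/(pg)]. -/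

import Mathlib

set_option linter.unusedSectionVars false
set_option linter.style.haveILetI false
/-! ## Witt vectors modulo p - [f] -/
namespace ACM
open WittVector
section Roots
variable {p : ℕ} [hp : Fact p.Prime]
variable {K : Type*} [CommRing K] [CharP K p] [PerfectRing K p]
variable {L : Type*} [CommRing L] [CharP L p] [PerfectRing L p]
noncomputable def rt (p : ℕ) [Fact p.Prime] {K : Type*} [CommRing K] [CharP K p] [PerfectRing K p]
    (j : ℕ) : K ≃+* K := (iterateFrobeniusEquiv K p j).symm
lemma rt_pow (j : ℕ) (x : K) : (rt p j x) ^ (p ^ j) = x := by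
  have := (iterateFrobeniusEquiv K p j).apply_symm_apply x
  rwa [iterateFrobeniusEquiv_def] at this
lemma pow_inj (j : ℕ) {x y : K} (h : x ^ (p ^ j) = y ^ (p ^ j)) : x = y := by
  apply (iterateFrobeniusEquiv K p j).injective
  rwa [iterateFrobeniusEquiv_def, iterateFrobeniusEquiv_def]
lemma rt_unique {j : ℕ} {x y : K} (h : y ^ (p ^ j) = x) : y = rt p j x :=
  pow_inj (p := p) j (by rw [h, rt_pow])
lemma rt_map (φ : K →+* L) (j : ℕ) (x : K) : φ (rt p j x) = rt p j (φ x) :=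
  rt_unique (by rw [← map_pow, rt_pow])
lemma rt_pow_self (j : ℕ) (x : K) : rt p j (x ^ (p ^ j)) = x := (rt_unique rfl).symm
lemma rt_add_pow (i j : ℕ) (x : K) : (rt p (i + j) x) ^ (p ^ j) = rt p i x :=
  rt_unique (by rw [← pow_mul, ← pow_add, add_comm j i, rt_pow])
lemma rt_add_pow' (i j : ℕ) (x : K) : (rt p (i + j) x) ^ (p ^ i) = rt p j x := by
  rw [add_comm, rt_add_pow]
lemma rt_rt (i j : ℕ) (x : K) : rt p i (rt p j x) = rt p (i + j) x :=
  rt_unique (by rw [pow_add, pow_mul, rt_pow, rt_pow])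
lemma rt_mul (j : ℕ) (x y : K) : rt p j (x * y) = rt p j x * rt p j y := map_mul _ _ _
lemma rt_mul_eq_zero {f z : K} {n : ℕ} (h : f ^ n * z = 0) (j : ℕ) : rt p j f * z = 0 := by
  obtain ⟨i, hi⟩ : ∃ i, n ≤ p ^ i := ⟨n, (Nat.lt_pow_self hp.out.one_lt).le⟩
  have h1 : f ^ (p ^ i) * z = 0 := by
    rw [← Nat.sub_add_cancel hi, pow_add, mul_assoc, h, mul_zero]
  have h2 : rt p j f * rt p (i + j) z = 0 := by
    apply pow_inj (p := p) (i + j)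
    rw [zero_pow (by have := hp.out.pos; positivity), mul_pow, rt_pow, add_comm, pow_add, pow_mul, rt_pow, h1]
  have : z = rt p (i + j) z * rt p (i + j) z ^ (p ^ (i + j) - 1) := by
    rw [← pow_succ', Nat.sub_add_cancel (Nat.one_le_pow _ _ hp.out.pos), rt_pow]
  rw [this, ← mul_assoc, h2, zero_mul]
end Roots
section E
variable (p : ℕ) [hp : Fact p.Prime]
variable {K : Type*} [CommRing K] [CharP K p] [PerfectRing K p]
abbrev EE (f : K) : Type _ := WittVector p K ⧸ Ideal.span {(p : WittVector p K) - teichmuller p f}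
noncomputable def te (f : K) : K →* EE p f :=
  (Ideal.Quotient.mk (Ideal.span {(p : WittVector p K) - teichmuller p f})).toMonoidHom.comp
    (teichmuller p)
variable {p}
lemma te_def (f x : K) : te p f x = Ideal.Quotient.mk _ (teichmuller p x) := rfl
lemma te_f (f : K) : te p f f = (p : EE p f) := by
  rw [te_def]
  symm
  rw [← map_natCast (Ideal.Quotient.mk _), Ideal.Quotient.eq]
  exact Ideal.mem_span_singleton_self _
lemma witt_exists (z : WittVector p K) : ∃ w, z = teichmuller p (z.coeff 0) + p * w := by
  have : z - teichmuller p (z.coeff 0) ∈ Ideal.span {(p : WittVector p K)} := by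
    rw [mem_span_p_iff_coeff_zero_eq_zero]
    have : (z - teichmuller p (z.coeff 0)).coeff 0
      = constantCoeff (z - teichmuller p (z.coeff 0)) := rfl
    rw [this, map_sub]
    simp [constantCoeff, teichmuller_coeff_zero]
  obtain ⟨w, hw⟩ := Ideal.mem_span_singleton.mp this
  exact ⟨w, by rw [← hw]; ring⟩
lemma witt_p_nzd {z : WittVector p K} (h : p * z = 0) : z = 0 :=
  eq_zero_of_p_mul_eq_zero z (by rw [mul_comm]; exact h)
noncomputable def red (p : ℕ) [Fact p.Prime] {K : Type*} [CommRing K] [CharP K p] [PerfectRing K p]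
    (f : K) : EE p f →+* K ⧸ Ideal.span {f} :=
  Ideal.Quotient.lift _ ((Ideal.Quotient.mk (Ideal.span {f})).comp constantCoeff) (by
    intro a ha
    obtain ⟨b, rfl⟩ := Ideal.mem_span_singleton.mp ha
    rw [RingHom.comp_apply, map_mul, map_sub, map_natCast, CharP.cast_eq_zero, zero_sub]
    rw [Ideal.Quotient.eq_zero_iff_mem, Ideal.mem_span_singleton]
    simp [constantCoeff, teichmuller_coeff_zero])
lemma red_mk (f : K) (z : WittVector p K) :
    red p f (Ideal.Quotient.mk _ z) = Ideal.Quotient.mk _ (z.coeff 0) := rfl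
lemma red_te (f x : K) : red p f (te p f x) = Ideal.Quotient.mk _ x := by
  rw [te_def, red_mk, teichmuller_coeff_zero]
lemma red_eq_zero {f : K} {z : EE p f} : red p f z = 0 ↔ (p : EE p f) ∣ z := by
  constructor
  · obtain ⟨z, rfl⟩ := Ideal.Quotient.mk_surjective z
    intro h
    rw [red_mk, Ideal.Quotient.eq_zero_iff_mem, Ideal.mem_span_singleton] at h
    obtain ⟨c, hc⟩ := h
    obtain ⟨w, hw⟩ := witt_exists z
    rw [hw, hc, map_mul (teichmuller p), map_add, map_mul, map_mul, ← te_def, te_f, map_natCast, ← mul_add]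
    exact dvd_mul_right _ _
  · rintro ⟨c, rfl⟩
    rw [map_mul, ← te_f, red_te, Ideal.Quotient.eq_zero_iff_mem.mpr (Ideal.mem_span_singleton_self _),
      zero_mul]
lemma E_exists {f : K} (z : EE p f) : ∃ (k : K) (w : EE p f), z = te p f k + p * w := by
  obtain ⟨z, rfl⟩ := Ideal.Quotient.mk_surjective z
  obtain ⟨w, hw⟩ := witt_exists z
  refine ⟨z.coeff 0, Ideal.Quotient.mk _ w, ?_⟩
  conv_lhs => rw [hw]
  rw [map_add, map_mul, map_natCast, te_def]
lemma E_p_nzd {f : K} (hf : ∀ k : K, f * k = 0 → k = 0) {z : EE p f} (h : (p : EE p f) * z = 0) :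
    z = 0 := by
  obtain ⟨z, rfl⟩ := Ideal.Quotient.mk_surjective z
  rw [← map_natCast (Ideal.Quotient.mk _), ← map_mul, Ideal.Quotient.eq_zero_iff_mem,
    Ideal.mem_span_singleton] at h
  obtain ⟨u, hu⟩ := h
  have h0 : u.coeff 0 = 0 := by
    apply hf
    have := congrArg constantCoeff hu
    simp only [map_mul, map_sub, map_natCast, CharP.cast_eq_zero, zero_mul, zero_sub] at this
    simp [constantCoeff, teichmuller_coeff_zero] at this
    exact this
  obtain ⟨w, hw⟩ := witt_exists u
  rw [h0, teichmuller_zero, zero_add] at hw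
  rw [Ideal.Quotient.eq_zero_iff_mem, Ideal.mem_span_singleton]
  refine ⟨w, ?_⟩
  rw [← sub_eq_zero]
  apply witt_p_nzd
  rw [mul_sub, hu, hw]; ring
lemma E_root {f : K} (j : ℕ) {z : EE p f} (h : (p : EE p f) ∣ z ^ (p ^ j)) :
    te p f (rt p j f) ∣ z := by
  obtain ⟨k, w, hz⟩ := E_exists z
  have h1 : red p f z = Ideal.Quotient.mk _ k := by
    rw [hz, map_add, red_te, red_eq_zero.mpr (dvd_mul_right _ _), add_zero]
  have h2 := red_eq_zero.mpr h
  rw [map_pow, h1, ← map_pow, Ideal.Quotient.eq_zero_iff_mem, Ideal.mem_span_singleton] at h2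
  obtain ⟨c, hc⟩ := h2
  have hk : k = rt p j f * rt p j c := by
    rw [← rt_mul, ← hc, rt_pow_self]
  have hpd : te p f (rt p j f) ∣ (p : EE p f) := by
    rw [← te_f]
    have : te p f f = te p f (rt p j f) ^ (p ^ j) := by rw [← map_pow, rt_pow]
    rw [this]
    exact dvd_pow_self _ (by have := hp.out.pos; positivity)
  rw [hz, hk, map_mul]
  exact dvd_add (dvd_mul_right _ _) (hpd.mul_right _)
end E
end ACM
/-! ## Almost integral elements and the rings N_n -/
namespace ACM
open WittVector Polynomial
lemma exists_bound {E L : Type*} [CommRing E] [CommRing L] [Algebra E L] (a : E)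
    (y : L) (hy : IsIntegral E y) (hden : ∃ n, ∃ e : E, algebraMap E L a ^ n * y = algebraMap E L e) :
    ∃ M, ∀ m : ℕ, ∃ e : E, algebraMap E L a ^ M * y ^ m = algebraMap E L e := by
  obtain ⟨P, hP, hPy⟩ := hy
  obtain ⟨n, e0, he0⟩ := hden
  set D := P.natDegree
  refine ⟨n * D, fun m => ?_⟩
  have base : ∀ m ≤ D, ∃ e : E, algebraMap E L a ^ (n * D) * y ^ m = algebraMap E L e := by
    intro m hm
    refine ⟨a ^ (n * (D - m)) * e0 ^ m, ?_⟩
    rw [map_mul, map_pow, map_pow, ← he0, mul_pow, ← pow_mul, ← mul_assoc, ← pow_add, ← mul_add,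
      Nat.sub_add_cancel hm]
  induction m using Nat.strong_induction_on with
  | _ m ih =>
    by_cases hm : m ≤ D
    · exact base m hm
    · push Not at hm
      have h1 : y ^ D = - ∑ i ∈ Finset.range D, algebraMap E L (P.coeff i) * y ^ i := by
        rw [eval₂_eq_sum_range, Finset.sum_range_succ] at hPy
        have : P.coeff P.natDegree = 1 := hP
        rw [this, map_one, one_mul] at hPy
        exact eq_neg_of_add_eq_zero_right hPy
      choose c hc using fun i : Finset.range D => ih (i.1 + (m - D)) (by
        have := Finset.mem_range.mp i.2; omega)
      refine ⟨- ∑ i : Finset.range D, P.coeff i * c i, ?_⟩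
      have h2 : y ^ m = y ^ D * y ^ (m - D) := by rw [← pow_add]; congr 1; omega
      rw [h2, h1, map_neg, map_sum, neg_mul, mul_neg, Finset.sum_mul, Finset.mul_sum, neg_inj,
        ← Finset.sum_coe_sort]
      refine Finset.sum_congr rfl fun i _ => ?_
      rw [map_mul, ← hc i, pow_add]; ring
section
variable {p : ℕ} [hp : Fact p.Prime]
lemma E_almost {K : Type*} [CommRing K] [CharP K p] [PerfectRing K p] {f : K}
    {L : Type*} [CommRing L] [Algebra (EE p f) L] (hu : IsUnit (algebraMap (EE p f) L p))
    (y : L) (hy : IsIntegral (EE p f) y)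
    (hden : ∃ n, ∃ e : EE p f, algebraMap _ L (p : EE p f) ^ n * y = algebraMap _ L e)
    (hinj : Function.Injective (algebraMap (EE p f) L)) (j : ℕ) :
    ∃ e : EE p f, algebraMap _ L (te p f (rt p j f)) * y = algebraMap _ L e := by
  obtain ⟨M, hM⟩ := exists_bound _ y hy hden
  obtain ⟨i, hi⟩ : ∃ i, M ≤ p ^ i := ⟨M, (Nat.lt_pow_self hp.out.one_lt).le⟩
  set Q := p ^ (j + i)
  have hQ0 : 0 < Q := by have := hp.out.pos; positivity
  set w := te p f (rt p (j + i) f)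
  have hw : w ^ Q = p := by rw [← map_pow, rt_pow, te_f]
  have hwu : IsUnit (algebraMap _ L w) := by
    rw [← hw, map_pow] at hu
    exact (isUnit_pow_iff hQ0.ne').mp hu
  have key : ∀ r, (∃ e : EE p f, algebraMap _ L w ^ (M + r) * y = algebraMap _ L e) →
      ∃ e : EE p f, algebraMap _ L w ^ M * y = algebraMap _ L e := by
    intro r
    induction r with
    | zero => exact id
    | succ r ih =>
      rintro ⟨z, hz⟩
      apply ih
      obtain ⟨e, he⟩ := hM Q
      have : (p : EE p f) ∣ z ^ Q := by
        refine ⟨p ^ r * e, hinj ?_⟩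
        rw [map_pow, ← hz, map_mul, map_mul, ← he, mul_pow, ← pow_mul, mul_comm _ Q, pow_mul, ← map_pow,
          hw, map_pow, pow_add, pow_add]
        ring
      obtain ⟨z', rfl⟩ := E_root _ this
      refine ⟨z', ?_⟩
      rw [map_mul] at hz
      apply hwu.mul_left_cancel
      rw [← hz]; ring
  obtain ⟨e, he⟩ := hM 1
  obtain ⟨e', he'⟩ := key (Q * M - M) ⟨e, by
    rw [Nat.add_sub_cancel' (Nat.le_mul_of_pos_left _ hQ0), pow_mul, ← map_pow, hw, ← he, pow_one]⟩
  have h3 : te p f (rt p j f) = w ^ M * w ^ (p ^ i - M) := by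
    rw [← pow_add, Nat.add_sub_cancel' hi, ← map_pow, rt_add_pow]
  refine ⟨e' * w ^ (p ^ i - M), ?_⟩
  rw [h3, map_mul, map_mul, ← he', map_pow]; ring
variable {𝒩 : Type*} [CommRing 𝒩] [CharP 𝒩 p] [PerfectRing 𝒩 p]
def PSub (p : ℕ) [Fact p.Prime] {𝒩 : Type*} [CommRing 𝒩] [CharP 𝒩 p] [PerfectRing 𝒩 p]
    (N : Subring 𝒩) : Prop := ∀ x ∈ N, ∀ j, rt p j x ∈ N
lemma N_almost {N : Subring 𝒩} (hN : PSub p N) {f : 𝒩} (hf : f ∈ N) {y : 𝒩}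
    (hy : IsIntegral N y) (hden : f * y ∈ N) (j : ℕ) : rt p j f * y ∈ N := by
  obtain ⟨M, hM⟩ := exists_bound (⟨f, hf⟩ : N) y hy ⟨1, ⟨_, hden⟩, by rw [pow_one]; rfl⟩
  obtain ⟨i, hi⟩ : ∃ i, M ≤ p ^ i := ⟨M, (Nat.lt_pow_self hp.out.one_lt).le⟩
  obtain ⟨e, he⟩ := hM (p ^ (j + i))
  have h1 : rt p (j + i) f ^ M * y ∈ N := by
    have : rt p (j + i) f ^ M * y = rt p (j + i) (e : 𝒩) := by
      apply rt_unique
      rw [mul_pow, ← pow_mul, mul_comm M, pow_mul, rt_pow]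
      exact he
    rw [this]
    exact hN _ e.2 _
  have h3 : rt p j f = rt p (j + i) f ^ M * rt p (j + i) f ^ (p ^ i - M) := by
    rw [← pow_add, Nat.add_sub_cancel' hi, rt_add_pow]
  rw [h3, mul_right_comm]
  exact N.mul_mem h1 (N.pow_mem (hN _ hf _) _)
def Nw (p : ℕ) [Fact p.Prime] {𝒩 : Type*} [CommRing 𝒩] [CharP 𝒩 p] [PerfectRing 𝒩 p]
    (N : Subring 𝒩) (w : 𝒩) : Subring 𝒩 :=
  Subring.closure ((N : Set 𝒩) ∪ Set.range fun l => rt p l w)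
lemma le_Nw (N : Subring 𝒩) (w : 𝒩) : N ≤ Nw p N w :=
  fun _ hx => Subring.subset_closure (Or.inl hx)
lemma rt_mem_Nw (N : Subring 𝒩) (w : 𝒩) (l : ℕ) : rt p l w ∈ Nw p N w :=
  Subring.subset_closure (Or.inr ⟨l, rfl⟩)
lemma Nw_psub {N : Subring 𝒩} (hN : PSub p N) (w : 𝒩) : PSub p (Nw p N w) := by
  intro x hx j
  induction hx using Subring.closure_induction with
  | mem x hx =>
    rcases hx with hx | ⟨l, rfl⟩
    · exact le_Nw _ _ (hN _ hx _)
    · simp only [rt_rt]; exact rt_mem_Nw _ _ _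
  | zero => rw [map_zero]; exact Subring.zero_mem _
  | one => rw [map_one]; exact Subring.one_mem _
  | add x y _ _ hx hy => rw [map_add]; exact Subring.add_mem _ hx hy
  | neg x _ hx => rw [map_neg]; exact Subring.neg_mem _ hx
  | mul x y _ _ hx hy => rw [map_mul]; exact Subring.mul_mem _ hx hy
lemma Nw_exists {N : Subring 𝒩} {w x : 𝒩} (hx : x ∈ Nw p N w) :
    ∃ l0, ∀ l, l0 ≤ l → ∃ P : N[X], x = P.eval₂ N.subtype (rt p l w) := by
  induction hx using Subring.closure_induction with
  | mem x hx =>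
    rcases hx with hx | ⟨l, rfl⟩
    · exact ⟨0, fun l _ => ⟨C ⟨x, hx⟩, by simp⟩⟩
    · refine ⟨l, fun l' hl => ⟨X ^ (p ^ (l' - l)), ?_⟩⟩
      rw [eval₂_pow, eval₂_X]
      obtain ⟨m, rfl⟩ := Nat.exists_eq_add_of_le hl
      rw [Nat.add_sub_cancel_left, rt_add_pow]
  | zero => exact ⟨0, fun l _ => ⟨0, by simp⟩⟩
  | one => exact ⟨0, fun l _ => ⟨1, by simp⟩⟩
  | add x y _ _ hx hy =>
    obtain ⟨a, ha⟩ := hx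
    obtain ⟨b, hb⟩ := hy
    refine ⟨max a b, fun l hl => ?_⟩
    obtain ⟨P, rfl⟩ := ha l (le_trans (le_max_left _ _) hl)
    obtain ⟨Q, rfl⟩ := hb l (le_trans (le_max_right _ _) hl)
    exact ⟨P + Q, by rw [eval₂_add]⟩
  | neg x _ hx =>
    obtain ⟨a, ha⟩ := hx
    refine ⟨a, fun l hl => ?_⟩
    obtain ⟨P, rfl⟩ := ha l hl
    exact ⟨-P, by rw [eval₂_neg]⟩
  | mul x y _ _ hx hy =>
    obtain ⟨a, ha⟩ := hx
    obtain ⟨b, hb⟩ := hy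
    refine ⟨max a b, fun l hl => ?_⟩
    obtain ⟨P, rfl⟩ := ha l (le_trans (le_max_left _ _) hl)
    obtain ⟨Q, rfl⟩ := hb l (le_trans (le_max_right _ _) hl)
    exact ⟨P * Q, by rw [eval₂_mul]⟩
lemma F3 {N : Subring 𝒩} (hN : PSub p N) {f g gi : 𝒩} (hf : f ∈ N) (hg : g ∈ N) (hgi : g * gi = 1)
    (j : ℕ) {v : 𝒩} (hv : v ∈ Nw p N (f ^ (2 * p ^ j) * gi)) :
    ∃ a ∈ N, ∃ b ∈ Nw p N (f ^ (p ^ j) * gi), rt p j g * v = a + f * b := by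
  obtain ⟨l0, hl0⟩ := Nw_exists hv
  set l := l0 + j with hl
  obtain ⟨P, hP⟩ := hl0 l (by omega)
  rw [hP]
  clear hP hl0 hv
  set Nq := Nw p N (f ^ (p ^ j) * gi)
  have hNq : N ≤ Nq := le_Nw _ _
  induction P using Polynomial.induction_on' with
  | add P Q hP hQ =>
    obtain ⟨a, ha, b, hb, h⟩ := hP
    obtain ⟨a', ha', b', hb', h'⟩ := hQ
    exact ⟨_, N.add_mem ha ha', _, Nq.add_mem hb hb', by rw [eval₂_add, mul_add, h, h']; ring⟩
  | monomial i c =>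
    rw [eval₂_monomial, map_mul, map_pow]
    set f1 := rt p l f with hf1
    set g1 := rt p l g
    set h1 := rt p l gi
    have hgh : g1 * h1 = 1 := by rw [← map_mul, hgi, map_one]
    have hs : rt p j g = g1 ^ (p ^ l0) := by
      exact (rt_add_pow' _ _ _).symm
    have hff : f1 ^ (p ^ l) = f := rt_pow _ _
    have f1N : f1 ∈ N := hN _ hf _
    have g1N : g1 ∈ N := hN _ hg _
    rw [hs]
    rcases le_total i (p ^ l0) with hi | hi
    · refine ⟨c * f1 ^ (2 * p ^ j * i) * g1 ^ (p ^ l0 - i), ?_, 0, Nq.zero_mem, ?_⟩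
      · exact N.mul_mem (N.mul_mem c.2 (N.pow_mem f1N _)) (N.pow_mem g1N _)
      · have : g1 ^ (p ^ l0) = g1 ^ (p ^ l0 - i) * g1 ^ i := by
          rw [← pow_add, Nat.sub_add_cancel hi]
        have h2 : g1 ^ i * h1 ^ i = 1 := by rw [← mul_pow, hgh, one_pow]
        rw [this, mul_pow, ← pow_mul, mul_zero, add_zero]
        simp only [Subring.subtype_apply]
        linear_combination (c * f1 ^ (2 * p ^ j * i) * g1 ^ (p ^ l0 - i)) * h2
    · have hle : p ^ l ≤ p ^ j * i := by
        rw [hl, add_comm, pow_add]; exact Nat.mul_le_mul_left _ hi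
      refine ⟨0, N.zero_mem, c * g1 ^ (p ^ l0) * f1 ^ (p ^ j * i - p ^ l) *
        (f1 ^ (p ^ j) * h1) ^ i, ?_, ?_⟩
      · refine Nq.mul_mem (hNq (N.mul_mem (N.mul_mem c.2 (N.pow_mem g1N _)) (N.pow_mem f1N _)))
          (Nq.pow_mem ?_ _)
        rw [← map_pow, ← map_mul]
        exact rt_mem_Nw _ _ _
      · rw [mul_pow, mul_pow, ← pow_mul, ← pow_mul]
        have : f1 ^ (2 * p ^ j * i) = f * f1 ^ (p ^ j * i - p ^ l) * f1 ^ (p ^ j * i) := by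
          nth_rw 1 [← hff]
          rw [← pow_add, ← pow_add]
          congr 1
          rw [Nat.add_sub_cancel' hle]; ring
        rw [this]
        simp only [Subring.subtype_apply]
        ring
lemma F4 {N : Subring 𝒩} (hN : PSub p N) {f g gi : 𝒩} (hf : f ∈ N) (hg : g ∈ N) (hgi : g * gi = 1)
    (j : ℕ) {z b : 𝒩} (hz : z ∈ N) (hb : b ∈ Nw p N (f ^ (p ^ j) * gi))
    (hzb : z = f * b) : ∃ c ∈ N, rt p j (f * g) * z = f * c := by
  obtain ⟨l0, hl0⟩ := Nw_exists hb
  set l := l0 + j with hl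
  obtain ⟨P, hP⟩ := hl0 l (by omega)
  set s := rt p j g
  have sN : s ∈ N := hN _ hg _
  set w1 := rt p l (f ^ (p ^ j) * gi)
  have hw : s * w1 ^ (p ^ l0) = f := by
    rw [show w1 ^ (p ^ l0) = rt p j (f ^ (p ^ j) * gi) from rt_add_pow' _ _ _, ← map_mul]
    rw [show g * (f ^ p ^ j * gi) = f ^ p ^ j * (g * gi) by ring, hgi, mul_one, rt_pow_self]
  set y := s * b
  set y1 := rt p l0 y
  set z1 := rt p l0 z
  have hz1 : y1 * w1 = z1 := by
    apply rt_unique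
    rw [mul_pow, rt_pow, hzb, ← hw]; ring
  have z1N : z1 ∈ N := hN _ hz _
  have hy1 : y1 ^ (p ^ l0) = y := rt_pow _ _
  have hint : IsIntegral N y1 := by
    set D := p ^ l0 + P.natDegree
    have hq0 : 0 < p ^ l0 := by have := hp.out.pos; positivity
    have hexp : y1 ^ (p ^ l0 + D) =
        ∑ i ∈ Finset.range (P.natDegree + 1),
          if i < p ^ l0 then ((P.coeff i : 𝒩) * s * z1 ^ i) * y1 ^ (D - i)
            else ((P.coeff i : 𝒩) * f * z1 ^ (i - p ^ l0)) * y1 ^ (D - (i - p ^ l0)) := by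
      rw [pow_add, hy1]
      simp only [y]
      rw [hP, eval₂_eq_sum_range, Finset.mul_sum, Finset.sum_mul]
      refine Finset.sum_congr rfl fun i hi => ?_
      have hi := Finset.mem_range.mp hi
      split_ifs with h
      · have : y1 ^ D = y1 ^ (D - i) * y1 ^ i := by rw [← pow_add]; congr 1; omega
        rw [this, ← hz1, mul_pow]; simp only [Subring.subtype_apply]; ring
      · have h1 : y1 ^ D = y1 ^ (D - (i - p ^ l0)) * y1 ^ (i - p ^ l0) := by
          rw [← pow_add]; congr 1; omega
        have h2 : w1 ^ i = w1 ^ (p ^ l0) * w1 ^ (i - p ^ l0) := by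
          rw [← pow_add]; congr 1; omega
        rw [h1, h2, ← hz1, mul_pow, ← hw]; simp only [Subring.subtype_apply]; ring
    let cf : ℕ → N := fun i => if i < p ^ l0 then P.coeff i * ⟨s, sN⟩ * ⟨z1, z1N⟩ ^ i
      else P.coeff i * ⟨f, hf⟩ * ⟨z1, z1N⟩ ^ (i - p ^ l0)
    let ex : ℕ → ℕ := fun i => if i < p ^ l0 then D - i else D - (i - p ^ l0)
    refine ⟨X ^ (p ^ l0 + D) - ∑ i ∈ Finset.range (P.natDegree + 1), C (cf i) * X ^ (ex i), ?_, ?_⟩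
    · apply monic_X_pow_sub
      refine (degree_sum_le _ _).trans_lt ?_
      rw [Finset.sup_lt_iff (WithBot.bot_lt_coe _)]
      intro i hi
      refine (degree_C_mul_X_pow_le _ _).trans_lt ?_
      simp only [ex]
      split_ifs <;> exact_mod_cast (by omega)
    · rw [eval₂_sub, eval₂_pow, eval₂_X, hexp, sub_eq_zero, eval₂_finsetSum]
      refine Finset.sum_congr rfl fun i hi => ?_
      rw [eval₂_mul, eval₂_C, eval₂_pow, eval₂_X]
      simp only [cf, ex]
      split_ifs <;> rfl
  have hinty : IsIntegral N y := by rw [← hy1]; exact hint.pow _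
  have hfy : f * y ∈ N := by
    have : f * y = s * z := by rw [hzb]; ring
    rw [this]; exact N.mul_mem sN hz
  refine ⟨_, N_almost hN hf hinty hfy j, ?_⟩
  rw [map_mul, hzb]; ring
end
end ACM
/-! ## The rings E_n and L_n, lifting and descent -/
namespace ACM
open WittVector Polynomial
section
variable {p : ℕ} [hp : Fact p.Prime]
variable {K : Type*} [CommRing K] [CharP K p] [PerfectRing K p]
variable {L : Type*} [CommRing L] [CharP L p] [PerfectRing L p]
variable {M : Type*} [CommRing M] [CharP M p] [PerfectRing M p]
noncomputable def EEmap (φ : K →+* L) {f : K} {f' : L} (h : φ f = f') : EE p f →+* EE p f' :=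
  Ideal.quotientMap _ (WittVector.map φ) (by
    rw [Ideal.span_singleton_le_iff_mem, Ideal.mem_comap, map_sub, map_natCast, map_teichmuller, h]
    exact Ideal.mem_span_singleton_self _)
lemma EEmap_mk (φ : K →+* L) {f : K} {f' : L} (h : φ f = f') (z : WittVector p K) :
    EEmap φ h (Ideal.Quotient.mk _ z) = Ideal.Quotient.mk _ (WittVector.map φ z) := rfl
lemma EEmap_te (φ : K →+* L) {f : K} {f' : L} (h : φ f = f') (x : K) :
    EEmap φ h (te p f x) = te p f' (φ x) := by
  rw [te_def, EEmap_mk, map_teichmuller, te_def]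
lemma EEmap_comp (φ : K →+* L) (ψ : L →+* M) {f : K} {f' : L} {f'' : M} (h : φ f = f')
    (h' : ψ f' = f'') (z : EE p f) : EEmap ψ h' (EEmap φ h z) =
      EEmap (p := p) (ψ.comp φ) (by rw [RingHom.comp_apply, h, h']) z := by
  obtain ⟨z, rfl⟩ := Ideal.Quotient.mk_surjective z
  rfl
abbrev LL (p : ℕ) [Fact p.Prime] {K : Type*} [CommRing K] [CharP K p] [PerfectRing K p] (f : K) :
    Type _ := Localization.Away (p : EE p f)
noncomputable def LLmap (φ : K →+* L) {f : K} {f' : L} (h : φ f = f') : LL p f →+* LL p f' :=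
  IsLocalization.Away.lift (p : EE p f) (g := (algebraMap (EE p f') (LL p f')).comp (EEmap φ h)) (by
    rw [map_natCast, ← map_natCast (algebraMap (EE p f') (LL p f'))]
    exact IsLocalization.Away.algebraMap_isUnit _)
lemma LLmap_algebraMap (φ : K →+* L) {f : K} {f' : L} (h : φ f = f') (z : EE p f) :
    LLmap φ h (algebraMap _ _ z) = algebraMap _ (LL p f') (EEmap φ h z) :=
  IsLocalization.Away.lift_eq _ _ _
lemma LL_unit (f : K) : IsUnit (p : LL p f) := by
  have := IsLocalization.Away.algebraMap_isUnit (S := LL p f) (p : EE p f)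
  rwa [map_natCast] at this
lemma LL_inj {f : K} (hf : ∀ k : K, f * k = 0 → k = 0) :
    Function.Injective (algebraMap (EE p f) (LL p f)) := by
  apply IsLocalization.injective (M := Submonoid.powers (p : EE p f))
  rintro _ ⟨n, rfl⟩
  have : (p : EE p f) ∈ nonZeroDivisors (EE p f) := by
    rw [mem_nonZeroDivisors_iff_right]
    intro z hz
    exact E_p_nzd hf (by rw [mul_comm]; exact hz)
  exact pow_mem this n
lemma LL_almost {f : K} (hf : ∀ k : K, f * k = 0 → k = 0) (y : LL p f) (hy : IsIntegral (EE p f) y)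
    (j : ℕ) : ∃ e : EE p f, algebraMap _ _ (te p f (rt p j f)) * y = algebraMap _ _ e := by
  refine E_almost (IsLocalization.Away.algebraMap_isUnit _) y hy ?_ (LL_inj hf) j
  obtain ⟨n, a, h⟩ := IsLocalization.Away.surj (p : EE p f) y
  exact ⟨n, a, by rw [mul_comm]; exact h⟩
end
section
variable {p : ℕ} [hp : Fact p.Prime]
variable {𝒩 : Type*} [CommRing 𝒩] [CharP 𝒩 p] [PerfectRing 𝒩 p]
instance subCharP (N : Subring 𝒩) : CharP N p := inferInstance
lemma PSub.perfect {N : Subring 𝒩} (hN : PSub p N) : PerfectRing N p where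
  bijective_frobenius := by
    constructor
    · intro x y h
      apply Subtype.ext
      apply pow_inj (p := p) 1
      have := congrArg Subtype.val h
      simpa [frobenius_def] using this
    · intro x
      refine ⟨⟨rt p 1 x, hN _ x.2 1⟩, Subtype.ext ?_⟩
      have := rt_pow (p := p) 1 (x : 𝒩)
      simpa [frobenius_def] using this
structure REdata (p : ℕ) [Fact p.Prime] (𝒩 : Type*) [CommRing 𝒩] [CharP 𝒩 p] [PerfectRing 𝒩 p] where
  N : Subring 𝒩
  hN : PSub p N
  f : 𝒩
  g : 𝒩
  fi : 𝒩
  gi : 𝒩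
  hf : f ∈ N
  hg : g ∈ N
  hfi : f * fi = 1
  hgi : g * gi = 1
namespace REdata
variable (D : REdata p 𝒩)
abbrev Nn (n : ℕ) : Subring 𝒩 := Nw p D.N (D.f ^ n * D.gi)
instance (n : ℕ) : PerfectRing (D.Nn n) p := (Nw_psub D.hN _).perfect
instance : PerfectRing D.N p := D.hN.perfect
def f0 : D.N := ⟨D.f, D.hf⟩
def g0 : D.N := ⟨D.g, D.hg⟩
def inc (n : ℕ) : D.N →+* D.Nn n := Subring.inclusion (le_Nw _ _)
def fn (n : ℕ) : D.Nn n := D.inc n D.f0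
lemma inc_f (n : ℕ) : D.inc n D.f0 = D.fn n := rfl
lemma nzd (n : ℕ) (k : D.Nn n) (h : D.fn n * k = 0) : k = 0 := by
  have h1 : D.f * (k : 𝒩) = 0 := congrArg Subtype.val h
  apply Subtype.ext
  have : (k : 𝒩) = D.fi * (D.f * k) + (1 - D.f * D.fi) * k := by ring
  rw [this, h1, D.hfi]; simp
lemma Nn_le {m n : ℕ} (h : m ≤ n) : D.Nn n ≤ D.Nn m := by
  apply Subring.closure_le.mpr
  rintro x (hx | ⟨l, rfl⟩)
  · exact le_Nw _ _ hx
  · have : D.f ^ n * D.gi = D.f ^ (n - m) * (D.f ^ m * D.gi) := by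
      rw [← mul_assoc, ← pow_add, Nat.sub_add_cancel h]
    simp only [this]
    rw [map_mul]
    refine Subring.mul_mem _ (le_Nw _ _ (D.hN _ (pow_mem D.hf _) _)) (rt_mem_Nw _ _ _)
def tr {m n : ℕ} (h : m ≤ n) : D.Nn n →+* D.Nn m := Subring.inclusion (D.Nn_le h)
lemma tr_fn {m n : ℕ} (h : m ≤ n) : D.tr h (D.fn n) = D.fn m := rfl
lemma rt_coe {n : ℕ} (j : ℕ) (x : D.Nn n) : ((rt p j x : D.Nn n) : 𝒩) = rt p j (x : 𝒩) :=
  rt_map (p := p) (D.Nn n).subtype j x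
lemma rt_coe0 (j : ℕ) (x : D.N) : ((rt p j x : D.N) : 𝒩) = rt p j (x : 𝒩) :=
  rt_map (p := p) D.N.subtype j x
lemma g_unit (n : ℕ) : IsUnit (algebraMap _ (LL p (D.fn n)) (te p (D.fn n) (D.inc n D.g0))) := by
  have h1 : D.inc n D.g0 * ⟨D.f ^ n * D.gi, by
      have := rt_mem_Nw (p := p) D.N (D.f ^ n * D.gi) 0
      rwa [show rt p 0 (D.f ^ n * D.gi) = D.f ^ n * D.gi from (rt_unique (by simp)).symm] at this⟩
      = D.fn n ^ n := by
    apply Subtype.ext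
    change D.g * (D.f ^ n * D.gi) = D.f ^ n
    rw [mul_left_comm, D.hgi, mul_one]
  have h2 := congrArg (fun x => algebraMap _ (LL p (D.fn n)) (te p (D.fn n) x)) h1
  simp only [map_mul, map_pow, te_f, map_natCast] at h2
  exact isUnit_of_mul_isUnit_left (h2 ▸ (LL_unit _).pow n)
theorem lift (j : ℕ) (y : LL p (D.fn (2 * p ^ j))) (hy : IsIntegral (EE p (D.fn (2 * p ^ j))) y) :
    ∃ (a : D.N) (e : EE p (D.fn (p ^ j))),
      algebraMap _ (LL p (D.fn (p ^ j))) (te p (D.fn (p ^ j)) (D.inc (p ^ j) a)) =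
       algebraMap _ (LL p (D.fn (p ^ j))) (te p (D.fn (p ^ j)) (D.inc (p ^ j) (rt p j (D.f0 * D.g0)))) *
        LLmap (D.tr (by omega)) (D.tr_fn _) y + algebraMap _ (LL p (D.fn (p ^ j))) (p * e) := by
  obtain ⟨y1, hy1⟩ := LL_almost (D.nzd _) y hy j
  obtain ⟨v, w, hvw⟩ := E_exists y1
  obtain ⟨a, ha, b, hb, hab⟩ := F3 D.hN D.hf D.hg D.hgi j v.2
  have hle : p ^ j ≤ 2 * p ^ j := by omega
  set L1 := LL p (D.fn (p ^ j))
  have hy2 := congrArg (LLmap (D.tr hle) (D.tr_fn hle)) hy1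
  rw [map_mul, LLmap_algebraMap, LLmap_algebraMap, EEmap_te, hvw, map_add, EEmap_te, map_mul, map_natCast] at hy2
  -- te (g^{1/q} v) = te (a) mod p
  have h3 : (p : EE p (D.fn (p ^ j))) ∣ te p _ (D.inc _ (rt p j D.g0)) * te p _ (D.tr hle v)
      - te p _ (D.inc _ ⟨a, ha⟩) := by
    rw [← red_eq_zero, map_sub, ← map_mul, red_te, red_te, ← map_sub, Ideal.Quotient.eq_zero_iff_mem,
      Ideal.mem_span_singleton]
    refine ⟨⟨b, hb⟩, Subtype.ext ?_⟩
    change (rt p j D.g0 : D.N) * (v : 𝒩) - a = D.f * b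
    rw [rt_coe0]
    change rt p j D.g * (v : 𝒩) - a = D.f * b
    rw [hab]; ring
  obtain ⟨e, he⟩ := h3
  refine ⟨⟨a, ha⟩, -te p _ (D.inc _ (rt p j D.g0)) * EEmap (D.tr hle) (D.tr_fn hle) w - e, ?_⟩
  have hrt : D.tr hle (rt p j (D.fn (2 * p ^ j))) = D.inc _ (rt p j D.f0) := by
    rw [rt_map, tr_fn, rt_map]; rfl
  rw [hrt] at hy2
  rw [map_mul, map_mul, map_mul, map_mul, mul_assoc, mul_comm (algebraMap _ L1 (te p _ (D.inc _ (rt p j D.f0)))),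
    mul_assoc, mul_comm _ (algebraMap _ L1 (te p _ (D.inc _ (rt p j D.f0)))), hy2,
    ← map_mul, ← map_add]
  congr 1
  linear_combination -he
theorem down (j : ℕ) (z : EE p D.f0) (hz : (p : EE p (D.fn (p ^ j))) ∣ EEmap (D.inc (p ^ j)) (D.inc_f _) z) :
    (p : EE p D.f0) ∣ te p _ (rt p j (D.f0 * D.g0)) * z := by
  obtain ⟨k, w, rfl⟩ := E_exists z
  rw [map_add, EEmap_te, map_mul, map_natCast, dvd_add_left (dvd_mul_right _ _), ← red_eq_zero, red_te,
    Ideal.Quotient.eq_zero_iff_mem, Ideal.mem_span_singleton] at hz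
  obtain ⟨b, hb⟩ := hz
  obtain ⟨c, hc, h⟩ := F4 D.hN D.hf D.hg D.hgi j k.2 b.2 (congrArg Subtype.val hb)
  rw [mul_add]
  refine dvd_add ?_ (dvd_mul_of_dvd_right (dvd_mul_right _ _) _)
  rw [← map_mul, ← red_eq_zero, red_te, Ideal.Quotient.eq_zero_iff_mem, Ideal.mem_span_singleton]
  refine ⟨⟨c, hc⟩, Subtype.ext ?_⟩
  change (rt p j (D.f0 * D.g0) : D.N) * (k : 𝒩) = D.f * c
  rw [rt_coe0, ← h]; rfl
end REdata
end
end ACM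
/-! ## Free ring homs -/
namespace ACM
open Polynomial
def FreeHom {A B : Type*} [CommRing A] [CommRing B] (φ : A →+* B) : Prop :=
  letI := φ.toAlgebra; Module.Free A B
lemma FreeHom.comp {A B C : Type*} [CommRing A] [CommRing B] [CommRing C] {φ : A →+* B}
    {ψ : B →+* C} (h : FreeHom φ) (h' : FreeHom ψ) : FreeHom (ψ.comp φ) := by
  letI := φ.toAlgebra
  letI := ψ.toAlgebra
  letI := (ψ.comp φ).toAlgebra
  haveI : IsScalarTower A B C := IsScalarTower.of_algebraMap_eq fun _ => rfl
  haveI : Module.Free A B := h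
  haveI : Module.Free B C := h'
  exact Module.Free.trans (S := B)
lemma FreeHom.of_equiv {A B : Type*} [CommRing A] [CommRing B] (φ : A ≃+* B) :
    FreeHom φ.toRingHom := by
  letI := φ.toRingHom.toAlgebra
  have e : A ≃ₗ[A] B := { φ.toAddEquiv with map_smul' := fun a b => map_mul φ a b }
  exact Module.Free.of_equiv e
attribute [local instance] MvPolynomial.algebraMvPolynomial in
lemma FreeHom.mvPoly {A B : Type*} [CommRing A] [CommRing B] {φ : A →+* B} (σ : Type*)
    (h : FreeHom φ) : FreeHom (MvPolynomial.map (σ := σ) φ) := by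
  letI := φ.toAlgebra
  haveI : Module.Free A B := h
  have h1 : Algebra.IsPushout A (MvPolynomial σ A) B (MvPolynomial σ B) := inferInstance
  have : Module.Free (MvPolynomial σ A) (MvPolynomial σ B) := h1.out.free
  exact this
lemma FreeHom.exists.{uA, uB} {A : Type uA} {B : Type uB} [CommRing A] [CommRing B] {φ : A →+* B} (h : FreeHom φ) :
    ∃ (κ : Type uB) (e : κ → B), (∀ b, ∃ z : κ →₀ A, b = z.sum fun k c => φ c * e k) ∧
      ∀ z : κ →₀ A, (z.sum fun k c => φ c * e k) = 0 → z = 0 := by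
  letI := φ.toAlgebra
  haveI : Module.Free A B := h
  let b := Module.Free.chooseBasis A B
  refine ⟨_, b, fun x => ⟨b.repr x, ?_⟩, fun z hz => ?_⟩
  · exact (b.linearCombination_repr x).symm
  · have := b.linearIndependent
    rw [linearIndependent_iff] at this
    exact this z hz
lemma FreeHom.mk {A B κ : Type*} [CommRing A] [CommRing B] {φ : A →+* B} (e : κ → B)
    (h1 : ∀ b, ∃ z : κ →₀ A, b = z.sum fun k c => φ c * e k)
    (h2 : ∀ z : κ →₀ A, (z.sum fun k c => φ c * e k) = 0 → z = 0) : FreeHom φ := by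
  letI := φ.toAlgebra
  have li : LinearIndependent A e := by
    rw [linearIndependent_iff]; exact h2
  refine Module.Free.of_basis (Module.Basis.mk li ?_)
  intro b _
  obtain ⟨z, rfl⟩ := h1 b
  rw [Finsupp.mem_span_range_iff_exists_finsupp]
  exact ⟨z, rfl⟩
lemma freeHom_expand (S : Type*) [CommRing S] (p : ℕ) (hp : 0 < p) :
    FreeHom (MvPolynomial.expand (σ := ℕ) (R := S) p).toRingHom := by
  classical
  refine FreeHom.mk (κ := {r : ℕ →₀ ℕ // ∀ i, r i < p}) (fun r => MvPolynomial.monomial r.1 1) ?_ ?_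
  · intro b
    induction b using MvPolynomial.induction_on' with
    | monomial m c =>
      let r : {r : ℕ →₀ ℕ // ∀ i, r i < p} := ⟨m.mapRange (· % p) (Nat.zero_mod p), fun i => Nat.mod_lt _ hp⟩
      let a : ℕ →₀ ℕ := m.mapRange (· / p) (Nat.zero_div p)
      refine ⟨Finsupp.single r (MvPolynomial.monomial a c), ?_⟩
      rw [Finsupp.sum_single_index (by simp)]
      change _ = MvPolynomial.expand p _ * _
      rw [MvPolynomial.expand_monomial, MvPolynomial.monomial_mul, mul_one]
      have : m = p • a + r.1 := by
        ext i
        exact (Nat.div_add_mod (m i) p).symm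
      rw [← this]
    | add x y hx hy =>
      obtain ⟨z, rfl⟩ := hx
      obtain ⟨z', rfl⟩ := hy
      refine ⟨z + z', ?_⟩
      rw [Finsupp.sum_add_index'] <;> intros <;> simp [add_mul]
  · intro z hz
    ext r0 a : 2
    have := congrArg (MvPolynomial.coeff (p • a + r0.1)) hz
    rw [Finsupp.sum, MvPolynomial.coeff_sum, MvPolynomial.coeff_zero] at this
    rw [Finset.sum_eq_single r0] at this
    · have h2 : MvPolynomial.coeff (p • a + r0.1) (MvPolynomial.expand p (z r0) * MvPolynomial.monomial r0.1 1) = 0 := this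
      rw [MvPolynomial.coeff_mul_monomial, MvPolynomial.coeff_expand_smul _ hp.ne', mul_one] at h2
      exact h2
    · intro r _ hr
      change MvPolynomial.coeff (p • a + r0.1) (MvPolynomial.expand p (z r) * MvPolynomial.monomial r.1 1) = 0
      rw [MvPolynomial.coeff_mul_monomial']
      split_ifs with h
      · obtain ⟨i, hi⟩ : ∃ i, r.1 i ≠ r0.1 i := by
          by_contra! hh
          exact hr (Subtype.ext (Finsupp.ext hh))
        rw [mul_one]
        apply MvPolynomial.coeff_expand_of_not_dvd (i := i)
        intro hd
        apply hi
        have hle := h i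
        simp only [Finsupp.coe_tsub, Finsupp.coe_add, Finsupp.coe_smul, Pi.sub_apply, Pi.add_apply,
          Pi.smul_apply, smul_eq_mul] at hd hle
        have h1 : r.1 i ≡ p * a i + r0.1 i [MOD p] := (Nat.modEq_iff_dvd' hle).mpr hd
        have h2 : p * a i + r0.1 i ≡ r0.1 i [MOD p] := by simp [Nat.ModEq]
        have h3 := h1.trans h2
        rwa [Nat.ModEq, Nat.mod_eq_of_lt (r.2 i), Nat.mod_eq_of_lt (r0.2 i)] at h3
      · rfl
    · intro h
      simp only [Finsupp.notMem_support_iff] at h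
      simp [h]
lemma freeHom_comp {S : Type*} [CommRing S] (w : S[X]) (hw : w.Monic) (hD : 0 < w.natDegree) :
    FreeHom (compRingHom w) := by
  classical
  haveI : Nontrivial S := by
    by_contra h
    rw [not_nontrivial_iff_subsingleton] at h
    rw [natDegree_of_subsingleton] at hD
    exact absurd hD (lt_irrefl _)
  set D := w.natDegree
  have key : ∀ n, ∀ z : Fin D → S[X], (∀ i, (z i).natDegree < n ∨ z i = 0) →
      (∑ i, (z i).comp w * X ^ (i : ℕ)) = 0 → ∀ i, z i = 0 := by
    intro n
    induction n with
    | zero => intro z hz _ i; simpa using hz i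
    | succ n ih =>
      intro z hz hs
      have h1 : (∑ i, (z i).comp w * X ^ (i : ℕ)) =
          w * (∑ i, (divX (z i)).comp w * X ^ (i : ℕ)) + ∑ i : Fin D, C ((z i).coeff 0) * X ^ (i : ℕ) := by
        rw [Finset.mul_sum, ← Finset.sum_add_distrib]
        refine Finset.sum_congr rfl fun i _ => ?_
        conv_lhs => rw [← divX_mul_X_add (z i)]
        simp; ring
      rw [hs] at h1
      have hdeg : (∑ i : Fin D, C ((z i).coeff 0) * X ^ (i : ℕ)).degree < w.degree := by
        rw [degree_eq_natDegree hw.ne_zero]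
        exact degree_sum_fin_lt _
      have hr : (∑ i : Fin D, C ((z i).coeff 0) * X ^ (i : ℕ)) = 0 := by
        have hdvd : w ∣ ∑ i : Fin D, C ((z i).coeff 0) * X ^ (i : ℕ) :=
          ⟨-(∑ i, (divX (z i)).comp w * X ^ (i : ℕ)), by linear_combination h1.symm⟩
        have := (modByMonic_eq_zero_iff_dvd hw).mpr hdvd
        rwa [(modByMonic_eq_self_iff hw).mpr hdeg] at this
      rw [hr, add_zero] at h1
      have h2 : (∑ i, (divX (z i)).comp w * X ^ (i : ℕ)) = 0 := by
        have := hw.mul_right_eq_zero_iff.mp h1.symm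
        exact this
      have h3 := ih (fun i => divX (z i)) (fun i => by
        rcases hz i with h | h
        · rw [natDegree_divX_eq_natDegree_tsub_one]
          by_cases h0 : (z i).natDegree = 0
          · right
            rw [eq_C_of_natDegree_eq_zero h0, divX_C]
          · left; omega
        · right; simp [h]) h2
      intro i
      rw [← divX_mul_X_add (z i), h3 i, zero_mul, zero_add, C_eq_zero]
      have := congrArg (fun q => coeff q i.1) hr
      simp only [finsetSum_coeff, coeff_C_mul, coeff_X_pow, coeff_zero] at this
      rw [Finset.sum_eq_single i] at this
      · simpa using this
      · intro b _ hb
        rw [if_neg (fun h => hb (Fin.ext h.symm)), mul_zero]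
      · simp
  refine FreeHom.mk (κ := Fin D) (fun i => X ^ (i : ℕ)) ?_ ?_
  · intro b
    suffices ∃ z : Fin D → S[X], b = ∑ i, (z i).comp w * X ^ (i : ℕ) by
      obtain ⟨z, hz⟩ := this
      refine ⟨Finsupp.equivFunOnFinite.symm z, ?_⟩
      rw [Finsupp.sum_fintype _ _ (by simp)]
      simpa using hz
    induction h : b.natDegree using Nat.strong_induction_on generalizing b with
    | _ n ih =>
      have hmod : b %ₘ w = ∑ i : Fin D, C ((b %ₘ w).coeff i) * X ^ (i : ℕ) := by
        conv_lhs => rw [as_sum_range' (b %ₘ w) D (natDegree_modByMonic_lt b hw (fun h => by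
          have : D = 0 := by simp [D, h]
          omega))]
        rw [Finset.sum_range]
        simp [C_mul_X_pow_eq_monomial]
      by_cases hb : b.natDegree < D
      · refine ⟨fun i => C ((b %ₘ w).coeff i), ?_⟩
        have := modByMonic_add_div b w
        rw [(divByMonic_eq_zero_iff hw).mpr (degree_lt_degree hb), mul_zero, add_zero] at this
        conv_lhs => rw [← this, hmod]
        simp
      · obtain ⟨z, hz⟩ := ih (b /ₘ w).natDegree (by
          rw [natDegree_divByMonic b hw]; omega) _ rfl
        refine ⟨fun i => X * z i + C ((b %ₘ w).coeff i), ?_⟩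
        conv_lhs => rw [← modByMonic_add_div b w, hmod, hz]
        rw [Finset.mul_sum, ← Finset.sum_add_distrib]
        refine Finset.sum_congr rfl fun i _ => ?_
        simp; ring
  · intro z hz
    rw [Finsupp.sum_fintype _ _ (by simp)] at hz
    obtain ⟨n, hn⟩ : ∃ n, ∀ i, (z i).natDegree < n :=
      ⟨(Finset.univ.sup fun i => (z i).natDegree) + 1, fun i =>
        Nat.lt_succ_of_le (Finset.le_sup (f := fun i => (z i).natDegree) (Finset.mem_univ i))⟩
    ext1 i
    exact key n z (fun i => Or.inl (hn i)) hz i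
end ACM
/-! ## Good extensions -/
namespace ACM
open Polynomial
section
variable {A B C : Type*} [CommRing A] [CommRing B] [CommRing C]
def qmap (φ : A →+* B) {f : A} {f' : B} (h : φ f = f') : A ⧸ Ideal.span {f} →+* B ⧸ Ideal.span {f'} :=
  Ideal.quotientMap _ φ (by
    rw [Ideal.span_singleton_le_iff_mem, Ideal.mem_comap, h]
    exact Ideal.mem_span_singleton_self _)
lemma qmap_mk (φ : A →+* B) {f : A} {f' : B} (h : φ f = f') (a : A) :
    qmap φ h (Ideal.Quotient.mk _ a) = Ideal.Quotient.mk _ (φ a) := rfl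
lemma qmap_comp (φ : A →+* B) (ψ : B →+* C) {f : A} {f' : B} {f'' : C} (h : φ f = f') (h' : ψ f' = f'') :
    qmap (ψ.comp φ) (by rw [RingHom.comp_apply, h, h']) = (qmap ψ h').comp (qmap φ h) := by
  ext a; rfl
lemma mk_eq_zero_iff_dvd {f a : A} : Ideal.Quotient.mk (Ideal.span {f}) a = 0 ↔ f ∣ a := by
  rw [Ideal.Quotient.eq_zero_iff_mem, Ideal.mem_span_singleton]
structure Good (φ : A →+* B) {f : A} {f' : B} (h : φ f = f') : Prop where
  nzd : ∀ b, f' * b = 0 → b = 0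
  ff : (qmap φ h).FaithfullyFlat
lemma Good.comp.{u} {A B C : Type u} [CommRing A] [CommRing B] [CommRing C] {φ : A →+* B} {ψ : B →+* C} {f : A} {f' : B} {f'' : C} {h : φ f = f'} {h' : ψ f' = f''}
    (g : Good φ h) (g' : Good ψ h') :
    Good (ψ.comp φ) (f := f) (f' := f'') (by rw [RingHom.comp_apply, h, h']) := by
  refine ⟨g'.nzd, ?_⟩
  rw [qmap_comp φ ψ h h']
  exact RingHom.FaithfullyFlat.stableUnderComposition _ _ g.ff g'.ff
lemma Good.id {f : A} (hf : ∀ b, f * b = 0 → b = 0) : Good (RingHom.id A) (f := f) (f' := f) rfl := by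
  refine ⟨hf, ?_⟩
  have : qmap (RingHom.id A) (f := f) (f' := f) rfl = RingHom.id _ := by ext; rfl
  rw [this]
  exact RingHom.FaithfullyFlat.of_bijective Function.bijective_id
lemma Good.nontrivial {φ : A →+* B} {f : A} {f' : B} {h : φ f = f'} (g : Good φ h)
    (hf : ¬ IsUnit f) : ¬ IsUnit f' := by
  intro hu
  have : Function.Injective (qmap φ h) := g.ff.injective
  apply hf
  rw [← Ideal.span_singleton_eq_top, Ideal.eq_top_iff_one, ← Ideal.Quotient.eq_zero_iff_mem]
  apply this
  rw [map_zero, qmap_mk, map_one, Ideal.Quotient.eq_zero_iff_mem]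
  rw [Ideal.span_singleton_eq_top.mpr hu]; trivial
end
section
variable {p : ℕ} [hp : Fact p.Prime]
variable {P : Type*} [CommRing P] [CharP P p] [PerfectRing P p]
lemma perfectClosure_mk_common {C0 : Type*} [CommRing C0] [CharP C0 p] {ι : Type*} (s : Finset ι)
    (x : ι → PerfectClosure C0 p) : ∃ m0, ∀ m, m0 ≤ m → ∀ i ∈ s, ∃ c : C0, x i ^ (p ^ m) = PerfectClosure.of C0 p c := by
  classical
  have h1 : ∀ i, ∃ m0, ∀ m, m0 ≤ m → ∃ c : C0, x i ^ (p ^ m) = PerfectClosure.of C0 p c := by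
    intro i
    obtain ⟨⟨m, c⟩, hc⟩ := PerfectClosure.mk_surjective C0 p (x i)
    have h2 : x i ^ (p ^ m) = PerfectClosure.of C0 p c := by
      rw [← hc]
      have := PerfectClosure.iterate_frobenius_mk C0 p m c
      rw [iterate_frobenius] at this
      exact this
    refine ⟨m, fun k hk => ⟨c ^ p ^ (k - m), ?_⟩⟩
    rw [map_pow, ← h2, ← pow_mul, ← pow_add]
    congr 2; omega
  choose m0 hm0 using h1
  exact ⟨s.sup m0, fun m hm i hi => hm0 i m ((Finset.le_sup hi).trans hm)⟩
lemma perfectClosure_of_eq_zero {C0 : Type*} [CommRing C0] [CharP C0 p] {c : C0}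
    (h : PerfectClosure.of C0 p c = 0) : ∃ m, ∀ k, m ≤ k → c ^ (p ^ k) = 0 := by
  rw [PerfectClosure.of_apply, ← PerfectClosure.mk_zero, PerfectClosure.mk_eq_iff] at h
  obtain ⟨z, hz⟩ := h
  simp only [Prod.fst_zero, Prod.snd_zero, zero_add, iterate_frobenius] at hz
  rw [zero_pow (pow_ne_zero _ hp.out.ne_zero)] at hz
  refine ⟨z, fun k hk => ?_⟩
  rw [← Nat.sub_add_cancel hk, add_comm, pow_add, pow_mul, hz, zero_pow (pow_ne_zero _ hp.out.ne_zero)]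
theorem flat_perfectClosure {C0 κ : Type*} [CommRing C0] [CharP C0 p] (φ : P →+* C0) (f : P) (e : κ → C0)
    (gen : ∀ (n : ℕ) (c : C0), ∃ (z : κ →₀ P) (c' : C0), c = (z.sum fun k a => φ a * e k) + φ f ^ n * c')
    (ind : ∀ (n : ℕ) (s : Finset κ) (z : κ → P) (c' : C0), ∑ k ∈ s, φ (z k) * e k = φ f ^ n * c' →
      ∀ k ∈ s, ∃ h, z k = f ^ n * h) :
    (qmap ((PerfectClosure.of C0 p).comp φ) (f := f) rfl).Flat := by
  classical
  set Φ := (PerfectClosure.of C0 p).comp φ with hΦ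
  letI := (qmap Φ (f := f) rfl).toAlgebra
  change Module.Flat _ _
  rw [Module.Flat.iff_forall_isTrivialRelation]
  intro l a x h
  choose a' ha' using fun i => Ideal.Quotient.mk_surjective (a i)
  choose x' hx' using fun i => Ideal.Quotient.mk_surjective (x i)
  have h1 : ∑ i, Ideal.Quotient.mk (Ideal.span {Φ f}) (Φ (a' i) * x' i) = 0 := by
    rw [← h]
    refine Finset.sum_congr rfl fun i _ => ?_
    rw [map_mul, ← qmap_mk Φ rfl, ha', hx']; rfl
  rw [← map_sum, mk_eq_zero_iff_dvd] at h1
  obtain ⟨x'', h1⟩ := h1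
  obtain ⟨m0, hm0⟩ := perfectClosure_mk_common (p := p) Finset.univ (fun i : Option (Fin l) => i.elim x'' x')
  -- a relation in C0
  obtain ⟨m, c, c0, hc, hc0, hrel⟩ : ∃ (m : ℕ) (c : Fin l → C0) (c0 : C0),
      (∀ i, x' i ^ p ^ m = PerfectClosure.of C0 p (c i)) ∧ x'' ^ p ^ m = PerfectClosure.of C0 p c0 ∧
      ∑ i, φ (a' i) ^ p ^ m * c i = φ f ^ p ^ m * c0 := by
    choose c hc using fun i => hm0 m0 le_rfl (some i) (Finset.mem_univ _)
    obtain ⟨c0, hc0⟩ := hm0 m0 le_rfl none (Finset.mem_univ _)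
    simp only [Option.elim] at hc hc0
    have h2 : PerfectClosure.of C0 p (∑ i, φ (a' i) ^ p ^ m0 * c i - φ f ^ p ^ m0 * c0) = 0 := by
      have h3 := congrArg (· ^ p ^ m0) h1
      simp only [sum_pow_char_pow, mul_pow] at h3
      simp only [hc, hc0] at h3
      rw [map_sub, map_sum]
      simp only [map_mul, map_pow]
      exact sub_eq_zero.mpr h3
    obtain ⟨k, hk⟩ := perfectClosure_of_eq_zero h2
    have h4 := hk k le_rfl
    rw [sub_pow_char_pow, sum_pow_char_pow, sub_eq_zero] at h4
    refine ⟨m0 + k, fun i => c i ^ p ^ k, c0 ^ p ^ k, fun i => ?_, ?_, ?_⟩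
    · rw [map_pow, ← hc, ← pow_mul, ← pow_add]
    · rw [map_pow, ← hc0, ← pow_mul, ← pow_add]
    · simp only [mul_pow] at h4
      simp only [pow_add, pow_mul]
      exact h4
  choose z c' hz using fun i => gen (p ^ m) (c i)
  let s : Finset κ := Finset.univ.biUnion fun i => (z i).support
  have hs : ∀ i, (z i).sum (fun k a => φ a * e k) = ∑ k ∈ s, φ (z i k) * e k := by
    intro i
    refine Finsupp.sum_of_support_subset _ ?_ _ (by simp)
    exact Finset.subset_biUnion_of_mem (fun i => (z i).support) (Finset.mem_univ i)
  have h5 := ind (p ^ m) s (fun k => ∑ i, a' i ^ p ^ m * z i k) (c0 - ∑ i, φ (a' i) ^ p ^ m * c' i) (by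
    simp only [map_sum, Finset.sum_mul, map_mul, map_pow]
    rw [Finset.sum_comm, mul_sub, ← hrel, Finset.mul_sum, ← Finset.sum_sub_distrib]
    refine Finset.sum_congr rfl fun i _ => ?_
    conv_rhs => rw [hz i, hs i]
    rw [mul_add, Finset.mul_sum, mul_left_comm, add_sub_cancel_right]
    exact Finset.sum_congr rfl fun k _ => by ring)
  choose! hh hhh using h5
  let eq := s.equivFin
  have hx : ∀ i, x' i = ∑ k ∈ s, Φ (rt p m (z i k)) * rt p m (PerfectClosure.of C0 p (e k)) + Φ f * rt p m (PerfectClosure.of C0 p (c' i)) := by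
    intro i
    apply pow_inj (p := p) m
    rw [hc, add_pow_char_pow, sum_pow_char_pow, mul_pow, rt_pow]
    conv_lhs => rw [hz i, hs i]
    simp only [map_add, map_sum, map_mul, mul_pow, rt_pow, rt_map, map_pow]
    rfl
  refine ⟨s.card, fun i j => Ideal.Quotient.mk _ (rt p m (z i (eq.symm j))),
    fun j => Ideal.Quotient.mk _ (rt p m (PerfectClosure.of C0 p (e (eq.symm j)))), fun i => ?_, fun j => ?_⟩
  · rw [← hx' i, hx i, map_add, (mk_eq_zero_iff_dvd).mpr (dvd_mul_right _ _), add_zero, map_sum,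
      ← Finset.sum_coe_sort, ← eq.symm.sum_comp]
    refine Finset.sum_congr rfl fun k _ => ?_
    rw [map_mul]; rfl
  · have : ∑ i, a' i * rt p m (z i (eq.symm j)) = f * rt p m (hh (eq.symm j)) := by
      apply pow_inj (p := p) m
      have := hhh (eq.symm j) (eq.symm j).2
      rw [sum_pow_char_pow]
      simp only [mul_pow, rt_pow]
      exact this
    have h6 := congrArg (Ideal.Quotient.mk (Ideal.span {f})) this
    rw [mk_eq_zero_iff_dvd.mpr (dvd_mul_right _ _), map_sum] at h6
    rw [← h6]
    refine Finset.sum_congr rfl fun i _ => ?_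
    rw [map_mul, ha']
end
end ACM
/-! ## Separated quotient -/
namespace ACM
open Polynomial
section
variable {p : ℕ} [hp : Fact p.Prime]
lemma perfect_mk {K : Type*} [CommRing K] [CharP K p] (h1 : ∀ a : K, a ^ p = 0 → a = 0)
    (h2 : ∀ a : K, ∃ b, b ^ p = a) : PerfectRing K p := by
  refine ⟨fun a b hab => ?_, h2⟩
  have hab : a ^ p = b ^ p := hab
  exact sub_eq_zero.mp (h1 _ (by rw [sub_pow_char, hab, sub_self]))
lemma flat_rel {A B ι : Type*} [CommRing A] [CommRing B] [Fintype ι] {φ : A →+* B} (h : φ.Flat)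
    (a : ι → A) (b : ι → B) (hab : ∑ i, φ (a i) * b i = 0) : ∃ (k : ℕ) (c : ι → Fin k → A) (y : Fin k → B),
      (∀ i, b i = ∑ j, φ (c i j) * y j) ∧ ∀ j, ∑ i, a i * c i j = 0 := by
  letI := φ.toAlgebra
  haveI : Module.Flat A B := h
  exact Module.Flat.isTrivialRelation_of_sum_smul_eq_zero (R := A) (M := B) (f := a) (x := b) hab
lemma flat_ann {A B : Type*} [CommRing A] [CommRing B] {φ : A →+* B} {f : A} {f' : B} (h : φ f = f')
    (hfl : (qmap φ h).Flat) (a : A) (b : B) (hab : f' ∣ φ a * b) : ∃ (k : ℕ) (c : Fin k → A) (y : Fin k → B),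
      (∀ j, f ∣ a * c j) ∧ f' ∣ b - ∑ j, φ (c j) * y j := by
  obtain ⟨k, c, y, h1, h2⟩ := flat_rel hfl (ι := Fin 1) (fun _ => Ideal.Quotient.mk _ a)
    (fun _ => Ideal.Quotient.mk _ b) (by
      rw [Fin.sum_univ_one, qmap_mk, ← map_mul]; exact mk_eq_zero_iff_dvd.mpr hab)
  choose c' hc' using fun j => Ideal.Quotient.mk_surjective (c 0 j)
  choose y' hy' using fun j => Ideal.Quotient.mk_surjective (y j)
  refine ⟨k, c', y', fun j => ?_, ?_⟩
  · rw [← mk_eq_zero_iff_dvd, map_mul, hc', ← h2 j, Fin.sum_univ_one]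
  · rw [← mk_eq_zero_iff_dvd, map_sub, h1 0, map_sum, sub_eq_zero]
    refine Finset.sum_congr rfl fun j _ => ?_
    rw [map_mul, ← qmap_mk φ h, hc', hy']
theorem exists_good.{u} {P P' : Type u} [CommRing P] [CharP P p] [PerfectRing P p]
    [CommRing P'] [CharP P' p] [PerfectRing P' p] (φ : P →+* P') (f : P)
    (hf : ∀ k, f * k = 0 → k = 0) (hu : ¬ IsUnit f) (hff : (qmap φ (f := f) rfl).FaithfullyFlat) :
    ∃ (P'' : Type u) (_ : CommRing P'') (_ : CharP P'' p) (_ : PerfectRing P'' p) (ψ : P' →+* P''),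
      Good (ψ.comp φ) (f := f) rfl := by
  classical
  have h2p : 2 ≤ p := hp.out.two_le
  set f' := φ f with hf'
  have hup : ¬ IsUnit f' := by
    intro h
    have : Function.Injective (qmap φ (f := f) rfl) := hff.injective
    apply hu
    rw [← Ideal.span_singleton_eq_top, Ideal.eq_top_iff_one, ← Ideal.Quotient.eq_zero_iff_mem]
    apply this
    rw [map_zero, qmap_mk, map_one, Ideal.Quotient.eq_zero_iff_mem, Ideal.span_singleton_eq_top.mpr h]
    trivial
  let J : Ideal P' := LinearMap.ker (LinearMap.mulLeft P' f')
  have memJ : ∀ z, z ∈ J ↔ f' * z = 0 := fun z => by simp [J]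
  -- torsion is divisible
  have step : ∀ z, f' * z = 0 → ∃ z', z = rt p 1 f' * z' ∧ f' * z' = 0 := by
    intro z hz
    have h1 : rt p 1 f' * z = 0 := rt_mul_eq_zero (p := p) (n := 1) (by rwa [pow_one]) 1
    suffices h : ∃ z', z = rt p 1 f' * z' by
      obtain ⟨z', rfl⟩ := h
      refine ⟨z', rfl, ?_⟩
      have h2 : f' ^ 2 * z' = 0 := by
        have : f' * rt p 1 f' * z' = 0 := by rw [mul_assoc]; exact hz
        have h3 : (rt p 1 f') ^ p = f' := by simpa using rt_pow (p := p) 1 f'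
        calc f' ^ 2 * z' = (f' * rt p 1 f' * z') * (rt p 1 f') ^ (p - 1) := by
              rw [show f' ^ 2 = f' * (rt p 1 f') ^ p by rw [h3]; ring]
              have : rt p 1 f' ^ p = rt p 1 f' ^ (p - 1) * rt p 1 f' := by
                rw [← pow_succ, Nat.sub_add_cancel (by omega)]
              rw [this]; ring
          _ = 0 := by rw [this, zero_mul]
      have h4 := rt_mul_eq_zero (p := p) (f := f') (z := z') h2 0
      rwa [← rt_unique (p := p) (j := 0) (x := f') (y := f') (by simp)] at h4
    obtain ⟨k, a, y, h4, h3⟩ := flat_ann (f' := f') rfl hff.flat (rt p 1 f) z (by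
      rw [rt_map, ← hf', h1]; exact dvd_zero _)
    have h5 : ∀ j, ∃ y', φ (a j) * y j = rt p 1 f' * y' := by
      intro j
      obtain ⟨b, hb⟩ := h4 j
      have h3 : (rt p 1 f) ^ p = f := by simpa using rt_pow (p := p) 1 f
      have h6 : a j = rt p 1 f * ((rt p 1 f) ^ (p - 2) * b) := by
        have : f * (a j - rt p 1 f * ((rt p 1 f) ^ (p - 2) * b)) = 0 := by
          have e1 : f * a j = (rt p 1 f) ^ (p - 1) * (rt p 1 f * a j) := by
            rw [← mul_assoc, ← pow_succ, Nat.sub_add_cancel (by omega), h3]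
          rw [mul_sub, e1, hb]
          have : rt p 1 f ^ (p - 1) = rt p 1 f * rt p 1 f ^ (p - 2) := by
            rw [← pow_succ']; congr 1; omega
          rw [this]; ring
        exact sub_eq_zero.mp (hf _ this)
      refine ⟨φ (rt p 1 f ^ (p - 2) * b) * y j, ?_⟩
      rw [h6, map_mul φ (rt p 1 f), rt_map, ← hf', mul_assoc]
    choose y' hy' using h5
    simp only [hy'] at h3
    obtain ⟨b, hb⟩ := h3
    have h7 : (rt p 1 f') ^ p = f' := by simpa using rt_pow (p := p) 1 f'
    refine ⟨∑ j, y' j + (rt p 1 f') ^ (p - 1) * b, ?_⟩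
    rw [mul_add, Finset.mul_sum, ← mul_assoc, ← pow_succ', Nat.sub_add_cancel (by omega), h7, ← hb]
    ring
  have hJ : ∀ z, f' * z = 0 → f' ∣ z := by
    have : ∀ n z, f' * z = 0 → ∃ z', z = rt p 1 f' ^ n * z' ∧ f' * z' = 0 := by
      intro n
      induction n with
      | zero => intro z hz; exact ⟨z, by simp, hz⟩
      | succ n ih =>
        intro z hz
        obtain ⟨z', rfl, hz'⟩ := ih z hz
        obtain ⟨z'', rfl, hz''⟩ := step z' hz'
        exact ⟨z'', by ring, hz''⟩
    intro z hz
    obtain ⟨z', rfl, -⟩ := this p z hz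
    have h7 : (rt p 1 f') ^ p = f' := by simpa using rt_pow (p := p) 1 f'
    rw [h7]; exact dvd_mul_right _ _
  have hJtop : (1 : P') ∉ J := by
    rw [memJ, mul_one]
    intro h
    have := hJ 1 (by rw [h, zero_mul])
    exact hup (isUnit_of_dvd_one this)
  haveI : Nontrivial (P' ⧸ J) := Ideal.Quotient.nontrivial_iff.mpr (fun h => hJtop (by rw [h]; trivial))
  haveI : CharP (P' ⧸ J) p := by
    rw [CharP.charP_iff_prime_eq_zero hp.out, ← map_natCast (Ideal.Quotient.mk J), CharP.cast_eq_zero, map_zero]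
  haveI : PerfectRing (P' ⧸ J) p := by
    refine perfect_mk ?_ ?_
    · intro a ha
      obtain ⟨a, rfl⟩ := Ideal.Quotient.mk_surjective a
      rw [← map_pow, Ideal.Quotient.eq_zero_iff_mem, memJ] at ha
      rw [Ideal.Quotient.eq_zero_iff_mem, memJ]
      have h1 : (f' * a) ^ p = 0 := by
        rw [mul_pow, ← Nat.sub_add_cancel (by omega : 1 ≤ p), pow_succ f', mul_assoc, Nat.sub_add_cancel (by omega), ha, mul_zero]
      apply pow_inj (p := p) 1
      rw [pow_one, h1, zero_pow hp.out.ne_zero]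
    · intro a
      obtain ⟨a, rfl⟩ := Ideal.Quotient.mk_surjective a
      refine ⟨Ideal.Quotient.mk _ (rt p 1 a), ?_⟩
      rw [← map_pow]
      congr 1
      simpa using rt_pow (p := p) 1 a
  refine ⟨P' ⧸ J, inferInstance, inferInstance, inferInstance, Ideal.Quotient.mk J, ?_, ?_⟩
  · intro b hb
    obtain ⟨b, rfl⟩ := Ideal.Quotient.mk_surjective b
    change Ideal.Quotient.mk J f' * _ = 0 at hb
    rw [← map_mul, Ideal.Quotient.eq_zero_iff_mem, memJ] at hb
    rw [Ideal.Quotient.eq_zero_iff_mem, memJ]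
    have h4 := rt_mul_eq_zero (p := p) (f := f') (z := b) (n := 2) (by rw [pow_two, mul_assoc]; exact hb) 0
    rwa [← rt_unique (p := p) (j := 0) (x := f') (y := f') (by simp)] at h4
  · rw [qmap_comp φ (Ideal.Quotient.mk J) (f := f) rfl rfl]
    refine RingHom.FaithfullyFlat.stableUnderComposition _ _ hff (RingHom.FaithfullyFlat.of_bijective ⟨?_, ?_⟩)
    · rw [injective_iff_map_eq_zero]
      intro a ha
      obtain ⟨a, rfl⟩ := Ideal.Quotient.mk_surjective a
      rw [qmap_mk, mk_eq_zero_iff_dvd] at ha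
      rw [mk_eq_zero_iff_dvd]
      obtain ⟨b, hb⟩ := ha
      obtain ⟨b, rfl⟩ := Ideal.Quotient.mk_surjective b
      rw [← map_mul, Ideal.Quotient.eq, memJ] at hb
      have := hJ _ hb
      exact (dvd_sub_left (dvd_mul_right _ _)).mp this
    · intro a
      obtain ⟨a, rfl⟩ := Ideal.Quotient.mk_surjective a
      obtain ⟨a, rfl⟩ := Ideal.Quotient.mk_surjective a
      exact ⟨Ideal.Quotient.mk _ a, rfl⟩
end
end ACM
/-! ## The André construction -/
namespace ACM
open Polynomial WittVector
section
variable {p : ℕ} [hp : Fact p.Prime]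
variable {S S' : Type*} [CommRing S] [CommRing S']
abbrev BB (S : Type*) [CommRing S] := MvPolynomial ℕ S[X]
noncomputable abbrev BBmap (θ : S →+* S') : BB S →+* BB S' := MvPolynomial.map (Polynomial.mapRingHom θ)
noncomputable abbrev CC : S →+* BB S := MvPolynomial.C.comp Polynomial.C
lemma BBmap_CC (θ : S →+* S') (a : S) : BBmap θ (CC a) = CC (θ a) := by simp [CC]
noncomputable def Hv (w : (WittVector p S)[X]) : WittVector p S[X] :=
  eval₂ (WittVector.map Polynomial.C) (teichmuller p X) w
noncomputable def bv (p : ℕ) (S : Type*) [CommRing S] : WittVector p (BB S) := WittVector.mk p fun j => MvPolynomial.X j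
noncomputable def sbt (p : ℕ) (S : Type*) [CommRing S] : ℕ → BB S
  | 0 => 0
  | (j + 1) => MvPolynomial.X j ^ p
noncomputable def rho (a : S) (w : (WittVector p S)[X]) (j : ℕ) : BB S :=
  (WittVector.map MvPolynomial.C (Hv w) + teichmuller p (CC a) * bv p S).coeff j - sbt p S j
lemma Hv_map (θ : S →+* S') (w : (WittVector p S)[X]) :
    WittVector.map (mapRingHom θ) (Hv w) = Hv (w.map (WittVector.map θ)) := by
  rw [Hv, Hv, hom_eval₂, eval₂_map, map_teichmuller]
  congr 1
  · ext x : 1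
    ext n : 1
    simp [WittVector.map_coeff]
  · simp
lemma rho_map (θ : S →+* S') (a : S) (w : (WittVector p S)[X]) (j : ℕ) :
    BBmap θ (rho a w j) = rho (θ a) (w.map (WittVector.map θ)) j := by
  have h1 : WittVector.map (BBmap θ) (WittVector.map MvPolynomial.C (Hv w)) =
      WittVector.map MvPolynomial.C (Hv (w.map (WittVector.map θ))) := by
    rw [← Hv_map]
    apply WittVector.ext
    intro n
    rw [WittVector.map_coeff, WittVector.map_coeff, WittVector.map_coeff, WittVector.map_coeff,
      BBmap, MvPolynomial.map_C]
  have h2 : WittVector.map (BBmap θ) (bv p S) = bv p S' := by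
    apply WittVector.ext
    intro n
    rw [WittVector.map_coeff, bv, bv, WittVector.coeff_mk, WittVector.coeff_mk, BBmap, MvPolynomial.map_X]
  have h3 : BBmap θ (sbt p S j) = sbt p S' j := by
    cases j
    · exact map_zero _
    · rw [sbt, sbt, map_pow, BBmap, MvPolynomial.map_X]
  rw [rho, rho, map_sub, ← WittVector.map_coeff, map_add, map_mul, map_teichmuller, BBmap_CC, h1, h2, h3]
lemma rho_zero_zero (w : (WittVector p S)[X]) :
    rho 0 w 0 = MvPolynomial.C (w.map WittVector.constantCoeff) := by
  rw [rho, map_zero, WittVector.teichmuller_zero, zero_mul, add_zero, sbt, sub_zero, WittVector.map_coeff]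
  congr 1
  have : (Hv w).coeff 0 = WittVector.constantCoeff (Hv w) := rfl
  rw [this, Hv, hom_eval₂]
  have h2 : (WittVector.constantCoeff).comp (WittVector.map (Polynomial.C (R := S))) = Polynomial.C.comp (WittVector.constantCoeff (p := p)) := by
    refine RingHom.ext fun x => ?_
    exact WittVector.map_coeff (Polynomial.C (R := S)) x 0
  rw [h2]
  have h3 : WittVector.constantCoeff (p := p) (teichmuller p (X : S[X])) = X :=
    WittVector.teichmuller_coeff_zero p _
  rw [h3]; rfl
lemma rho_zero_succ (w : (WittVector p S)[X]) (j : ℕ) :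
    rho 0 w (j + 1) = MvPolynomial.C ((Hv w).coeff (j + 1)) - MvPolynomial.X j ^ p := by
  rw [rho, map_zero, WittVector.teichmuller_zero, zero_mul, add_zero, sbt, WittVector.map_coeff]
noncomputable def rhom (a : S) (w : (WittVector p S)[X]) : BB S →+* BB S :=
  MvPolynomial.eval₂Hom (eval₂RingHom CC (rho a w 0)) (fun j => rho a w (j + 1))
lemma rhom_CC (a : S) (w : (WittVector p S)[X]) (s : S) : rhom a w (CC s) = CC s := by
  simp [rhom, CC]
lemma rhom_map (θ : S →+* S') (a : S) (w : (WittVector p S)[X]) (z : BB S) :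
    BBmap θ (rhom a w z) = rhom (θ a) (w.map (WittVector.map θ)) (BBmap θ z) := by
  have : (BBmap θ).comp (rhom a w) = (rhom (θ a) (w.map (WittVector.map θ))).comp (BBmap θ) := by
    apply MvPolynomial.ringHom_ext'
    · apply Polynomial.ringHom_ext
      · intro s; simp [rhom, CC]
      · simp [rhom, rho_map]
    · intro i; simp [rhom, rho_map]
  exact congrArg (fun g => g z) this
lemma freeHom_rhom [Nontrivial S] (w : (WittVector p S)[X]) (hw : w.Monic) (hD : 0 < w.natDegree) :
    FreeHom (rhom 0 w) := by
  let wb := w.map WittVector.constantCoeff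
  have h1 : FreeHom (MvPolynomial.map (σ := ℕ) (compRingHom wb)) :=
    (freeHom_comp wb (hw.map _) (by rw [hw.natDegree_map]; exact hD)).mvPoly ℕ
  let t : BB S →+* BB S := MvPolynomial.eval₂Hom MvPolynomial.C fun j =>
    MvPolynomial.C ((Hv w).coeff (j + 1)) - MvPolynomial.X j
  have ht : t.comp t = RingHom.id _ := by
    apply MvPolynomial.ringHom_ext'
    · refine RingHom.ext fun x => ?_
      simp [t]
    · intro i; simp [t]
  let τ : BB S ≃+* BB S := RingEquiv.ofRingHom t t ht ht
  have h2 : FreeHom t := FreeHom.of_equiv τ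
  have h3 := (h1.comp h2).comp (freeHom_expand S[X] p hp.out.pos)
  convert h3 using 1
  symm
  apply MvPolynomial.ringHom_ext'
  · apply Polynomial.ringHom_ext
    · intro s; simp [rhom, CC, t]
    · simp [rhom, t, rho_zero_zero, wb]
  · intro i; simp [rhom, t, rho_zero_succ]
lemma BB_dvd (f : S) (b : BB S) (h : BBmap (Ideal.Quotient.mk (Ideal.span {f})) b = 0) :
    ∃ b', b = CC f * b' := by
  change CC f ∣ b
  rw [CC, RingHom.comp_apply, MvPolynomial.C_dvd_iff_dvd_coeff]
  intro i
  rw [Polynomial.C_dvd_iff_dvd_coeff]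
  intro j
  rw [← mk_eq_zero_iff_dvd]
  have h1 := congrArg (fun q => Polynomial.coeff (MvPolynomial.coeff i q) j) h
  simpa [MvPolynomial.coeff_map] using h1
lemma BBmap_f (f : S) : BBmap (Ideal.Quotient.mk (Ideal.span {f})) (CC f) = 0 := by
  rw [BBmap_CC, mk_eq_zero_iff_dvd.mpr dvd_rfl, map_zero]
lemma BB_nzd (f : S) (hf : ∀ k, f * k = 0 → k = 0) (n : ℕ) (b b' : BB S) (h : CC f ^ n * b = CC f ^ n * b') : b = b' := by
  have h1 : ∀ b : BB S, CC f * b = 0 → b = 0 := by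
    intro b h
    ext i j
    have h1 := congrArg (fun q => Polynomial.coeff (MvPolynomial.coeff i q) j) h
    simp only [CC, RingHom.comp_apply, MvPolynomial.coeff_C_mul, Polynomial.coeff_C_mul] at h1
    exact hf _ (by simpa using h1)
  have h2 : ∀ n, ∀ b : BB S, CC f ^ n * b = 0 → b = 0 := by
    intro n
    induction n with
    | zero => intro b h; simpa using h
    | succ n ih => intro b h; exact h1 _ (ih _ (by rw [← mul_assoc, ← pow_succ]; exact h))
  exact sub_eq_zero.mp (h2 n _ (by rw [mul_sub, h, sub_self]))
theorem BB_basis.{u} {S : Type u} [CommRing S] (f : S) (hf : ∀ k, f * k = 0 → k = 0) (hu : ¬ IsUnit f) (w : (WittVector p S)[X]) (hw : w.Monic)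
    (hD : 0 < w.natDegree) : ∃ (κ : Type u) (e : κ → BB S),
    (∀ (n : ℕ) (b : BB S), ∃ (z : κ →₀ BB S) (b' : BB S), b = (z.sum fun k a => rhom f w a * e k) + CC f ^ n * b') ∧
    (∀ (n : ℕ) (s : Finset κ) (z : κ → BB S) (b' : BB S), ∑ k ∈ s, rhom f w (z k) * e k = CC f ^ n * b' →
      ∀ k ∈ s, ∃ h, z k = CC f ^ n * h) := by
  classical
  haveI : Nontrivial (S ⧸ Ideal.span {f}) := Ideal.Quotient.nontrivial_iff.mpr
    (fun h => hu (Ideal.span_singleton_eq_top.mp h))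
  haveI : Nontrivial S := (Ideal.Quotient.mk (Ideal.span {f})).domain_nontrivial
  set θ := Ideal.Quotient.mk (Ideal.span {f})
  have hθf : θ f = 0 := mk_eq_zero_iff_dvd.mpr dvd_rfl
  have hfree : FreeHom (rhom 0 (w.map (WittVector.map θ))) :=
    freeHom_rhom _ (hw.map _) (by rw [hw.natDegree_map]; exact hD)
  obtain ⟨κ, eb, hgen, hind⟩ := hfree.exists
  have hsurj : Function.Surjective (BBmap θ) := MvPolynomial.map_surjective _
    (Polynomial.map_surjective _ Ideal.Quotient.mk_surjective)
  choose e he using fun k => hsurj (eb k)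
  have gen1 : ∀ b : BB S, ∃ (z : κ →₀ BB S) (b' : BB S), b = (z.sum fun k a => rhom f w a * e k) + CC f * b' := by
    intro b
    obtain ⟨z, hz⟩ := hgen (BBmap θ b)
    choose! lf hlf using hsurj
    let z' : κ →₀ BB S := Finsupp.onFinset z.support (fun k => if z k = 0 then 0 else lf (z k)) (by
      intro k; simp only [Finsupp.mem_support_iff]; intro h1 h2; simp [h2] at h1)
    have hz' : ∀ k, BBmap θ (z' k) = z k := by
      intro k
      simp only [z', Finsupp.onFinset_apply]
      split_ifs with h
      · rw [h, map_zero]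
      · exact hlf _
    obtain ⟨b', hb'⟩ := BB_dvd f (b - (z'.sum fun k a => rhom f w a * e k)) (by
      rw [map_sub, hz, Finsupp.sum, Finsupp.sum, map_sum, sub_eq_zero]
      symm
      rw [Finset.sum_subset (s₂ := z.support ∪ z'.support) Finset.subset_union_left,
        Finset.sum_subset (s₂ := z.support ∪ z'.support) Finset.subset_union_right]
      · refine Finset.sum_congr rfl fun k _ => ?_
        rw [map_mul, rhom_map, he, hz', hθf]
      · intro k _ hk
        rw [Finsupp.notMem_support_iff.mp hk]; simp
      · intro k _ hk
        rw [Finsupp.notMem_support_iff.mp hk]; simp)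
    exact ⟨z', b', by rw [← hb']; ring⟩
  have ind1 : ∀ (s : Finset κ) (z : κ → BB S) (b' : BB S), ∑ k ∈ s, rhom f w (z k) * e k = CC f * b' →
      ∀ k ∈ s, ∃ h, z k = CC f * h := by
    intro s z b' h
    have h1 := congrArg (BBmap θ) h
    rw [map_mul, BBmap_f, zero_mul, map_sum] at h1
    have h2 := hind (Finsupp.onFinset s (fun k => if k ∈ s then BBmap θ (z k) else 0) (by
      intro k hk; by_contra h; simp [h] at hk)) (by
      rw [Finsupp.onFinset_sum _ (by simp), ← h1]
      refine Finset.sum_congr rfl fun k hk => ?_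
      rw [if_pos hk, map_mul, rhom_map, he, hθf])
    intro k hk
    apply BB_dvd
    have := DFunLike.congr_fun h2 k
    simpa [hk] using this
  refine ⟨κ, e, ?_, ?_⟩
  · intro n
    induction n with
    | zero => intro b; exact ⟨0, b, by simp⟩
    | succ n ih =>
      intro b
      obtain ⟨z, b', rfl⟩ := ih b
      obtain ⟨z', b'', rfl⟩ := gen1 b'
      refine ⟨z + (CC f ^ n) • z', b'', ?_⟩
      rw [Finsupp.sum_add_index' (by simp) (by intros; simp [add_mul]), Finsupp.sum_smul_index (by simp)]
      simp only [map_mul, map_pow, rhom_CC]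
      rw [mul_add, Finsupp.mul_sum]
      simp only [mul_assoc]
      ring
  · intro n
    induction n with
    | zero => intro s z b' _ k _; exact ⟨z k, by simp⟩
    | succ n ih =>
      intro s z b' h
      have h1 := ih s z (CC f * b') (by rw [h]; ring)
      choose! z' hz' using h1
      have h2 := ind1 s z' b' (by
        apply BB_nzd f hf n
        rw [← mul_assoc, ← pow_succ, ← h, Finset.mul_sum]
        refine Finset.sum_congr rfl fun k hk => ?_
        rw [hz' k hk, map_mul, map_pow, rhom_CC]; ring)
      intro k hk
      obtain ⟨h, hh⟩ := h2 k hk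
      exact ⟨h, by rw [hz' k hk, hh]; ring⟩
end
end ACM
/-! ## André's lemma -/
namespace ACM
open Polynomial WittVector
lemma ff_of {A B : Type*} [CommRing A] [CommRing B] (φ : A →+* B) (h : φ.Flat)
    (hm : ∀ m : Ideal A, m.IsMaximal → ∃ (Ω : Type _) (_ : CommRing Ω) (_ : Nontrivial Ω) (χ : B →+* Ω),
      ∀ a ∈ m, χ (φ a) = 0) : φ.FaithfullyFlat := by
  letI := φ.toAlgebra
  haveI : Module.Flat A B := h
  refine ⟨fun m hmax htop => ?_⟩
  obtain ⟨Ω, _, _, χ, hχ⟩ := hm m hmax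
  have h1 : (1 : B) ∈ m • (⊤ : Submodule A B) := by rw [htop]; trivial
  have : χ 1 = 0 := by
    refine Submodule.smul_induction_on (p := fun b => χ b = 0) h1 ?_ ?_
    · intro a ha b _
      change χ (φ a * b) = 0
      rw [map_mul, hχ a ha, zero_mul]
    · intro x y hx hy; rw [map_add, hx, hy, add_zero]
  rw [map_one] at this
  exact one_ne_zero this
section
variable {p : ℕ} [hp : Fact p.Prime]
noncomputable def eps (S : Type*) [CommRing S] : BB S →+* S :=
  MvPolynomial.eval₂Hom (eval₂RingHom (RingHom.id S) 0) (fun _ => 0)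
lemma eps_CC {S : Type*} [CommRing S] (a : S) : eps S (CC a) = a := by simp [eps, CC]
noncomputable def zz (S : Type*) [CommRing S] : ℕ → BB S
  | 0 => MvPolynomial.C X
  | (j + 1) => MvPolynomial.X j
lemma eps_zz {S : Type*} [CommRing S] (j : ℕ) : eps S (zz S j) = 0 := by
  cases j <;> simp [eps, zz]
lemma rhom_zz {S : Type*} [CommRing S] (a : S) (w : (WittVector p S)[X]) (j : ℕ) :
    rhom a w (zz S j) = rho a w j := by
  cases j <;> simp [rhom, zz]
noncomputable abbrev rI {S : Type*} [CommRing S] (a : S) (w : (WittVector p S)[X]) : Ideal (BB S) :=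
  Ideal.span (Set.range (rho a w))
lemma mk_rhom {S : Type*} [CommRing S] (a : S) (w : (WittVector p S)[X]) (z : BB S) :
    Ideal.Quotient.mk (rI a w) (rhom a w z) = Ideal.Quotient.mk (rI a w) (CC (eps S z)) := by
  have hz : ∀ j, Ideal.Quotient.mk (rI a w) (rho a w j) = 0 := fun j =>
    Ideal.Quotient.eq_zero_iff_mem.mpr (Ideal.subset_span ⟨j, rfl⟩)
  have : (Ideal.Quotient.mk (rI a w)).comp (rhom a w) =
      (Ideal.Quotient.mk (rI a w)).comp (CC.comp (eps S)) := by
    apply MvPolynomial.ringHom_ext'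
    · apply Polynomial.ringHom_ext
      · intro s; simp [rhom, eps]
      · have := hz 0
        simpa [rhom, eps] using this
    · intro i
      have := hz (i + 1)
      simpa [rhom, eps] using this
  exact congrArg (fun g => g z) this
lemma rI_basis {S : Type*} [CommRing S] {f : S} {w : (WittVector p S)[X]} {κ : Type*} {e : κ → BB S}
    (gen : ∀ (n : ℕ) (b : BB S), ∃ (z : κ →₀ BB S) (b' : BB S),
      b = (z.sum fun k a => rhom f w a * e k) + CC f ^ n * b') (n : ℕ) (x : BB S) (hx : x ∈ rI f w) :
    ∃ (ζ : κ →₀ BB S) (b' : BB S), (∀ k, eps S (ζ k) = 0) ∧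
      x = (ζ.sum fun k a => rhom f w a * e k) + CC f ^ n * b' := by
  classical
  obtain ⟨c, rfl⟩ := (Finsupp.mem_ideal_span_range_iff_exists_finsupp).mp hx
  rw [Finsupp.sum]
  refine Finset.sum_induction _ (fun x => ∃ (ζ : κ →₀ BB S) (b' : BB S), (∀ k, eps S (ζ k) = 0) ∧
      x = (ζ.sum fun k a => rhom f w a * e k) + CC f ^ n * b') ?_ ?_ ?_
  · rintro _ _ ⟨ζ, b, h1, rfl⟩ ⟨ζ', b', h1', rfl⟩
    refine ⟨ζ + ζ', b + b', fun k => by simp [h1, h1'], ?_⟩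
    rw [Finsupp.sum_add_index' (by simp) (by intros; simp [add_mul])]
    ring
  · exact ⟨0, 0, by simp, by simp⟩
  · intro j _
    obtain ⟨z, b', hz⟩ := gen n (c j)
    refine ⟨z.mapRange (fun a => zz S j * a) (mul_zero _), b' * rho f w j, fun k => ?_, ?_⟩
    · rw [Finsupp.mapRange_apply, map_mul, eps_zz, zero_mul]
    · rw [Finsupp.sum_mapRange_index (by intro k; rw [map_zero, zero_mul])]
      simp only [map_mul, rhom_zz]
      have h1 : (z.sum fun k a => rho f w j * rhom f w a * e k) =
          (z.sum fun k a => rhom f w a * e k) * rho f w j := by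
        rw [Finsupp.sum, Finsupp.sum, Finset.sum_mul]
        exact Finset.sum_congr rfl fun k _ => by ring
      rw [h1]
      linear_combination (rho f w j) * hz
theorem C0_basis.{u} {S : Type u} [CommRing S] (f : S) (hf : ∀ k, f * k = 0 → k = 0) (hu : ¬ IsUnit f)
    (w : (WittVector p S)[X]) (hw : w.Monic) (hD : 0 < w.natDegree) :
    ∃ (κ : Type u) (e : κ → BB S ⧸ rI f w),
    (∀ (n : ℕ) (c : BB S ⧸ rI f w), ∃ (z : κ →₀ S) (c' : BB S ⧸ rI f w),
      c = (z.sum fun k a => ((Ideal.Quotient.mk (rI f w)).comp CC) a * e k) +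
        ((Ideal.Quotient.mk (rI f w)).comp CC) f ^ n * c') ∧
    (∀ (n : ℕ) (s : Finset κ) (z : κ → S) (c' : BB S ⧸ rI f w),
      ∑ k ∈ s, ((Ideal.Quotient.mk (rI f w)).comp CC) (z k) * e k =
        ((Ideal.Quotient.mk (rI f w)).comp CC) f ^ n * c' →
      ∀ k ∈ s, ∃ h, z k = f ^ n * h) := by
  classical
  obtain ⟨κ, e, gen, ind⟩ := BB_basis f hf hu w hw hD
  refine ⟨κ, fun k => Ideal.Quotient.mk _ (e k), ?_, ?_⟩
  · intro n c
    obtain ⟨c, rfl⟩ := Ideal.Quotient.mk_surjective c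
    obtain ⟨z, b', hz⟩ := gen n c
    refine ⟨z.mapRange (eps S) (map_zero _), Ideal.Quotient.mk _ b', ?_⟩
    conv_lhs => rw [hz]
    rw [Finsupp.sum_mapRange_index (by simp), map_add, Finsupp.sum, map_sum, map_mul, map_pow]
    simp only [map_mul, mk_rhom]
    rfl
  · intro n s z c' h k hk
    obtain ⟨c, rfl⟩ := Ideal.Quotient.mk_surjective c'
    have h1 : (∑ k ∈ s, CC (z k) * e k) - CC f ^ n * c ∈ rI f w := by
      rw [← Ideal.Quotient.eq, map_sum]
      simp only [map_mul, map_pow]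
      exact h
    obtain ⟨ζ, b', h2, h3⟩ := rI_basis gen n _ h1
    have h4 := ind n (s ∪ ζ.support) (fun k => (if k ∈ s then CC (z k) else 0) - ζ k) (c + b') (by
      simp only [map_sub, sub_mul]
      rw [Finset.sum_sub_distrib]
      rw [Finsupp.sum] at h3
      rw [← Finset.sum_subset (s₁ := s) Finset.subset_union_left,
        ← Finset.sum_subset (s₁ := ζ.support) Finset.subset_union_right]
      · have : ∑ k ∈ s, rhom f w (if k ∈ s then CC (z k) else 0) * e k = ∑ k ∈ s, CC (z k) * e k :=
          Finset.sum_congr rfl fun k hk => by rw [if_pos hk, rhom_CC]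
        rw [this]
        linear_combination h3
      · intro k _ hk
        rw [Finsupp.notMem_support_iff.mp hk]; simp
      · intro k _ hk
        rw [if_neg hk]; simp) k (Finset.mem_union_left _ hk)
    obtain ⟨h, hh⟩ := h4
    rw [if_pos hk] at hh
    have h5 := congrArg (eps S) hh
    rw [map_sub, eps_CC, h2, sub_zero, map_mul, map_pow, eps_CC] at h5
    exact ⟨_, h5⟩
lemma exists_point {S Ω : Type*} [CommRing S] [Field Ω] [IsAlgClosed Ω] (ω : S →+* Ω) (f : S) (hf : ω f = 0)
    (w : (WittVector p S)[X]) (hw : w.Monic) (hD : 0 < w.natDegree) :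
    ∃ χ : BB S ⧸ rI f w →+* Ω, ∀ s, χ (Ideal.Quotient.mk _ (CC s)) = ω s := by
  haveI : Nontrivial S := ω.domain_nontrivial
  set w1 := w.map (WittVector.map ω)
  have hw1 : w1.Monic := hw.map _
  obtain ⟨y0, hy0⟩ := IsAlgClosed.exists_root (w1.map WittVector.constantCoeff) (by
    rw [Polynomial.degree_eq_natDegree (hw1.map _).ne_zero, hw1.natDegree_map, hw.natDegree_map]
    exact_mod_cast hD.ne')
  choose r hr using fun j => IsAlgClosed.exists_pow_nat_eq (eval y0 ((Hv w1).coeff (j + 1))) hp.out.pos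
  let Ψ : BB Ω →+* Ω := MvPolynomial.eval₂Hom (evalRingHom y0) r
  refine ⟨Ideal.Quotient.lift _ (Ψ.comp (BBmap ω)) ?_, ?_⟩
  · intro a ha
    rw [← RingHom.mem_ker]
    revert a
    change rI f w ≤ _
    rw [Ideal.span_le]
    rintro _ ⟨j, rfl⟩
    rw [SetLike.mem_coe, RingHom.mem_ker, RingHom.comp_apply, rho_map, hf]
    cases j with
    | zero => rw [rho_zero_zero]; simpa [Ψ] using hy0
    | succ j => rw [rho_zero_succ]; simp [Ψ, hr, w1]
  · intro s
    simp [Ψ]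
theorem andre_aux.{u} {P C0 : Type u} [CommRing P] [CharP P p] [PerfectRing P p] [CommRing C0] (f : P)
    (hf : ∀ k, f * k = 0 → k = 0) (hu : ¬ IsUnit f) (w : (WittVector p P)[X])
    (q0 : BB P →+* C0) (hq0 : ∀ j, q0 (rho f w j) = 0)
    (hpt : ∀ m : Ideal (P ⧸ Ideal.span {f}), m.IsMaximal → ∃ (Ω : Type u) (_ : Field Ω) (_ : IsAlgClosed Ω)
      (χ : C0 →+* Ω), χ (q0.comp CC f) = 0 ∧ ∀ a, Ideal.Quotient.mk (Ideal.span {f}) a ∈ m → χ (q0.comp CC a) = 0)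
    {κ : Type u} (e : κ → C0)
    (gen : ∀ (n : ℕ) (c : C0), ∃ (z : κ →₀ P) (c' : C0),
      c = (z.sum fun k a => (q0.comp CC) a * e k) + (q0.comp CC) f ^ n * c')
    (ind : ∀ (n : ℕ) (s : Finset κ) (z : κ → P) (c' : C0),
      ∑ k ∈ s, (q0.comp CC) (z k) * e k = (q0.comp CC) f ^ n * c' →
      ∀ k ∈ s, ∃ h, z k = f ^ n * h) :
    ∃ (P' : Type u) (_ : CommRing P') (_ : CharP P' p) (_ : PerfectRing P' p) (φ : P →+* P'),
      Good φ (f := f) rfl ∧ ∃ (q : BB P →+* P'), (∀ a, q (CC a) = φ a) ∧ ∀ j, q (rho f w j) = 0 := by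
  haveI ht : Nontrivial (P ⧸ Ideal.span {f}) := Ideal.Quotient.nontrivial_iff.mpr
    (fun h => hu (Ideal.span_singleton_eq_top.mp h))
  have hp0 : ((p : ℕ) : C0) = 0 := by
    rw [← map_natCast (q0.comp CC), CharP.cast_eq_zero, map_zero]
  haveI : CharP C0 p := by
    obtain ⟨m, hm⟩ := Ideal.exists_maximal (P ⧸ Ideal.span {f})
    obtain ⟨Ω, _, _, χ, -⟩ := hpt m hm
    haveI := χ.domain_nontrivial
    exact (CharP.charP_iff_prime_eq_zero hp.out).mpr hp0
  have hflat := flat_perfectClosure (p := p) (q0.comp CC) f e gen ind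
  have hff := ff_of _ hflat (by
    intro m hm
    obtain ⟨Ω, _, _, χ, h1, h2⟩ := hpt m hm
    haveI : CharP Ω p := by
      rw [CharP.charP_iff_prime_eq_zero hp.out, ← map_natCast χ, hp0, map_zero]
    haveI : ExpChar Ω p := ExpChar.prime hp.out
    haveI : PerfectRing Ω p := inferInstance
    let L := PerfectClosure.lift C0 p Ω χ
    have hL : ∀ c, L (PerfectClosure.of _ p c) = χ c := by
      intro c
      have := (PerfectClosure.lift C0 p Ω).symm_apply_apply χ
      exact congrArg (fun g => g c) this
    refine ⟨Ω, inferInstance, inferInstance, Ideal.Quotient.lift _ L ?_, ?_⟩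
    · intro a ha
      rw [Ideal.mem_span_singleton] at ha
      obtain ⟨b, rfl⟩ := ha
      rw [map_mul, RingHom.comp_apply, hL, h1, zero_mul]
    · intro a ha
      obtain ⟨a, rfl⟩ := Ideal.Quotient.mk_surjective a
      rw [qmap_mk, Ideal.Quotient.lift_mk, RingHom.comp_apply, hL]
      exact h2 a ha)
  obtain ⟨P'', _, _, _, ψ, hψ⟩ := exists_good _ f hf hu hff
  refine ⟨P'', inferInstance, inferInstance, inferInstance, _, hψ,
    (ψ.comp (PerfectClosure.of _ p)).comp q0, fun a => rfl, fun j => ?_⟩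
  rw [RingHom.comp_apply, hq0, map_zero]
lemma exists_geom.{u} {P : Type u} [CommRing P] (f : P) (m : Ideal (P ⧸ Ideal.span {f})) (hm : m.IsMaximal) :
    ∃ (Ω : Type u) (_ : Field Ω) (_ : IsAlgClosed Ω) (ω : P →+* Ω), ω f = 0 ∧
      ∀ a, Ideal.Quotient.mk (Ideal.span {f}) a ∈ m → ω a = 0 := by
  letI := Ideal.Quotient.field m
  have h : ∀ a, Ideal.Quotient.mk (Ideal.span {f}) a ∈ m → (algebraMap _ (AlgebraicClosure ((P ⧸ Ideal.span {f}) ⧸ m))).comp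
      ((Ideal.Quotient.mk m).comp (Ideal.Quotient.mk (Ideal.span {f}))) a = 0 := by
    intro a ha
    simp only [RingHom.comp_apply]
    rw [Ideal.Quotient.eq_zero_iff_mem.mpr ha, map_zero]
  refine ⟨AlgebraicClosure ((P ⧸ Ideal.span {f}) ⧸ m), inferInstance, inferInstance, (algebraMap _ _).comp
    ((Ideal.Quotient.mk m).comp (Ideal.Quotient.mk (Ideal.span {f}))), h f ?_, h⟩
  rw [mk_eq_zero_iff_dvd.mpr dvd_rfl]
  exact m.zero_mem
theorem andre_q.{u} {P : Type u} [CommRing P] [CharP P p] [PerfectRing P p] (f : P)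
    (hf : ∀ k, f * k = 0 → k = 0) (hu : ¬ IsUnit f) (w' : (WittVector p P)[X]) (hw' : w'.Monic)
    (hwD : 0 < w'.natDegree) :
    ∃ (P' : Type u) (_ : CommRing P') (_ : CharP P' p) (_ : PerfectRing P' p) (φ : P →+* P'),
      Good φ (f := f) rfl ∧ ∃ (q : BB P →+* P'), (∀ a, q (CC a) = φ a) ∧ ∀ j, q (rho f w' j) = 0 := by
  obtain ⟨κ, e, gen, ind⟩ := C0_basis f hf hu w' hw' hwD
  have hr : ∀ j, Ideal.Quotient.mk (rI f w') (rho f w' j) = 0 := fun j =>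
    Ideal.Quotient.eq_zero_iff_mem.mpr (Ideal.subset_span (Set.mem_range_self j))
  refine andre_aux (C0 := BB P ⧸ rI f w') f hf hu w' (Ideal.Quotient.mk (rI f w')) hr ?_ e gen ind
  intro m hm
  obtain ⟨Ω, _, _, ω, h1, h2⟩ := exists_geom f m hm
  obtain ⟨χ, hχ⟩ := exists_point ω f h1 w' hw' hwD
  exact ⟨Ω, inferInstance, inferInstance, χ, (hχ f).trans h1, fun a ha => (hχ a).trans (h2 a ha)⟩
theorem andre_root {P P'' : Type*} [CommRing P] [CommRing P''] [CharP P'' p] (f : P) (w' : (WittVector p P)[X])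
    (χ : P →+* P'') (q : BB P →+* P'') (hq : ∀ a, q (CC a) = χ a) (hqr : ∀ j, q (rho f w' j) = 0) :
    ∃ b, eval₂ (WittVector.map χ) (teichmuller p (q (MvPolynomial.C X))) w' =
      ((p : WittVector p P'') - teichmuller p (χ f)) * b := by
  have h2 : eval₂ (WittVector.map χ) (teichmuller p (q (MvPolynomial.C X))) w' =
      WittVector.map q (WittVector.map MvPolynomial.C (Hv w')) := by
    rw [Hv, hom_eval₂, hom_eval₂, map_teichmuller, map_teichmuller]
    congr 1
    apply RingHom.ext
    intro a
    apply WittVector.ext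
    intro n
    simp only [RingHom.comp_apply, WittVector.map_coeff]
    exact (hq _).symm
  have h3 : WittVector.map q (WittVector.map MvPolynomial.C (Hv w')) + teichmuller p (χ f) * WittVector.map q (bv p P)
      = WittVector.map q (bv p P) * p := by
    apply WittVector.ext
    intro j
    have h4 := hqr j
    rw [rho, map_sub, ← WittVector.map_coeff, map_add, map_mul, map_teichmuller, hq, sub_eq_zero] at h4
    rw [h4]
    cases j with
    | zero => rw [WittVector.mul_charP_coeff_zero, sbt, map_zero]
    | succ j =>
      rw [WittVector.mul_charP_coeff_succ, sbt, map_pow, WittVector.map_coeff, bv, WittVector.coeff_mk]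
  exact ⟨WittVector.map q (bv p P), by rw [h2]; linear_combination h3⟩
theorem andre.{u} {P : Type u} [CommRing P] [CharP P p] [PerfectRing P p] (f : P)
    (hf : ∀ k, f * k = 0 → k = 0) (hu : ¬ IsUnit f) (w : (EE p f)[X]) (hw : w.Monic) (hD : 0 < w.natDegree) :
    ∃ (P' : Type u) (_ : CommRing P') (_ : CharP P' p) (_ : PerfectRing P' p) (φ : P →+* P'),
      Good φ (f := f) rfl ∧ ∃ y : P', eval₂ (EEmap φ rfl) (te p (φ f) y) w = 0 := by
  obtain ⟨w', hwm, hwD, hw'⟩ : ∃ w' : (WittVector p P)[X], w'.map (Ideal.Quotient.mk _) = w ∧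
      0 < w'.natDegree ∧ w'.Monic := by
    have hl : w ∈ lifts (Ideal.Quotient.mk (Ideal.span {(p : WittVector p P) - teichmuller p f})) := by
      rw [lifts_iff_coeff_lifts]; intro n; exact Ideal.Quotient.mk_surjective _
    obtain ⟨w', h1, h2, h3⟩ := lifts_and_natDegree_eq_and_monic hl hw
    exact ⟨w', h1, h2 ▸ hD, h3⟩
  clear hw hD
  subst hwm
  obtain ⟨P'', _, _, _, χ, hψ, q, hq, hqr⟩ := andre_q f hf hu w' hw' hwD
  refine ⟨P'', inferInstance, inferInstance, inferInstance, χ, hψ, q (MvPolynomial.C X), ?_⟩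
  obtain ⟨b, hb⟩ := andre_root f w' χ q hq hqr
  rw [eval₂_map]
  have h1 : (EEmap (p := p) χ (f := f) rfl).comp (Ideal.Quotient.mk _) =
      (Ideal.Quotient.mk _).comp (WittVector.map χ) := rfl
  rw [h1, te_def, ← hom_eval₂, hb, Ideal.Quotient.eq_zero_iff_mem, Ideal.mem_span_singleton]
  exact ⟨b, rfl⟩
end
end ACM
/-! ## Splitting separable polynomials -/
namespace ACM
open Polynomial
lemma idem_lift {𝓔 ι : Type*} [CommRing 𝓔] [Fintype ι] (e : 𝓔) (he : e * e = e)
    (x : 𝓔) (y : ι → 𝓔) (ε : ι → 𝓔 ⧸ Ideal.span {1 - e}) (h1 : ∀ l, ε l * ε l = ε l) (h2 : ∑ l, ε l = 1)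
    (h3 : ∀ l, ε l * Ideal.Quotient.mk _ x = ε l * Ideal.Quotient.mk _ (y l)) :
    ∃ η : ι → 𝓔, (∀ l, η l * η l = η l) ∧ ∑ l, η l = e ∧ (∀ l, η l * x = η l * y l) ∧ ∀ l, η l = e * η l := by
  have key : ∀ a b : 𝓔, Ideal.Quotient.mk (Ideal.span {1 - e}) a = Ideal.Quotient.mk _ b → e * a = e * b := by
    intro a b h
    rw [Ideal.Quotient.eq, Ideal.mem_span_singleton] at h
    obtain ⟨c, hc⟩ := h
    linear_combination e * hc - c * he
  choose t ht using fun l => Ideal.Quotient.mk_surjective (ε l)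
  refine ⟨fun l => e * t l, fun l => ?_, ?_, fun l => ?_, fun l => ?_⟩
  · have := key (t l * t l) (t l) (by rw [map_mul, ht, h1])
    linear_combination (t l * t l) * he + this
  · have := key (∑ l, t l) 1 (by rw [map_sum]; simp only [ht, h2, map_one])
    rw [← Finset.mul_sum, this, mul_one]
  · have := key (t l * x) (t l * y l) (by rw [map_mul, map_mul, ht, h3])
    linear_combination this
  · linear_combination (- t l) * he
def PSplit.{u} {S : Type u} [CommRing S] (μ : S[X]) : Prop :=
  ∃ (n : ℕ) (r : Fin n → S), (∀ l, eval (r l) μ = 0) ∧ ∀ (𝓔 : Type u) [CommRing 𝓔] (β : S →+* 𝓔) (θ : 𝓔),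
    eval₂ β θ μ = 0 → ∃ e : Fin n → 𝓔, (∀ l, e l * e l = e l) ∧ ∑ l, e l = 1 ∧ ∀ l, e l * θ = e l * β (r l)
lemma PSplit.map.{u} {S S' : Type u} [CommRing S] [CommRing S'] {μ : S[X]} (h : PSplit μ) (φ : S →+* S') :
    PSplit (μ.map φ) := by
  obtain ⟨n, r, h1, h2⟩ := h
  refine ⟨n, fun l => φ (r l), fun l => by rw [eval_map_apply, h1, map_zero], ?_⟩
  intro 𝓔 _ β θ h
  rw [eval₂_map] at h
  exact h2 𝓔 _ θ h
lemma PSplit.zero.{u} {S : Type u} [CommRing S] {μ : S[X]} (h : μ.Monic) (h0 : μ.natDegree = 0) : PSplit μ := by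
  replace h0 := eq_one_of_monic_natDegree_zero h h0
  subst h0
  refine ⟨0, Fin.elim0, fun l => l.elim0, ?_⟩
  intro 𝓔 _ β θ h
  rw [eval₂_one] at h
  exact ⟨Fin.elim0, fun l => l.elim0, by rw [h]; simp, fun l => l.elim0⟩
lemma PSplit.succ.{u} {S : Type u} [CommRing S] {μ ν : S[X]} {r : S} (hμ : μ = (X - C r) * ν) (hs : μ.Separable)
    (hν : PSplit ν) : PSplit μ := by
  obtain ⟨n, s, h1, h2⟩ := hν
  refine ⟨n + 1, Fin.cons r s, ?_, ?_⟩
  · intro l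
    refine Fin.cases ?_ (fun l => ?_) l
    · simp [hμ]
    · simp [hμ, h1]
  intro 𝓔 _ β θ hθ
  obtain ⟨a, b, hab⟩ := hs
  have hu : β (eval r b) * β (eval r ν) = 1 := by
    have := congrArg (fun q => β (eval r q)) hab
    simp only [hμ, derivative_mul] at this
    simpa using this
  set ν' := eval₂ β θ ν
  have hθ' : (θ - β r) * ν' = 0 := by
    rw [hμ] at hθ; simpa [eval₂_mul] using hθ
  obtain ⟨κ, hκ⟩ : ∃ κ, ν' = β (eval r ν) + (θ - β r) * κ := by
    have := X_sub_C_dvd_sub_C_eval (a := r) (p := ν)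
    obtain ⟨q, hq⟩ := this
    refine ⟨eval₂ β θ q, ?_⟩
    have h := congrArg (eval₂ β θ) hq
    rw [eval₂_sub, eval₂_mul, eval₂_sub, eval₂_X, eval₂_C, eval₂_C] at h
    linear_combination h
  set e := β (eval r b) * ν'
  have he : e * e = e := by
    simp only [e]
    linear_combination (β (eval r b))^2 * ν' * hκ + (β (eval r b))^2 * κ * hθ' + β (eval r b) * ν' * hu
  have heθ : e * θ = e * β r := by
    simp only [e]
    linear_combination β (eval r b) * hθ'
  have he' : (1 - e) * (1 - e) = 1 - e := by linear_combination he
  obtain ⟨ε, g1, g2, g3⟩ := h2 (𝓔 ⧸ Ideal.span {1 - (1 - e)}) ((Ideal.Quotient.mk _).comp β) (Ideal.Quotient.mk _ θ) (by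
    rw [← hom_eval₂, Ideal.Quotient.eq_zero_iff_mem, Ideal.mem_span_singleton]
    refine ⟨β (eval r ν), ?_⟩
    change ν' = _
    simp only [e]
    linear_combination -ν' * hu)
  obtain ⟨η, k1, k2, k3, k4⟩ := idem_lift (1 - e) he' θ (fun l => β (s l)) ε g1 g2 g3
  refine ⟨Fin.cons e η, ?_, ?_, ?_⟩
  · intro l; refine Fin.cases ?_ (fun l => ?_) l
    · simpa using he
    · simpa using k1 l
  · rw [Fin.sum_univ_succ]; simp [k2]
  · intro l; refine Fin.cases ?_ (fun l => ?_) l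
    · simpa using heθ
    · simpa using k3 l
section
variable {p : ℕ} [hp : Fact p.Prime]
structure PObj.{u} (p : ℕ) [Fact p.Prime] (A : Type u) [CommRing A] where
  P : Type u
  [cr : CommRing P]
  [cp : CharP P p]
  [pr : PerfectRing P p]
  f : P
  nzd : ∀ b, f * b = 0 → b = 0
  nu : ¬ IsUnit f
  ι : A →+* EE p f
attribute [instance] PObj.cr PObj.cp PObj.pr
variable {A : Type*} [CommRing A]
structure PHom (X Y : PObj p A) where
  φ : X.P →+* Y.P
  hf : φ X.f = Y.f
  good : Good φ hf
  comm : ∀ a, EEmap φ hf (X.ι a) = Y.ι a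
def PHom.comp {X Y Z : PObj p A} (h : PHom X Y) (h' : PHom Y Z) : PHom X Z where
  φ := h'.φ.comp h.φ
  hf := by rw [RingHom.comp_apply, h.hf, h'.hf]
  good := h.good.comp h'.good
  comm a := by rw [← EEmap_comp h.φ h'.φ h.hf h'.hf, h.comm, h'.comm]
def PHom.id (X : PObj p A) : PHom X X where
  φ := RingHom.id _
  hf := rfl
  good := Good.id X.nzd
  comm a := by
    obtain ⟨z, hz⟩ := Ideal.Quotient.mk_surjective (X.ι a)
    rw [← hz, EEmap_mk, WittVector.map_id]; rfl
variable (c : A)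
abbrev PObj.Qg (X : PObj p A) : Type _ := Localization.Away (X.ι c)
noncomputable def PObj.str (X : PObj p A) : A →+* X.Qg c := (algebraMap _ _).comp X.ι
lemma PObj.str_unit (X : PObj p A) : IsUnit (X.str c c) :=
  IsLocalization.Away.algebraMap_isUnit (S := X.Qg c) (X.ι c)
noncomputable def PHom.loc {X Y : PObj p A} (h : PHom X Y) : X.Qg c →+* Y.Qg c :=
  IsLocalization.Away.lift (X.ι c) (g := (algebraMap (EE p Y.f) (Y.Qg c)).comp (EEmap h.φ h.hf)) (by
    rw [RingHom.comp_apply, h.comm]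
    exact IsLocalization.Away.algebraMap_isUnit _)
lemma PHom.loc_algebraMap {X Y : PObj p A} (h : PHom X Y) (z : EE p X.f) :
    h.loc c (algebraMap _ _ z) = algebraMap _ (Y.Qg c) (EEmap h.φ h.hf z) :=
  IsLocalization.Away.lift_eq _ _ _
lemma PHom.loc_str {X Y : PObj p A} (h : PHom X Y) (a : A) : h.loc c (X.str c a) = Y.str c a := by
  rw [PObj.str, RingHom.comp_apply, loc_algebraMap, h.comm]; rfl
lemma PHom.loc_comp {X Y Z : PObj p A} (h : PHom X Y) (h' : PHom Y Z) :
    (h.comp h').loc c = (h'.loc c).comp (h.loc c) := by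
  apply IsLocalization.ringHom_ext (Submonoid.powers (X.ι c))
  refine RingHom.ext fun z => ?_
  simp only [RingHom.comp_apply]
  rw [loc_algebraMap, loc_algebraMap, loc_algebraMap, EEmap_comp]
  rfl
theorem exists_root0.{u} {A : Type u} [CommRing A] (X : PObj.{u} p A) (w : (EE p X.f)[X]) (hw : w.Monic) (hD : 0 < w.natDegree) :
    ∃ (Y : PObj.{u} p A) (h : PHom X Y) (y : Y.P), eval₂ (EEmap h.φ h.hf) (te p Y.f y) w = 0 := by
  obtain ⟨P', _, _, _, φ, hg, y, hy⟩ := andre X.f X.nzd X.nu w hw hD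
  exact ⟨⟨P', φ X.f, hg.nzd, hg.nontrivial X.nu, (EEmap φ rfl).comp X.ι⟩, ⟨φ, rfl, hg, fun a => rfl⟩, y, hy⟩
lemma exists_scale {E L : Type*} [CommRing E] [CommRing L] [Algebra E L] (M : Submonoid E) [IsLocalization M L]
    (μ : L[X]) (hμ : μ.Monic) : ∃ (s : M) (w : E[X]), w.Monic ∧ w.natDegree = μ.natDegree ∧
      w.map (algebraMap E L) = scaleRoots μ (algebraMap E L s) := by
  classical
  obtain ⟨s, hs⟩ := IsLocalization.exist_integer_multiples_of_finset M (Finset.univ.image (fun i : Fin μ.natDegree => μ.coeff i))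
  have hl : scaleRoots μ (algebraMap E L s) ∈ lifts (algebraMap E L) := by
    rw [lifts_iff_coeff_lifts]
    intro i
    rw [coeff_scaleRoots]
    rcases lt_trichotomy i μ.natDegree with h | h | h
    · obtain ⟨a, ha⟩ := hs (μ.coeff i) (Finset.mem_image.mpr ⟨⟨i, h⟩, Finset.mem_univ _, rfl⟩)
      refine ⟨a * s ^ (μ.natDegree - i - 1), ?_⟩
      rw [map_mul, ha, map_pow, Algebra.smul_def]
      have : μ.natDegree - i = (μ.natDegree - i - 1) + 1 := by omega
      conv_rhs => rw [this, pow_succ]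
      ring
    · subst h
      refine ⟨1, ?_⟩
      have : μ.coeff μ.natDegree = 1 := hμ
      rw [this]; simp
    · exact ⟨0, by rw [coeff_eq_zero_of_natDegree_lt h]; simp⟩
  obtain ⟨w, h1, h2, h3⟩ := lifts_and_natDegree_eq_and_monic hl ((monic_scaleRoots_iff _).mpr hμ)
  exact ⟨s, w, h3, by rw [h2, natDegree_scaleRoots], h1⟩
theorem exists_root.{u} {A : Type u} [CommRing A] (c : A) (X : PObj.{u} p A) (μ : (X.Qg c)[X]) (hw : μ.Monic) (hD : 0 < μ.natDegree) :
    ∃ (Y : PObj.{u} p A) (h : PHom X Y) (r : Y.Qg c), eval r (μ.map (h.loc c)) = 0 := by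
  obtain ⟨s, w, h1, h2, h3⟩ := exists_scale (Submonoid.powers (X.ι c)) μ hw
  obtain ⟨Y, h, y, hy⟩ := exists_root0 X w h1 (h2 ▸ hD)
  have hu : IsUnit (h.loc c (algebraMap _ (X.Qg c) (s : EE p X.f))) := (IsLocalization.map_units _ s).map _
  obtain ⟨u, hu⟩ := hu
  refine ⟨Y, h, (↑u⁻¹ : Y.Qg c) * algebraMap _ _ (te p Y.f y), ?_⟩
  rw [eval_map]
  have h4 := scaleRoots_eval₂_mul (p := μ) (h.loc c) ((↑u⁻¹ : Y.Qg c) * algebraMap _ _ (te p Y.f y)) (algebraMap _ (X.Qg c) (s : EE p X.f))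
  rw [← h3, eval₂_map, ← hu, Units.mul_inv_cancel_left] at h4
  have h5 : (h.loc c).comp (algebraMap (EE p X.f) (X.Qg c)) = (algebraMap (EE p Y.f) (Y.Qg c)).comp (EEmap h.φ h.hf) := by
    exact RingHom.ext fun z => h.loc_algebraMap c z
  rw [h5, ← hom_eval₂, hy, map_zero] at h4
  have := (u.isUnit.pow μ.natDegree).mul_right_eq_zero.mp h4.symm
  exact this
theorem exists_psplit.{u} {A : Type u} [CommRing A] (c : A) (n : ℕ) : ∀ (X : PObj.{u} p A) (μ : Polynomial (X.Qg c)), μ.Monic → μ.natDegree = n → μ.Separable →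
    ∃ (Y : PObj.{u} p A) (h : PHom X Y), PSplit (μ.map (h.loc c)) := by
  induction n with
  | zero => intro X μ hm h0 _; exact ⟨X, PHom.id X, (PSplit.zero hm h0).map _⟩
  | succ n ih =>
    intro X μ hm hn hs
    obtain ⟨Y, h, r, hr⟩ := exists_root c X μ hm (by omega)
    obtain ⟨ν, hν⟩ := dvd_iff_isRoot.mpr hr
    have hm' : (μ.map (h.loc c)).Monic := hm.map _
    have hνm : ν.Monic := (monic_X_sub_C r).of_mul_monic_left (hν ▸ hm')
    rcases subsingleton_or_nontrivial (Y.Qg c) with hS | hN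
    · exact ⟨Y, h, PSplit.zero hm' (by rw [Subsingleton.elim (μ.map (h.loc c)) 0]; simp)⟩
    obtain ⟨Z, h', hZ⟩ := ih Y ν hνm (by
      have := congrArg natDegree hν
      rw [(monic_X_sub_C r).natDegree_mul hνm, hm.natDegree_map, natDegree_X_sub_C] at this
      omega) (by
      have : (μ.map (h.loc c)).Separable := hs.map
      rw [hν] at this; exact this.of_mul_right)
    refine ⟨Z, h.comp h', ?_⟩
    rw [PHom.loc_comp, ← Polynomial.map_map]
    refine PSplit.succ (r := h'.loc c r) (ν := ν.map (h'.loc c)) ?_ hs.map.map hZ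
    rw [hν, Polynomial.map_mul]; simp
theorem exists_psplit_fin.{u} {A : Type u} [CommRing A] (c : A) {ι : Type*} (s : Finset ι) (X : PObj.{u} p A) (μ : ι → (X.Qg c)[X])
    (h1 : ∀ i, (μ i).Monic) (h2 : ∀ i, (μ i).Separable) :
    ∃ (Y : PObj.{u} p A) (h : PHom X Y), ∀ i ∈ s, PSplit ((μ i).map (h.loc c)) := by
  classical
  induction s using Finset.induction_on with
  | empty => exact ⟨X, PHom.id X, by simp⟩
  | insert i s hi ih =>
    obtain ⟨Y, h, hY⟩ := ih
    obtain ⟨Z, h', hZ⟩ := exists_psplit c _ Y ((μ i).map (h.loc c)) ((h1 i).map _) rfl (h2 i).map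
    refine ⟨Z, h.comp h', ?_⟩
    intro j hj
    rw [PHom.loc_comp, ← Polynomial.map_map]
    rcases Finset.mem_insert.mp hj with rfl | hj
    · exact hZ
    · exact (hY j hj).map _
end
end ACM
/-! ## Towers of standard etale extensions, splitting -/
namespace ACM
open Polynomial
section
variable {Ω : Type*} [Field Ω]
def Step (B B' : Subring Ω) : Prop :=
  ∃ (μ : B[X]) (θ : Ω), μ.Monic ∧ μ.Separable ∧ aeval θ μ = 0 ∧ (∀ q : B[X], aeval θ q = 0 → μ ∣ q) ∧
    ∀ z, z ∈ B' ↔ ∃ q : B[X], aeval θ q = z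
inductive Tow (B0 : Subring Ω) : Subring Ω → Prop
  | base : Tow B0 B0
  | step {B B' : Subring Ω} : Tow B0 B → Step B B' → Tow B0 B'
lemma Step.le {B B' : Subring Ω} (h : Step B B') : B ≤ B' := by
  obtain ⟨μ, θ, -, -, -, -, h⟩ := h
  intro z hz
  exact (h z).mpr ⟨C ⟨z, hz⟩, by rw [aeval_C]; rfl⟩
lemma Tow.le {B0 B : Subring Ω} (h : Tow B0 B) : B0 ≤ B := by
  induction h with
  | base => exact le_rfl
  | step _ h ih => exact ih.trans h.le
lemma Tow.trans {B0 B B' : Subring Ω} (h : Tow B0 B) (h' : Tow B B') : Tow B0 B' := by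
  induction h' with
  | base => exact h
  | step _ h ih => exact Tow.step ih h
lemma step_lift {B B' : Subring Ω} {μ : B[X]} {θ : Ω} (_h0 : aeval θ μ = 0) (h1 : ∀ q : B[X], aeval θ q = 0 → μ ∣ q)
    (h2 : ∀ z, z ∈ B' ↔ ∃ q : B[X], aeval θ q = z) {S : Type*} [CommRing S] (φ : B →+* S) (s : S) (hs : eval₂ φ s μ = 0) :
    ∃ ψ : B' →+* S, ∀ (q : B[X]) (z : B'), aeval θ q = (z : Ω) → ψ z = eval₂ φ s q := by
  let π : B[X] →+* B' := (aeval θ : B[X] →ₐ[B] Ω).toRingHom.codRestrict B' (fun q => (h2 _).mpr ⟨q, rfl⟩)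
  have hπ : Function.Surjective π := by
    intro z
    obtain ⟨q, hq⟩ := (h2 z).mp z.2
    exact ⟨q, Subtype.ext hq⟩
  have hk : RingHom.ker π ≤ RingHom.ker (eval₂RingHom φ s) := by
    intro q hq
    have hq' : aeval θ q = 0 := congrArg Subtype.val ((RingHom.mem_ker).mp hq)
    obtain ⟨r, rfl⟩ := h1 q hq'
    rw [RingHom.mem_ker, coe_eval₂RingHom, eval₂_mul, hs, zero_mul]
  refine ⟨RingHom.liftOfSurjective π hπ ⟨eval₂RingHom φ s, hk⟩, ?_⟩
  intro q z hz
  have : z = π q := Subtype.ext hz.symm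
  rw [this]
  exact RingHom.liftOfRightInverse_comp_apply _ _ _ _ _
variable {p : ℕ} [hp : Fact p.Prime]
def SPL.{u} {A Ω : Type u} [CommRing A] [Field Ω] (c : A) (j : A →+* Ω) (Y : PObj.{u} p A) (B : Subring Ω) : Prop :=
  ∃ (ι : Type) (_ : Fintype ι) (ρ : ι → B →+* Y.Qg c), (∀ l (b : B) a, (b : Ω) = j a → ρ l b = Y.str c a) ∧
    ∀ (𝓔 : Type u) [CommRing 𝓔] (α : B →+* 𝓔) (β : Y.Qg c →+* 𝓔),
      (∀ (b : B) a, (b : Ω) = j a → α b = β (Y.str c a)) →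
      ∃ e : ι → 𝓔, (∀ l, e l * e l = e l) ∧ ∑ l, e l = 1 ∧ ∀ l b, e l * α b = e l * β (ρ l b)
lemma SPL.map.{u} {A Ω : Type u} [CommRing A] [Field Ω] {c : A} {j : A →+* Ω} {Y Z : PObj.{u} p A} {B : Subring Ω}
    (h : SPL c j Y B) (ψ : PHom Y Z) : SPL c j Z B := by
  obtain ⟨ι, _, ρ, h1, h2⟩ := h
  refine ⟨ι, inferInstance, fun l => (ψ.loc c).comp (ρ l), ?_, ?_⟩
  · intro l b a h
    rw [RingHom.comp_apply, h1 l b a h, ψ.loc_str]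
  · intro 𝓔 _ α β hαβ
    exact h2 𝓔 α (β.comp (ψ.loc c)) (fun b a h => by rw [hαβ b a h, RingHom.comp_apply, ψ.loc_str])
lemma SPL.base.{u} {A Ω : Type u} [CommRing A] [Field Ω] {c : A} {j : A →+* Ω} (Y : PObj.{u} p A) (B : Subring Ω)
    (hj : Function.Injective j) (h1 : ∀ a, j a ∈ B) (hc : j c ≠ 0) (h2 : (j c)⁻¹ ∈ B) (h3 : ∀ z ∈ B, ∃ n a, z * j c ^ n = j a) :
    SPL c j Y B := by
  letI := (j.codRestrict B h1).toAlgebra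
  have hal : ∀ a, ((algebraMap A B a : B) : Ω) = j a := fun a => rfl
  haveI : IsLocalization.Away c B := by
    refine ⟨⟨?_, ?_, ?_⟩⟩
    · rintro ⟨_, n, rfl⟩
      change IsUnit (algebraMap A B (c ^ n))
      rw [map_pow]
      refine IsUnit.pow _ (IsUnit.of_mul_eq_one ⟨_, h2⟩ (Subtype.ext ?_))
      exact mul_inv_cancel₀ hc
    · intro z
      obtain ⟨n, a, h⟩ := h3 z z.2
      refine ⟨(a, ⟨c ^ n, n, rfl⟩), Subtype.ext ?_⟩
      change (z : Ω) * j (c ^ n) = j a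
      rw [map_pow, h]
    · intro x y
      intro h
      have : j x = j y := congrArg Subtype.val h
      exact ⟨1, by rw [hj this]⟩
  refine ⟨Unit, inferInstance, fun _ => IsLocalization.Away.lift c (g := Y.str c) (Y.str_unit c), ?_, ?_⟩
  · intro _ b a hb
    have : b = algebraMap A B a := Subtype.ext hb
    rw [this, IsLocalization.Away.lift_eq]
  · intro 𝓔 _ α β h
    refine ⟨fun _ => 1, fun _ => one_mul 1, by simp, fun _ b => ?_⟩
    have : α = β.comp (IsLocalization.Away.lift c (g := Y.str c) (Y.str_unit c)) := by
      apply IsLocalization.ringHom_ext (Submonoid.powers c)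
      refine RingHom.ext fun a => ?_
      rw [RingHom.comp_apply, RingHom.comp_apply, RingHom.comp_apply, IsLocalization.Away.lift_eq]
      exact h _ _ rfl
    conv_lhs => rw [this]
    rfl
lemma SPL.step.{u} {A Ω : Type u} [CommRing A] [Field Ω] {c : A} {j : A →+* Ω} {Y : PObj.{u} p A} {B B' : Subring Ω}
    (hB : ∀ a, j a ∈ B)
    (h : SPL c j Y B) (hS : Step B B') : ∃ (Z : PObj.{u} p A) (_ : PHom Y Z), SPL c j Z B' := by
  classical
  obtain ⟨ι, _, ρ, h1, h2⟩ := h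
  have hle := hS.le
  obtain ⟨μ, θ, m1, m2, m3, m4, m5⟩ := hS
  obtain ⟨Z, ψ, hZ⟩ := exists_psplit_fin c Finset.univ Y (fun i => μ.map (ρ i)) (fun i => m1.map _) (fun i => m2.map)
  refine ⟨Z, ψ, ?_⟩
  choose n r hr hr' using fun i => hZ i (Finset.mem_univ i)
  have hl := fun (i : ι) (k : Fin (n i)) => step_lift m3 m4 m5 ((ψ.loc c).comp (ρ i)) (r i k) (by
    have := hr i k
    rwa [eval_map, eval₂_map] at this)
  choose ρ' hρ' using hl
  have hρC : ∀ i k (b : B) (z : B'), (b : Ω) = z → ρ' i k z = ψ.loc c (ρ i b) := by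
    intro i k b z hz
    rw [hρ' i k (C b) z (by rw [aeval_C]; exact hz), eval₂_C]; rfl
  have hθ : θ ∈ B' := (m5 θ).mpr ⟨X, aeval_X _⟩
  have hρθ : ∀ i k, ρ' i k ⟨θ, hθ⟩ = r i k := by
    intro i k
    rw [hρ' i k X _ (aeval_X _), eval₂_X]
  refine ⟨Σ i, Fin (n i), inferInstance, fun x => ρ' x.1 x.2, ?_, ?_⟩
  · intro l b a hb
    rw [hρC _ _ ⟨j a, hB a⟩ b hb.symm, h1 _ _ a rfl, ψ.loc_str]
  intro 𝓔 _ α β hαβ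
  have hinc : ∀ b : B, ((Subring.inclusion hle b : B') : Ω) = b := fun b => rfl
  obtain ⟨e, e1, e2, e3⟩ := h2 𝓔 (α.comp (Subring.inclusion hle)) (β.comp (ψ.loc c)) (by
    intro b a hb
    rw [RingHom.comp_apply, RingHom.comp_apply, ψ.loc_str]
    exact hαβ _ a hb)
  have hq : ∀ i (b : B), Ideal.Quotient.mk (Ideal.span {1 - e i}) (α (Subring.inclusion hle b)) =
      Ideal.Quotient.mk (Ideal.span {1 - e i}) (β (ψ.loc c (ρ i b))) := by
    intro i b
    rw [Ideal.Quotient.eq, Ideal.mem_span_singleton]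
    refine ⟨α (Subring.inclusion hle b) - β (ψ.loc c (ρ i b)), ?_⟩
    have := e3 i b
    simp only [RingHom.comp_apply] at this
    linear_combination this
  have key : ∀ i, ∃ η : Fin (n i) → 𝓔, (∀ l, η l * η l = η l) ∧ ∑ l, η l = e i ∧
      (∀ l, η l * α ⟨θ, hθ⟩ = η l * β (r i l)) ∧ ∀ l, η l = e i * η l := by
    intro i
    obtain ⟨ε, g1, g2, g3⟩ := hr' i (𝓔 ⧸ Ideal.span {1 - e i}) ((Ideal.Quotient.mk _).comp β) (Ideal.Quotient.mk _ (α ⟨θ, hθ⟩)) (by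
      rw [eval₂_map, eval₂_map]
      have : (((Ideal.Quotient.mk (Ideal.span {1 - e i})).comp β).comp (ψ.loc c)).comp (ρ i) =
          (Ideal.Quotient.mk (Ideal.span {1 - e i})).comp (α.comp (Subring.inclusion hle)) :=
        RingHom.ext fun b => (hq i b).symm
      rw [this, ← hom_eval₂, ← hom_eval₂]
      have h0 : eval₂ (Subring.inclusion hle) ⟨θ, hθ⟩ μ = 0 := by
        apply Subtype.ext
        have := hom_eval₂ μ (Subring.inclusion hle) B'.subtype ⟨θ, hθ⟩
        refine this.trans ?_
        exact m3
      rw [h0, map_zero, map_zero])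
    exact idem_lift (e i) (e1 i) _ (fun l => β (r i l)) ε g1 g2 g3
  choose η k1 k2 k3 k4 using key
  refine ⟨fun x => η x.1 x.2, fun x => k1 _ _, ?_, ?_⟩
  · rw [Fintype.sum_sigma]; simp only [k2, e2]
  · rintro ⟨i, k⟩ b
    have hJ : (Ideal.Quotient.mk (Ideal.span {1 - η i k})).comp α = ((Ideal.Quotient.mk (Ideal.span {1 - η i k})).comp β).comp (ρ' i k) := by
      refine RingHom.ext fun b => ?_
      obtain ⟨q, hq'⟩ := (m5 b).mp b.2
      have hb : b = eval₂ (Subring.inclusion hle) ⟨θ, hθ⟩ q := by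
        apply Subtype.ext
        rw [← hq']
        exact (hom_eval₂ q (Subring.inclusion hle) B'.subtype ⟨θ, hθ⟩).symm
      rw [hb, hom_eval₂, hom_eval₂]
      congr 1
      · refine RingHom.ext fun b => ?_
        simp only [RingHom.comp_apply]
        rw [hρC i k b _ rfl, Ideal.Quotient.eq, Ideal.mem_span_singleton]
        refine ⟨α (Subring.inclusion hle b) - β (ψ.loc c (ρ i b)), ?_⟩
        have := e3 i b
        simp only [RingHom.comp_apply] at this
        linear_combination η i k * this + (α (Subring.inclusion hle b) - β (ψ.loc c (ρ i b))) * k4 i k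
      · simp only [RingHom.comp_apply]
        rw [hρθ, Ideal.Quotient.eq, Ideal.mem_span_singleton]
        exact ⟨α ⟨θ, hθ⟩ - β (r i k), by linear_combination k3 i k⟩
    have := congrArg (fun φ => φ b) hJ
    simp only [RingHom.comp_apply] at this
    rw [Ideal.Quotient.eq, Ideal.mem_span_singleton] at this
    obtain ⟨x, hx⟩ := this
    change η i k * α b = η i k * β (ρ' i k b)
    linear_combination η i k * hx - x * k1 i k
theorem Tow.spl.{u} {A Ω : Type u} [CommRing A] [Field Ω] {c : A} {j : A →+* Ω} (Y : PObj.{u} p A) {B0 B : Subring Ω}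
    (hj : Function.Injective j) (h1 : ∀ a, j a ∈ B0) (hc : j c ≠ 0) (h2 : (j c)⁻¹ ∈ B0) (h3 : ∀ z ∈ B0, ∃ n a, z * j c ^ n = j a)
    (h : Tow B0 B) : ∃ (Z : PObj.{u} p A) (_ : PHom Y Z), SPL c j Z B := by
  induction h with
  | base => exact ⟨Y, PHom.id Y, SPL.base Y B0 hj h1 hc h2 h3⟩
  | step hT hS ih =>
    obtain ⟨Z, ψ, hZ⟩ := ih
    obtain ⟨Z', ψ', h⟩ := SPL.step (fun a => hT.le (h1 a)) hZ hS
    exact ⟨Z', ψ.comp ψ', h⟩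
end
end ACM
/-! ## Normality in towers -/
namespace ACM
open Polynomial
section
variable {Ω : Type*} [Field Ω]
def Nrm (B : Subring Ω) : Prop := ∀ a ∈ B, ∀ b ∈ B, IsIntegral B (a / b) → a / b ∈ B
lemma nrm_iff (B : Subring Ω) : IsIntegrallyClosed B ↔ Nrm B := by
  letI : Algebra (FractionRing B) Ω := FractionRing.liftAlgebra B Ω
  haveI : IsScalarTower B (FractionRing B) Ω := FractionRing.isScalarTower_liftAlgebra B Ω
  have inj : Function.Injective (algebraMap (FractionRing B) Ω) := (algebraMap (FractionRing B) Ω).injective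
  have hB : ∀ b : B, algebraMap B Ω b = b := fun b => rfl
  rw [isIntegrallyClosed_iff (FractionRing B)]
  constructor
  · intro h a ha b hb hab
    have e : a / b = algebraMap (FractionRing B) Ω (algebraMap B _ ⟨a, ha⟩ / algebraMap B _ ⟨b, hb⟩) := by
      rw [map_div₀, ← IsScalarTower.algebraMap_apply, ← IsScalarTower.algebraMap_apply]; rfl
    rw [e, isIntegral_algebraMap_iff inj] at hab
    obtain ⟨y, hy⟩ := h hab
    rw [e, ← hy, ← IsScalarTower.algebraMap_apply]
    exact y.2
  · intro h x hx
    obtain ⟨a, b, hb, rfl⟩ := IsFractionRing.div_surjective (A := B) x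
    have e : (a : Ω) / b = algebraMap (FractionRing B) Ω (algebraMap B _ a / algebraMap B _ b) := by
      rw [map_div₀, ← IsScalarTower.algebraMap_apply, ← IsScalarTower.algebraMap_apply]; rfl
    have := h a a.2 b b.2 (by rw [e, isIntegral_algebraMap_iff inj]; exact hx)
    refine ⟨⟨_, this⟩, inj ?_⟩
    rw [← e, ← IsScalarTower.algebraMap_apply]; rfl
lemma aeval_sub (B : Subring Ω) (θ : Ω) (q : B[X]) : aeval θ q = eval θ (q.map B.subtype) := by
  rw [eval_map]; rfl
lemma step_nrm {B B' : Subring Ω} (hS : Step B B') (hB : Nrm B) : Nrm B' := by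
  have hle := hS.le
  obtain ⟨μ, θ, m1, m2, m3, m4, m5⟩ := hS
  haveI := (nrm_iff B).mpr hB
  letI : Algebra (FractionRing B) Ω := FractionRing.liftAlgebra B Ω
  haveI : IsScalarTower B (FractionRing B) Ω := FractionRing.isScalarTower_liftAlgebra B Ω
  set K := FractionRing B with hK
  have hint : IsIntegral K θ := ⟨μ.map (algebraMap B K), m1.map _, by
    rw [eval₂_map, ← IsScalarTower.algebraMap_eq]; exact m3⟩
  let F := IntermediateField.adjoin K {θ}
  let φ : K[X] →ₐ[K] F := aeval (IntermediateField.AdjoinSimple.gen K θ)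
  have hφ : ∀ q, ((φ q : F) : Ω) = aeval θ q := by
    intro q
    have := Polynomial.aeval_algebraMap_apply Ω (IntermediateField.AdjoinSimple.gen K θ) q
    exact this.symm
  have hφs : Function.Surjective φ := by
    intro z
    have hz : (z : Ω) ∈ Algebra.adjoin K {θ} := by
      rw [← IntermediateField.adjoin_simple_toSubalgebra_of_isAlgebraic hint.isAlgebraic]; exact z.2
    rw [Algebra.adjoin_singleton_eq_range_aeval] at hz
    obtain ⟨q, hq⟩ := hz
    exact ⟨q, Subtype.ext (by rw [hφ]; exact hq)⟩
  have hμK : aeval θ (μ.map (algebraMap B K)) = 0 := by rw [aeval_map_algebraMap]; exact m3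
  have hker : RingHom.ker (φ.restrictScalars B).toRingHom = Ideal.span {μ.map (algebraMap B K)} := by
    ext q
    rw [RingHom.mem_ker, Ideal.mem_span_singleton]
    change φ q = 0 ↔ _
    have h0 : φ q = 0 ↔ aeval θ q = 0 := by
      rw [← hφ]; exact ⟨fun h => by rw [h]; rfl, fun h => Subtype.ext h⟩
    rw [h0]
    constructor
    · intro hq
      obtain ⟨b, hbM, hb⟩ := IsLocalization.integerNormalization_spec (nonZeroDivisors B) q
      rw [Algebra.smul_def, IsScalarTower.algebraMap_apply B K K[X], Polynomial.algebraMap_apply,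
        Algebra.algebraMap_self_apply] at hb
      have h1 : aeval θ (IsLocalization.integerNormalization (nonZeroDivisors B) q) = 0 := by
        rw [← aeval_map_algebraMap K, hb, map_mul, hq, mul_zero]
      obtain ⟨r, hr⟩ := m4 _ h1
      have hbu : IsUnit (algebraMap B K b) := IsLocalization.map_units K (⟨b, hbM⟩ : nonZeroDivisors B)
      obtain ⟨u, hu⟩ := hbu
      have h2 : q = C (↑u⁻¹ : K) * (C (algebraMap B K b) * q) := by
        rw [← mul_assoc, ← C_mul, ← hu, Units.inv_mul, C_1, one_mul]
      rw [h2, ← hb, hr, Polynomial.map_mul]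
      exact Dvd.dvd.mul_left (dvd_mul_right _ _) _
    · rintro ⟨r, rfl⟩
      rw [map_mul, hμK, zero_mul]
  have hBF : ∀ z ∈ B', z ∈ F := by
    intro z hz
    obtain ⟨q, rfl⟩ := (m5 z).mp hz
    rw [← aeval_map_algebraMap K, ← hφ]
    exact (φ _).2
  have hθ : θ ∈ B' := (m5 θ).mpr ⟨X, aeval_X _⟩
  intro a ha b hb hab
  have hyF : a / b ∈ F := F.div_mem (hBF a ha) (hBF b hb)
  -- a / b integral over B
  letI : Algebra B B' := (Subring.inclusion hle).toAlgebra
  haveI : IsScalarTower B B' Ω := IsScalarTower.of_algebraMap_eq (fun _ => rfl)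
  have hθB : IsIntegral B θ := ⟨μ, m1, m3⟩
  haveI : Algebra.IsIntegral B B' := by
    constructor
    intro z
    obtain ⟨q, hq⟩ := (m5 z).mp z.2
    have h1 : IsIntegral B (aeval θ q) := by
      have : aeval θ q ∈ Algebra.adjoin B {θ} := by
        rw [Algebra.adjoin_singleton_eq_range_aeval]; exact ⟨q, rfl⟩
      exact adjoin_le_integralClosure hθB this
    rw [hq] at h1
    exact (isIntegral_algebraMap_iff (A := B') (B := Ω) Subtype.val_injective).mp h1
  have hab' : IsIntegral B (a / b) := isIntegral_trans _ hab
  haveI : IsScalarTower B F Ω := IsScalarTower.of_algebraMap_eq (fun b => by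
    rw [IsScalarTower.algebraMap_apply B K F, ← IsScalarTower.algebraMap_apply K F Ω, ← IsScalarTower.algebraMap_apply B K Ω])
  have hy : IsIntegral B (⟨a / b, hyF⟩ : F) := by
    have := isIntegral_algebraMap_iff (R := B) (A := F) (B := Ω) (x := ⟨a / b, hyF⟩) Subtype.val_injective
    exact this.mp hab'
  obtain ⟨g, hg, hgi⟩ := exists_derivative_mul_eq_and_isIntegral_coeff (R := B) (S := K) (φ := φ.restrictScalars B) hφs
    (m1.map (algebraMap B K)) (fun i => by rw [coeff_map]; exact isIntegral_algebraMap) hker hy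
  have hgl : g ∈ lifts (algebraMap B K) := by
    rw [lifts_iff_coeff_lifts]
    intro i
    obtain ⟨y, hy⟩ := IsIntegrallyClosed.isIntegral_iff.mp (hgi i)
    exact ⟨y, hy⟩
  obtain ⟨g', rfl⟩ := (mem_lifts _).mp hgl
  have hg' : aeval θ (derivative μ) * (a / b) = aeval θ g' := by
    have := congrArg (fun z : F => (z : Ω)) hg
    simp only [AlgHom.restrictScalars_apply, MulMemClass.coe_mul, hφ, derivative_map, aeval_map_algebraMap] at this
    exact this
  obtain ⟨s, t, hst⟩ := m2
  have hu : aeval θ t * aeval θ (derivative μ) = 1 := by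
    have := congrArg (aeval θ) hst
    rw [map_add, map_mul, map_mul, m3, mul_zero, zero_add, map_one] at this
    exact this
  have : a / b = aeval θ (t * g') := by
    rw [map_mul, ← hg', ← mul_assoc, hu, one_mul]
  rw [this]
  exact (m5 _).mpr ⟨_, rfl⟩
def adj (C : Subring Ω) (θ : Ω) : Subring Ω := (Algebra.adjoin C {θ}).toSubring
lemma mem_adj {C : Subring Ω} {θ z : Ω} : z ∈ adj C θ ↔ ∃ q : C[X], aeval θ q = z := by
  change z ∈ Algebra.adjoin C {θ} ↔ _
  rw [Algebra.adjoin_singleton_eq_range_aeval]; rfl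
lemma step_exists {C : Subring Ω} (hC : Nrm C) (θ : Ω) (μ : C[X]) (h1 : μ.Monic) (h2 : μ.Separable) (h3 : aeval θ μ = 0) :
    Step C (adj C θ) := by
  haveI := (nrm_iff C).mpr hC
  have hi : IsIntegral C θ := ⟨μ, h1, h3⟩
  obtain ⟨r, hr⟩ := minpoly.isIntegrallyClosed_dvd hi h3
  refine ⟨minpoly C θ, θ, minpoly.monic hi, ?_, minpoly.aeval _ _, fun q hq => minpoly.isIntegrallyClosed_dvd hi hq, fun z => mem_adj⟩
  rw [hr] at h2
  exact h2.of_mul_left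
lemma Tow.nrm {B0 B : Subring Ω} (h : Tow B0 B) (h0 : Nrm B0) : Nrm B := by
  induction h with
  | base => exact h0
  | step _ h ih => exact step_nrm h ih
lemma Tow.base_change {B0 B C : Subring Ω} (h : Tow B0 B) (hC : Nrm C) (hle : B0 ≤ C) :
    ∃ C', Tow C C' ∧ B ≤ C' := by
  induction h with
  | base => exact ⟨C, Tow.base, hle⟩
  | @step B B' _ hs ih =>
    obtain ⟨C', hT, hBC⟩ := ih
    obtain ⟨μ, θ, m1, m2, m3, m4, m5⟩ := hs
    have hm : ∀ q : B[X], aeval θ (q.map (Subring.inclusion hBC)) = aeval θ q := by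
      intro q
      rw [aeval_sub, aeval_sub, Polynomial.map_map]; rfl
    refine ⟨adj C' θ, hT.step (step_exists (hT.nrm hC) θ (μ.map (Subring.inclusion hBC)) (m1.map _) m2.map (by rw [hm, m3])), ?_⟩
    intro z hz
    obtain ⟨q, rfl⟩ := (m5 z).mp hz
    exact mem_adj.mpr ⟨_, hm q⟩
lemma Tow.directed {B0 B B' : Subring Ω} (h0 : Nrm B0) (h : Tow B0 B) (h' : Tow B0 B') :
    ∃ B'', Tow B B'' ∧ B' ≤ B'' := h'.base_change (h.nrm h0) h.le
def UU (B0 : Subring Ω) (h0 : Nrm B0) : Subring Ω where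
  carrier := {z | ∃ B, Tow B0 B ∧ z ∈ B}
  zero_mem' := ⟨B0, Tow.base, B0.zero_mem⟩
  one_mem' := ⟨B0, Tow.base, B0.one_mem⟩
  add_mem' := by
    rintro a b ⟨B, hB, ha⟩ ⟨B', hB', hb⟩
    obtain ⟨C, h1, h2⟩ := hB.directed h0 hB'
    exact ⟨C, hB.trans h1, C.add_mem (h1.le ha) (h2 hb)⟩
  mul_mem' := by
    rintro a b ⟨B, hB, ha⟩ ⟨B', hB', hb⟩
    obtain ⟨C, h1, h2⟩ := hB.directed h0 hB'
    exact ⟨C, hB.trans h1, C.mul_mem (h1.le ha) (h2 hb)⟩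
  neg_mem' := by
    rintro a ⟨B, hB, ha⟩
    exact ⟨B, hB, B.neg_mem ha⟩
lemma mem_UU {B0 : Subring Ω} {h0 : Nrm B0} {z : Ω} : z ∈ UU B0 h0 ↔ ∃ B, Tow B0 B ∧ z ∈ B := Iff.rfl
lemma UU_finite {B0 : Subring Ω} {h0 : Nrm B0} (s : Finset Ω) (hs : ∀ z ∈ s, z ∈ UU B0 h0) :
    ∃ B, Tow B0 B ∧ ∀ z ∈ s, z ∈ B := by
  classical
  induction s using Finset.induction_on with
  | empty => exact ⟨B0, Tow.base, by simp⟩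
  | insert a s ha ih =>
    obtain ⟨B, hB, h⟩ := ih (fun z hz => hs z (Finset.mem_insert_of_mem hz))
    obtain ⟨B', hB', h'⟩ := hs a (Finset.mem_insert_self _ _)
    obtain ⟨C, h1, h2⟩ := hB.directed h0 hB'
    refine ⟨C, hB.trans h1, fun z hz => ?_⟩
    rcases Finset.mem_insert.mp hz with rfl | hz
    · exact h2 h'
    · exact h1.le (h z hz)
lemma le_UU {B0 B : Subring Ω} {h0 : Nrm B0} (h : Tow B0 B) : B ≤ UU B0 h0 := fun _ hz => ⟨B, h, hz⟩
lemma lift_poly {U B : Subring Ω} (q : U[X]) (hB : ∀ z ∈ (q.map U.subtype).coeffs, z ∈ B) :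
    ∃ q' : B[X], q'.map B.subtype = q.map U.subtype := by
  have : q.map U.subtype ∈ lifts B.subtype := by
    rw [lifts_iff_coeff_lifts]
    intro n
    by_cases h : (q.map U.subtype).coeff n = 0
    · exact ⟨0, by rw [h, map_zero]⟩
    · exact ⟨⟨_, hB _ (coeff_mem_coeffs h)⟩, rfl⟩
  obtain ⟨q', h⟩ := (mem_lifts _).mp this
  exact ⟨q', h⟩
lemma monic_of_map {U B : Subring Ω} {q : U[X]} {q' : B[X]} (h : q'.map B.subtype = q.map U.subtype) (hq : q.Monic) : q'.Monic := by
  apply monic_of_injective (f := B.subtype) Subtype.val_injective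
  rw [h]; exact hq.map _
lemma UU_nrm {B0 : Subring Ω} (h0 : Nrm B0) : Nrm (UU B0 h0) := by
  classical
  intro a ha b hb hab
  obtain ⟨μ, h1, h2⟩ := hab
  obtain ⟨B, hB, h⟩ := UU_finite ({a, b} ∪ (μ.map (UU B0 h0).subtype).coeffs) (h0 := h0) (by
    intro z hz
    rcases Finset.mem_union.mp hz with hz | hz
    · rcases Finset.mem_insert.mp hz with rfl | hz
      · exact ha
      · rw [Finset.mem_singleton.mp hz]; exact hb
    · obtain ⟨n, -, rfl⟩ := mem_coeffs_iff.mp hz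
      rw [coeff_map]; exact Subtype.prop _)
  obtain ⟨μ', hμ'⟩ := lift_poly (B := B) μ (fun z hz => h z (Finset.mem_union_right _ hz))
  refine le_UU hB (hB.nrm h0 a (h a (by simp)) b (h b (by simp)) ⟨μ', monic_of_map hμ' h1, ?_⟩)
  have e1 : eval₂ (algebraMap B Ω) (a / b) μ' = eval (a / b) (μ'.map B.subtype) := by rw [eval_map]; rfl
  have e2 : eval₂ (algebraMap (UU B0 h0) Ω) (a / b) μ = eval (a / b) (μ.map (UU B0 h0).subtype) := by rw [eval_map]; rfl
  rw [e1, hμ', ← e2, h2]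
lemma UU_root {B0 : Subring Ω} (h0 : Nrm B0) (μ : (UU B0 h0)[X]) (h1 : μ.Monic) (h2 : μ.Separable) (θ : Ω) (h3 : aeval θ μ = 0) :
    θ ∈ UU B0 h0 := by
  classical
  obtain ⟨a, b, hab⟩ := h2
  have hmem : ∀ (q : (UU B0 h0)[X]), ∀ z ∈ (q.map (UU B0 h0).subtype).coeffs, z ∈ UU B0 h0 := by
    intro q z hz
    obtain ⟨n, -, rfl⟩ := mem_coeffs_iff.mp hz
    rw [coeff_map]; exact Subtype.prop _
  obtain ⟨B, hB, h⟩ := UU_finite ((a.map (UU B0 h0).subtype).coeffs ∪ (b.map (UU B0 h0).subtype).coeffs ∪ (μ.map (UU B0 h0).subtype).coeffs) (h0 := h0) (by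
    intro z hz
    rcases Finset.mem_union.mp hz with hz | hz
    · rcases Finset.mem_union.mp hz with hz | hz
      · exact hmem a z hz
      · exact hmem b z hz
    · exact hmem μ z hz)
  obtain ⟨μ', hμ'⟩ := lift_poly (B := B) μ (fun z hz => h z (Finset.mem_union_right _ hz))
  obtain ⟨a', ha'⟩ := lift_poly (B := B) a (fun z hz => h z (Finset.mem_union_left _ (Finset.mem_union_left _ hz)))
  obtain ⟨b', hb'⟩ := lift_poly (B := B) b (fun z hz => h z (Finset.mem_union_left _ (Finset.mem_union_right _ hz)))
  have hs : μ'.Separable := ⟨a', b', by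
    apply map_injective B.subtype Subtype.val_injective
    rw [Polynomial.map_add, Polynomial.map_mul, Polynomial.map_mul, ← derivative_map, ha', hb', hμ', derivative_map, ← Polynomial.map_mul,
      ← Polynomial.map_mul, ← Polynomial.map_add, hab, Polynomial.map_one, Polynomial.map_one]⟩
  have := step_exists (hB.nrm h0) θ μ' (monic_of_map hμ' h1) hs (by rw [aeval_sub, hμ', ← aeval_sub, h3])
  exact le_UU (hB.step this) (mem_adj.mpr ⟨X, aeval_X _⟩)
end
end ACM
/-! ## Etaleness -/
namespace ACM
open Polynomial
section
variable {Ω : Type*} [Field Ω]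
lemma step_etale {B B' : Subring Ω} (h : Step B B') :
    (Subring.inclusion h.le).Etale ∧ (Subring.inclusion h.le).Finite := by
  have hle := h.le
  obtain ⟨μ, θ, m1, m2, m3, m4, m5⟩ := h
  letI : Algebra B B' := (Subring.inclusion hle).toAlgebra
  haveI : IsScalarTower B B' Ω := IsScalarTower.of_algebraMap_eq (fun _ => rfl)
  let t : B' := ⟨θ, (m5 θ).mpr ⟨X, aeval_X _⟩⟩
  have ht : ∀ q : B[X], ((aeval t q : B') : Ω) = aeval θ q := fun q =>
    (Polynomial.aeval_algebraMap_apply Ω t q).symm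
  obtain ⟨a, b, hab⟩ := m2
  let P : StandardEtalePair B := ⟨μ, m1, 1, b, a, 1, by rw [one_pow, ← hab]; ring⟩
  have hm : P.HasMap t := ⟨Subtype.ext (by rw [ht]; exact m3), by rw [show P.g = 1 from rfl, map_one]; exact isUnit_one⟩
  have hs : Function.Surjective (aeval (R := B) t) := by
    intro z
    obtain ⟨q, hq⟩ := (m5 z).mp z.2
    exact ⟨q, Subtype.ext (by rw [ht, hq])⟩
  have key : ∀ q : B[X], P.lift t hm (aeval P.X q) = aeval t q := by
    intro q
    rw [← Polynomial.aeval_algHom_apply, StandardEtalePair.lift_X]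
  constructor
  · have : Algebra.IsStandardEtale B B' := by
      refine ⟨⟨P, t, hm, ?_, ?_⟩⟩
      · rw [injective_iff_map_eq_zero]
        intro z hz
        let PP : StandardEtalePresentation B P.Ring := ⟨P, P.X, P.hasMap_X, by simpa [StandardEtalePair.lift_X_left] using Function.bijective_id⟩
        obtain ⟨q, n, hq⟩ := PP.exists_mul_aeval_x_g_pow_eq_aeval_x z
        rw [show PP.g = 1 from rfl, map_one, one_pow, mul_one] at hq
        change z = aeval P.X q at hq
        rw [hq, key] at hz
        obtain ⟨r, rfl⟩ := m4 q (by rw [← ht, hz]; rfl)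
        rw [hq, map_mul, show aeval P.X μ = 0 from P.hasMap_X.1, zero_mul]
      · intro z
        obtain ⟨q, hq⟩ := hs z
        exact ⟨aeval P.X q, by rw [key, hq]⟩
    exact RingHom.etale_algebraMap.mpr inferInstance
  · change Module.Finite B B'
    have hfin : Module.Finite B (AdjoinRoot μ) := m1.finite_adjoinRoot
    have h0' : aeval t μ = 0 := Subtype.ext (by rw [ht]; exact m3)
    have h0 : eval₂ (↑(Algebra.ofId B B') : B →+* B') t μ = 0 := h0'
    refine Module.Finite.of_surjective (AdjoinRoot.liftAlgHom μ (Algebra.ofId B B') t h0).toLinearMap ?_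
    intro z
    obtain ⟨q, hq⟩ := hs z
    refine ⟨AdjoinRoot.mk μ q, ?_⟩
    rw [AlgHom.toLinearMap_apply, AdjoinRoot.liftAlgHom_mk, ← hq]; rfl
lemma tow_etale {B B' : Subring Ω} (h : Tow B B') :
    (Subring.inclusion h.le).Etale ∧ (Subring.inclusion h.le).Finite := by
  induction h with
  | base =>
    have : Function.Bijective (Subring.inclusion (le_refl B)) := ⟨fun x y h => h, fun x => ⟨x, rfl⟩⟩
    exact ⟨RingHom.Etale.of_bijective this, RingHom.Finite.of_surjective _ this.2⟩
  | step h1 h2 ih =>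
    have e : Subring.inclusion (Tow.step h1 h2).le = (Subring.inclusion h2.le).comp (Subring.inclusion h1.le) := rfl
    rw [e]
    exact ⟨RingHom.Etale.stableUnderComposition _ _ ih.1 (step_etale h2).1, (step_etale h2).2.comp ih.2⟩
def locS (S : Subring Ω) (c : Ω) (hc : c ∈ S) : Subring Ω where
  carrier := {z | ∃ n : ℕ, z * c ^ n ∈ S}
  zero_mem' := ⟨0, by simp⟩
  one_mem' := ⟨0, by simp⟩
  add_mem' := by
    rintro a b ⟨n, hn⟩ ⟨m, hm⟩
    refine ⟨n + m, ?_⟩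
    have : (a + b) * c ^ (n + m) = a * c ^ n * c ^ m + b * c ^ m * c ^ n := by ring
    rw [this]
    exact S.add_mem (S.mul_mem hn (S.pow_mem hc _)) (S.mul_mem hm (S.pow_mem hc _))
  mul_mem' := by
    rintro a b ⟨n, hn⟩ ⟨m, hm⟩
    refine ⟨n + m, ?_⟩
    have : (a * b) * c ^ (n + m) = a * c ^ n * (b * c ^ m) := by ring
    rw [this]
    exact S.mul_mem hn hm
  neg_mem' := by
    rintro a ⟨n, hn⟩
    exact ⟨n, by rw [neg_mul]; exact S.neg_mem hn⟩
lemma mem_locS {S : Subring Ω} {c : Ω} {hc : c ∈ S} {z : Ω} : z ∈ locS S c hc ↔ ∃ n : ℕ, z * c ^ n ∈ S := Iff.rfl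
lemma le_locS {S : Subring Ω} {c : Ω} (hc : c ∈ S) : S ≤ locS S c hc := fun z hz => ⟨0, by simpa using hz⟩
lemma inv_mem_locS {S : Subring Ω} {c : Ω} (hc : c ∈ S) : c⁻¹ ∈ locS S c hc := by
  by_cases h : c = 0
  · have : c⁻¹ = 0 := by rw [h, inv_zero]
    rw [this]; exact Subring.zero_mem _
  · exact ⟨1, by rw [pow_one, inv_mul_cancel₀ h]; exact S.one_mem⟩
lemma etale_comp {A B C : Type*} [CommRing A] [CommRing B] [CommRing C] {f : A →+* B} {g : B →+* C} (hf : f.Etale) (hg : g.Etale) :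
    (g.comp f).Etale := by
  algebraize [f, g, g.comp f]
  exact Algebra.Etale.comp A B C
lemma etale_bij {A B : Type*} [CommRing A] [CommRing B] {f : A →+* B} (hf : Function.Bijective f) : f.Etale := by
  letI := f.toAlgebra
  exact Algebra.Etale.of_equiv (A := A) (AlgEquiv.ofBijective (Algebra.ofId A B) hf)
lemma etale_clause.{u, v, w} {R : Type u} [CommRing R] {Ω : Type w} [Field Ω] [Algebra R Ω] (T : Subalgebra R Ω) (c : R)
    (hinj : Function.Injective (algebraMap R Ω)) (hc : c ≠ 0) (Rg : Subring Ω) (h0 : Nrm Rg)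
    (hRg : ∀ z, z ∈ Rg ↔ ∃ (n : ℕ) (a : R), z * algebraMap R Ω c ^ n = algebraMap R Ω a)
    (hU : ∀ z, z ∈ UU Rg h0 ↔ ∃ n : ℕ, z * algebraMap R Ω c ^ n ∈ T)
    (Rpg : Type v) (Tpg : Type v) [CommRing Rpg] [CommRing Tpg]
            [Algebra R Rpg] [IsLocalization.Away c Rpg]
            [Algebra ↥T Tpg]
            [IsLocalization.Away (algebraMap R T c) Tpg]
            [Algebra Rpg Tpg] [Algebra R Tpg]
            [IsScalarTower R Rpg Tpg] [IsScalarTower R ↥T Tpg] :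
          ∃ (ι : Type v) (F : ι → Subalgebra Rpg Tpg),
            Nonempty ι ∧
            (∀ i j : ι, ∃ k : ι, F i ≤ F k ∧ F j ≤ F k) ∧
            (∀ i : ι, Module.Finite Rpg ↥(F i) ∧ Algebra.Etale Rpg ↥(F i)) ∧
            (∀ y : Tpg, ∃ i : ι, y ∈ F i) := by
  have hc0 : algebraMap R Ω c ≠ 0 := fun h => hc (hinj (by rw [h, map_zero]))
  have hcu : IsUnit (T.val.toRingHom (algebraMap R T c)) := by
    rw [isUnit_iff_ne_zero]; exact hc0
  let lam : Tpg →+* Ω := IsLocalization.Away.lift (algebraMap R T c) hcu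
  have hlam : ∀ t : T, lam (algebraMap T Tpg t) = t := fun t => IsLocalization.Away.lift_eq _ hcu t
  have hlamR : ∀ r : R, lam (algebraMap Rpg Tpg (algebraMap R Rpg r)) = algebraMap R Ω r := by
    intro r
    rw [← IsScalarTower.algebraMap_apply R Rpg Tpg, IsScalarTower.algebraMap_apply R T Tpg, hlam]; rfl
  have hsurjT : ∀ y : Tpg, ∃ (n : ℕ) (t : T), y * algebraMap T Tpg (algebraMap R T c) ^ n = algebraMap T Tpg t := by
    intro y
    obtain ⟨n, t, h⟩ := IsLocalization.Away.surj (algebraMap R T c) y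
    exact ⟨n, t, h⟩
  have hsurjR : ∀ y : Rpg, ∃ (n : ℕ) (t : R), y * algebraMap R Rpg c ^ n = algebraMap R Rpg t := by
    intro y
    obtain ⟨n, t, h⟩ := IsLocalization.Away.surj c y
    exact ⟨n, t, h⟩
  have hcT : lam (algebraMap T Tpg (algebraMap R T c)) = algebraMap R Ω c := hlam _
  have hlinj : Function.Injective lam := by
    rw [injective_iff_map_eq_zero]
    intro y hy
    obtain ⟨n, t, h⟩ := hsurjT y
    have h1 := congrArg lam h
    rw [map_mul, hy, zero_mul, hlam] at h1
    have : t = 0 := Subtype.ext h1.symm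
    rw [this, map_zero] at h
    exact (((IsLocalization.Away.algebraMap_isUnit (S := Tpg) (algebraMap R T c)).pow n).mul_left_eq_zero).mp h
  have hlR : ∀ y : Rpg, lam (algebraMap Rpg Tpg y) ∈ Rg := by
    intro y
    obtain ⟨n, t, h⟩ := hsurjR y
    rw [hRg]
    refine ⟨n, t, ?_⟩
    have h1 := congrArg (fun z => lam (algebraMap Rpg Tpg z)) h
    simp only [map_mul, map_pow, hlamR] at h1
    exact h1
  let i1 : Rpg →+* Rg := (lam.comp (algebraMap Rpg Tpg)).codRestrict Rg hlR
  have hi1 : Function.Bijective i1 := by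
    constructor
    · rw [injective_iff_map_eq_zero]
      intro y hy
      have hy' : lam (algebraMap Rpg Tpg y) = 0 := congrArg Subtype.val hy
      obtain ⟨n, t, h⟩ := hsurjR y
      have h1 := congrArg (fun z => lam (algebraMap Rpg Tpg z)) h
      simp only [map_mul, map_pow, hlamR, hy', zero_mul] at h1
      have : t = 0 := hinj (by rw [← h1, map_zero])
      rw [this, map_zero] at h
      exact (((IsLocalization.Away.algebraMap_isUnit (S := Rpg) c).pow n).mul_left_eq_zero).mp h
    · intro z
      obtain ⟨n, a, h⟩ := (hRg z).mp z.2
      obtain ⟨u, hu⟩ := (IsLocalization.Away.algebraMap_isUnit (S := Rpg) c).pow n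
      refine ⟨algebraMap R Rpg a * ↑u⁻¹, Subtype.ext ?_⟩
      change lam (algebraMap Rpg Tpg _) = z
      apply mul_right_cancel₀ (pow_ne_zero n hc0)
      rw [h, ← hlamR, ← hlamR, ← map_pow, ← map_mul, ← map_pow, ← map_mul, mul_assoc, ← hu, Units.inv_mul, mul_one]
  let G : ∀ B, Tow Rg B → Subalgebra Rpg Tpg := fun B hB =>
    { (B.comap lam) with
      algebraMap_mem' := fun y => hB.le (hlR y) }
  have hG : ∀ B (hB : Tow Rg B) y, y ∈ G B hB ↔ lam y ∈ B := fun B hB y => Iff.rfl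
  refine ⟨{F : Subalgebra Rpg Tpg // ∃ B hB, F = G B hB}, fun F => F.1, ⟨⟨_, Rg, Tow.base, rfl⟩⟩, ?_, ?_, ?_⟩
  · rintro ⟨_, B, hB, rfl⟩ ⟨_, B', hB', rfl⟩
    obtain ⟨C, h1, h2⟩ := hB.directed h0 hB'
    exact ⟨⟨_, C, hB.trans h1, rfl⟩, fun y hy => h1.le hy, fun y hy => h2 hy⟩
  · rintro ⟨_, B, hB, rfl⟩
    let i2 : G B hB →+* B := (lam.comp (G B hB).val.toRingHom).codRestrict B (fun y => (hG B hB _).mp y.2)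
    have hi2 : Function.Bijective i2 := by
      constructor
      · intro x y h
        exact Subtype.ext (hlinj (congrArg Subtype.val h))
      · intro z
        have : (z : Ω) ∈ UU Rg h0 := le_UU hB z.2
        obtain ⟨n, hn⟩ := (hU z).mp this
        obtain ⟨u, hu⟩ := (IsLocalization.Away.algebraMap_isUnit (S := Tpg) (algebraMap R T c)).pow n
        obtain ⟨t, ht⟩ : ∃ t : T, (t : Ω) = z * algebraMap R Ω c ^ n := ⟨⟨_, hn⟩, rfl⟩
        have hy : lam (algebraMap T Tpg t * ↑u⁻¹) = z := by
          apply mul_right_cancel₀ (pow_ne_zero n hc0)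
          rw [← hcT, ← map_pow, ← map_mul, mul_assoc, ← hu, Units.inv_mul, mul_one, hlam, ht, hu, map_pow, hcT]
        exact ⟨⟨algebraMap T Tpg t * (↑u⁻¹ : Tpg), (hG B hB _).mpr (by rw [hy]; exact z.2)⟩, Subtype.ext hy⟩
    let e2 := RingEquiv.ofBijective i2 hi2
    have he : algebraMap Rpg (G B hB) = (e2.symm : B →+* G B hB).comp ((Subring.inclusion hB.le).comp i1) := by
      refine RingHom.ext fun y => e2.injective ?_
      change _ = e2 (e2.symm _)
      rw [RingEquiv.apply_symm_apply]
      rfl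
    have h3 := tow_etale hB
    constructor
    · have : (algebraMap Rpg (G B hB)).Finite := by
        rw [he]
        exact (RingHom.Finite.of_surjective _ e2.symm.surjective).comp (h3.2.comp (RingHom.Finite.of_surjective _ hi1.2))
      exact RingHom.finite_algebraMap.mp this
    · rw [← RingHom.etale_algebraMap, he]
      exact etale_comp (etale_comp (etale_bij hi1) h3.1) (etale_bij e2.symm.bijective)
  · intro y
    have : lam y ∈ UU Rg h0 := by
      rw [hU]
      obtain ⟨n, t, h⟩ := hsurjT y
      refine ⟨n, ?_⟩
      have h1 := congrArg lam h
      rw [map_mul, map_pow, hcT, hlam] at h1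
      rw [h1]; exact t.2
    obtain ⟨B, hB, h⟩ := this
    exact ⟨⟨_, B, hB, rfl⟩, (hG B hB y).mpr h⟩
end
end ACM
/-! ## The algebra `T` -/
namespace ACM
open Polynomial
section
lemma goldman {D : Type*} [CommRing D] [IsDomain D] [IsNoetherianRing D] [IsLocalRing D] (c : D)
    (h : ∀ P : Ideal D, P.IsPrime → P ≠ ⊥ → c ∈ P) (hc0 : c ≠ 0) (hc : c ∈ IsLocalRing.maximalIdeal D) :
    IsLocalRing.maximalIdeal D ≤ (Ideal.span {c}).radical := by
  have hfin := (Ideal.span {c}).finite_minimalPrimes_of_isNoetherianRing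
  by_cases hm : ∃ Q ∈ (Ideal.span {c}).minimalPrimes, IsLocalRing.maximalIdeal D ≤ Q
  · obtain ⟨Q, hQ, hmQ⟩ := hm
    rw [← Ideal.sInf_minimalPrimes]
    refine le_sInf fun Q' hQ' => ?_
    have h1 : Q' ≤ Q := (IsLocalRing.le_maximalIdeal hQ'.1.1.ne_top).trans hmQ
    exact hmQ.trans (hQ.2 hQ'.1 h1)
  · exfalso
    push Not at hm
    have h2 : ¬ ((IsLocalRing.maximalIdeal D : Set D) ⊆ ⋃ i ∈ (hfin.toFinset : Set (Ideal D)), ((id i : Ideal D) : Set D)) := by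
      rw [Ideal.subset_union_prime (f := id) ⊥ ⊥ (fun i hi _ _ => (hfin.mem_toFinset.mp hi).1.1)]
      rintro ⟨i, hi, hmi⟩
      exact hm i (hfin.mem_toFinset.mp hi) hmi
    rw [Set.not_subset] at h2
    obtain ⟨y, hy, hyn⟩ := h2
    have hyn' : ∀ Q ∈ (Ideal.span {c}).minimalPrimes, y ∉ Q := by
      intro Q hQ hyQ
      exact hyn (Set.mem_biUnion (by rw [Set.Finite.coe_toFinset]; exact hQ) hyQ)
    have hyt : Ideal.span {y} ≤ IsLocalRing.maximalIdeal D := (Ideal.span_singleton_le_iff_mem _).mpr hy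
    obtain ⟨P, hP, -⟩ := Ideal.exists_minimalPrimes_le hyt
    haveI := hP.1.1
    have hyP : y ∈ P := hP.1.2 (Ideal.mem_span_singleton_self y)
    have hcP : c ∈ P := by
      refine h P hP.1.1 ?_
      rintro rfl
      obtain ⟨Q, hQ, -⟩ := Ideal.exists_minimalPrimes_le ((Ideal.span_singleton_le_iff_mem _).mpr hc)
      rw [Ideal.mem_bot.mp hyP] at hyn'
      exact hyn' Q hQ Q.zero_mem
    obtain ⟨Q, hQ, hQP⟩ := Ideal.exists_minimalPrimes_le ((Ideal.span_singleton_le_iff_mem _).mpr hcP)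
    haveI := hQ.1.1
    have hlt : Q < P := lt_of_le_of_ne hQP (by rintro rfl; exact hyn' _ hQ hyP)
    have h3 := (Ideal.height_strict_mono_of_isPrime_of_isPrime hlt).trans_le (Ideal.height_le_one_of_isPrincipal_of_mem_minimalPrimes _ P hP)
    rw [Order.lt_one_iff, Ideal.height_eq_zero_iff, IsDomain.minimalPrimes_eq_singleton_bot] at h3
    have h4 := hQ.1.2 (Ideal.mem_span_singleton_self c)
    rw [Set.mem_singleton_iff.mp h3] at h4
    exact hc0 h4
variable {R Ω : Type*} [CommRing R] [IsDomain R] [Field Ω] [Algebra R Ω]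
structure TData (R Ω : Type*) [CommRing R] [Field Ω] [Algebra R Ω] where
  c : R
  hc : c ≠ 0
  inj : Function.Injective (algebraMap R Ω)
  Rg : Subring Ω
  h0 : Nrm Rg
  hRg : ∀ z, z ∈ Rg ↔ ∃ (n : ℕ) (a : R), z * algebraMap R Ω c ^ n = algebraMap R Ω a
namespace TData
variable (D : TData R Ω)
def T : Subalgebra R Ω where
  carrier := {z | z ∈ UU D.Rg D.h0 ∧ IsIntegral R z}
  mul_mem' := fun ha hb => ⟨Subring.mul_mem _ ha.1 hb.1, ha.2.mul hb.2⟩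
  add_mem' := fun ha hb => ⟨Subring.add_mem _ ha.1 hb.1, ha.2.add hb.2⟩
  algebraMap_mem' := fun r => ⟨le_UU Tow.base ((D.hRg _).mpr ⟨0, r, by simp⟩), isIntegral_algebraMap⟩
lemma mem_T {z : Ω} : z ∈ D.T ↔ z ∈ UU D.Rg D.h0 ∧ IsIntegral R z := Iff.rfl
lemma c0 : algebraMap R Ω D.c ≠ 0 := fun h => D.hc (D.inj (by rw [h, map_zero]))
lemma cinv : (algebraMap R Ω D.c)⁻¹ ∈ UU D.Rg D.h0 :=
  le_UU Tow.base ((D.hRg _).mpr ⟨1, 1, by rw [pow_one, inv_mul_cancel₀ D.c0, map_one]⟩)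
lemma U_iff (z : Ω) : z ∈ UU D.Rg D.h0 ↔ ∃ n : ℕ, z * algebraMap R Ω D.c ^ n ∈ D.T := by
  constructor
  · rintro ⟨B, hB, hz⟩
    have hfin := (tow_etale hB).2
    letI : Algebra D.Rg B := (Subring.inclusion hB.le).toAlgebra
    haveI : Module.Finite D.Rg B := hfin
    haveI : IsScalarTower D.Rg B Ω := IsScalarTower.of_algebraMap_eq (fun _ => rfl)
    have h1 : IsIntegral D.Rg z := (Algebra.IsIntegral.isIntegral (R := D.Rg) (⟨z, hz⟩ : B)).algebraMap (B := Ω)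
    letI : Algebra R D.Rg := ((algebraMap R Ω).codRestrict D.Rg (fun r => (D.hRg _).mpr ⟨0, r, by simp⟩)).toAlgebra
    haveI : IsScalarTower R D.Rg Ω := IsScalarTower.of_algebraMap_eq (fun _ => rfl)
    have hcu : IsUnit (algebraMap R D.Rg D.c) := by
      refine IsUnit.of_mul_eq_one ⟨_, (D.hRg (algebraMap R Ω D.c)⁻¹).mpr ⟨1, 1, by rw [pow_one, inv_mul_cancel₀ D.c0, map_one]⟩⟩ (Subtype.ext ?_)
      exact mul_inv_cancel₀ D.c0
    haveI : IsLocalization.Away D.c D.Rg := by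
      refine ⟨⟨?_, ?_, ?_⟩⟩
      · rintro ⟨_, n, rfl⟩
        exact (map_pow (algebraMap R D.Rg) D.c n).symm ▸ hcu.pow n
      · intro z
        obtain ⟨n, a, h⟩ := (D.hRg z).mp z.2
        refine ⟨(a, ⟨_, n, rfl⟩), Subtype.ext ?_⟩
        change (z : Ω) * algebraMap R Ω (D.c ^ n) = _
        rw [map_pow, h]; rfl
      · intro x y h
        exact ⟨1, by rw [D.inj (congrArg Subtype.val h : algebraMap R Ω x = algebraMap R Ω y)]⟩
    obtain ⟨⟨m, n, rfl⟩, hm⟩ := IsIntegral.exists_multiple_integral_of_isLocalization (Submonoid.powers D.c) z h1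
    refine ⟨n, Subring.mul_mem _ ⟨B, hB, hz⟩ (Subring.pow_mem _ (le_UU Tow.base ((D.hRg _).mpr ⟨0, D.c, by simp⟩)) _), ?_⟩
    rw [mul_comm, ← map_pow, ← Algebra.smul_def]
    exact hm
  · rintro ⟨n, hn⟩
    have : z = z * algebraMap R Ω D.c ^ n * (algebraMap R Ω D.c)⁻¹ ^ n := by
      rw [mul_assoc, ← mul_pow, mul_inv_cancel₀ D.c0, one_pow, mul_one]
    rw [this]
    exact Subring.mul_mem _ hn.1 (Subring.pow_mem _ D.cinv _)
lemma T_le : D.T ≤ integralClosure R Ω := fun _ hz => hz.2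
instance : Algebra.IsIntegral R D.T := ⟨fun z => (isIntegral_algebraMap_iff (A := D.T) (B := Ω) Subtype.val_injective).mp z.2.2⟩
lemma int_T {z : Ω} (h : IsIntegral D.T z) (hz : z ∈ UU D.Rg D.h0) : z ∈ D.T := ⟨hz, isIntegral_trans z h⟩
lemma T_nrm : Nrm D.T.toSubring := by
  intro a ha b hb hab
  have h1 : IsIntegral D.T (a / b) := hab
  refine D.int_T h1 (UU_nrm D.h0 a ha.1 b hb.1 ?_)
  obtain ⟨μ, m1, m2⟩ := h1
  let i : D.T →+* UU D.Rg D.h0 := D.T.val.toRingHom.codRestrict _ (fun z => z.2.1)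
  exact ⟨μ.map i, m1.map _, by rw [eval₂_map]; exact m2⟩
instance : IsIntegrallyClosed D.T := (nrm_iff D.T.toSubring).mpr D.T_nrm
lemma T_root {a b : D.T} {n : ℕ} (hn : 0 < n) (h : a ^ n ∣ b ^ n) : a ∣ b := by
  obtain ⟨e, he⟩ := h
  by_cases ha : (a : Ω) = 0
  · have : a = 0 := Subtype.ext ha
    rw [this, zero_pow hn.ne', zero_mul] at he
    rw [pow_eq_zero_iff hn.ne'] at he
    rw [he]; exact dvd_zero a
  · have h2 : (b / a : Ω) ∈ D.T := by
      refine D.T_nrm b b.2 a a.2 ⟨X ^ n - C e, monic_X_pow_sub_C _ hn.ne', ?_⟩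
      rw [eval₂_sub, eval₂_X_pow, eval₂_C, div_pow]
      have := congrArg (fun z : D.T => (z : Ω)) he
      simp only [SubmonoidClass.coe_pow, MulMemClass.coe_mul] at this
      rw [this, mul_div_cancel_left₀ _ (pow_ne_zero n ha)]
      exact sub_self _
    exact ⟨⟨_, h2⟩, Subtype.ext (mul_div_cancel₀ _ ha).symm⟩
variable (p : ℕ) [hp : Fact p.Prime]
lemma U_root (hpU : (p : Ω)⁻¹ ∈ UU D.Rg D.h0) (hp0 : (p : Ω) ≠ 0) {a b : Ω} (ha : a ∈ UU D.Rg D.h0) (ha0 : a ≠ 0)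
    (hai : a⁻¹ ∈ UU D.Rg D.h0) (hb : b ^ p = a) : b ∈ UU D.Rg D.h0 ∧ b ≠ 0 ∧ b⁻¹ ∈ UU D.Rg D.h0 := by
  have hb0 : b ≠ 0 := by
    rintro rfl
    rw [zero_pow hp.out.ne_zero] at hb
    exact ha0 hb.symm
  have h1 : b ∈ UU D.Rg D.h0 := by
    refine UU_root D.h0 (X ^ p - C ⟨a, ha⟩) (monic_X_pow_sub_C _ hp.out.ne_zero) ?_ b ?_
    · refine ⟨-C ⟨_, hai⟩, X * C ⟨_, hpU⟩ * C ⟨_, hai⟩, ?_⟩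
      have e1 : C (⟨a, ha⟩ : UU D.Rg D.h0) * C ⟨_, hai⟩ = 1 := by
        rw [← C_mul, ← C_1]; exact congrArg C (Subtype.ext (mul_inv_cancel₀ ha0))
      have e2 : (p : (UU D.Rg D.h0)[X]) * C ⟨_, hpU⟩ = 1 := by
        rw [← C_eq_natCast, ← C_mul, ← C_1]; exact congrArg C (Subtype.ext (by
          rw [MulMemClass.coe_mul, SubringClass.coe_natCast]; exact mul_inv_cancel₀ hp0))
      rw [derivative_sub, derivative_C, derivative_X_pow, sub_zero, C_eq_natCast]
      have e3 : (X : (UU D.Rg D.h0)[X]) ^ p = X ^ (p - 1) * X := by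
        rw [← pow_succ, Nat.sub_add_cancel hp.out.one_le]
      rw [e3]
      linear_combination e1 + (X ^ (p - 1) * X * C (⟨_, hai⟩ : UU D.Rg D.h0)) * e2
    · rw [map_sub, aeval_X_pow, aeval_C, hb]; exact sub_self _
  refine ⟨h1, hb0, ?_⟩
  have : b⁻¹ = b ^ (p - 1) * a⁻¹ := by
    rw [← hb, eq_mul_inv_iff_mul_eq₀ (pow_ne_zero _ hb0), ← Nat.sub_add_cancel hp.out.one_le, pow_succ', inv_mul_cancel_left₀ hb0,
      Nat.add_sub_cancel]
  rw [this]
  exact Subring.mul_mem _ (Subring.pow_mem _ h1 _) hai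
lemma roots [IsAlgClosed Ω] (hpU : (p : Ω)⁻¹ ∈ UU D.Rg D.h0) (hp0 : (p : Ω) ≠ 0) (a : D.T) (ha0 : (a : Ω) ≠ 0)
    (hai : (a : Ω)⁻¹ ∈ UU D.Rg D.h0) : ∃ r : ℕ → D.T, r 0 = a ∧ ∀ n, r (n + 1) ^ p = r n := by
  let Q := {a : D.T // (a : Ω) ≠ 0 ∧ (a : Ω)⁻¹ ∈ UU D.Rg D.h0}
  have hQ : ∀ q : Q, ∃ q' : Q, q'.1 ^ p = q.1 := by
    rintro ⟨a, h1, h2⟩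
    obtain ⟨b, hb⟩ := IsAlgClosed.exists_pow_nat_eq (a : Ω) hp.out.pos
    obtain ⟨h3, h4, h5⟩ := D.U_root p hpU hp0 a.2.1 h1 h2 hb
    have hbT : b ∈ D.T := ⟨h3, IsIntegral.of_pow hp.out.pos (by rw [hb]; exact a.2.2)⟩
    exact ⟨⟨⟨b, hbT⟩, h4, h5⟩, Subtype.ext hb⟩
  choose s hs using hQ
  let r : ℕ → Q := fun n => Nat.rec ⟨a, ha0, hai⟩ (fun _ q => s q) n
  exact ⟨fun n => (r n).1, rfl, fun n => hs (r n)⟩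
lemma frob_surj [IsAlgClosed Ω] [IsLocalRing R] (hpm : (p : R) ∈ IsLocalRing.maximalIdeal R) (hpU : (p : Ω)⁻¹ ∈ UU D.Rg D.h0) (hp0 : (p : Ω) ≠ 0)
    (a : D.T) : ∃ b e : D.T, a - b ^ p = p * e := by
  let μ : D.T[X] := X ^ p ^ 2 - (C (p : D.T) * X + C a)
  have hp2 : 1 < p ^ 2 := Nat.one_lt_pow (by norm_num) hp.out.one_lt
  have hμ : μ.Monic := by
    apply monic_X_pow_sub
    refine lt_of_le_of_lt (degree_linear_le) ?_
    exact_mod_cast hp2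
  have hu : ∃ q r : D.T[X], q * (1 - C (p : D.T) * X ^ (p ^ 2 - 1)) + r * μ = 1 := by
    have : IsUnit (AdjoinRoot.mk μ (1 - C (p : D.T) * X ^ (p ^ 2 - 1))) := by
      by_contra hn
      obtain ⟨M, hM, hmem⟩ := exists_max_ideal_of_mem_nonunits hn
      haveI : Module.Finite D.T (AdjoinRoot μ) := hμ.finite_adjoinRoot
      haveI : Algebra.IsIntegral R (AdjoinRoot μ) := Algebra.IsIntegral.trans D.T
      have := Ideal.isMaximal_comap_of_isIntegral_of_isMaximal (R := R) M
      rw [IsLocalRing.eq_maximalIdeal this |>.symm, Ideal.mem_comap, map_natCast] at hpm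
      apply hM.ne_top
      rw [Ideal.eq_top_iff_one]
      have e : (1 : AdjoinRoot μ) = AdjoinRoot.mk μ (1 - C (p : D.T) * X ^ (p ^ 2 - 1)) + (p : AdjoinRoot μ) * AdjoinRoot.mk μ (X ^ (p ^ 2 - 1)) := by
        rw [map_sub, map_mul, map_one, C_eq_natCast, map_natCast]; ring
      rw [e]
      exact M.add_mem hmem (M.mul_mem_right _ hpm)
    obtain ⟨v, hv⟩ := this.exists_left_inv
    obtain ⟨q, rfl⟩ := AdjoinRoot.mk_surjective v
    rw [← map_mul, ← map_one (AdjoinRoot.mk μ), AdjoinRoot.mk_eq_mk] at hv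
    obtain ⟨r, hr⟩ := hv
    exact ⟨q, -r, by linear_combination hr⟩
  obtain ⟨q, r, hqr⟩ := hu
  let i : D.T →+* UU D.Rg D.h0 := D.T.val.toRingHom.codRestrict _ (fun z => z.2.1)
  have hsep : (μ.map i).Separable := by
    refine ⟨r.map i, -(q.map i) * C ⟨_, hpU⟩, ?_⟩
    have e2 : (p : (UU D.Rg D.h0)[X]) * C ⟨_, hpU⟩ = 1 := by
      rw [← C_eq_natCast, ← C_mul, ← C_1]; exact congrArg C (Subtype.ext (by
        rw [MulMemClass.coe_mul, SubringClass.coe_natCast]; exact mul_inv_cancel₀ hp0))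
    have e1 := congrArg (Polynomial.map i) hqr
    have e3 : derivative μ = (p : D.T[X]) * (-(1 - C (p : D.T) * X ^ (p ^ 2 - 1))) := by
      simp only [μ, derivative_sub, derivative_X_pow, derivative_add, derivative_C, derivative_C_mul, derivative_X]
      simp only [C_eq_natCast]; push_cast; ring
    rw [derivative_map, e3]
    simp only [Polynomial.map_add, Polynomial.map_mul, Polynomial.map_one, Polynomial.map_neg, Polynomial.map_natCast] at e1 ⊢
    linear_combination e1 + (q.map i * (1 - C (p : D.T) * X ^ (p ^ 2 - 1) : D.T[X]).map i) * e2
  obtain ⟨z, hz⟩ := IsAlgClosed.exists_root (μ.map D.T.val.toRingHom) (by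
    have : (μ.map D.T.val.toRingHom).natDegree = p ^ 2 := by
      rw [hμ.natDegree_map, natDegree_sub_eq_left_of_natDegree_lt, natDegree_X_pow]
      rw [natDegree_X_pow]
      exact lt_of_le_of_lt natDegree_linear_le hp2
    intro h
    rw [natDegree_eq_zero_iff_degree_le_zero.mpr h.le] at this
    omega)
  have hz' : eval₂ (algebraMap D.T Ω) z μ = 0 := by rw [IsRoot, eval_map] at hz; exact hz
  have hzT : z ∈ D.T := by
    refine D.int_T ⟨μ, hμ, hz'⟩ (UU_root D.h0 (μ.map i) (hμ.map _) hsep z ?_)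
    rw [aeval_def, eval₂_map]; exact hz'
  refine ⟨⟨z, hzT⟩ ^ p, -⟨z, hzT⟩, Subtype.ext ?_⟩
  simp only [μ, eval₂_sub, eval₂_add, eval₂_mul, eval₂_C, eval₂_X, eval₂_X_pow] at hz'
  rw [map_natCast (algebraMap D.T Ω)] at hz'
  have ha : algebraMap D.T Ω a = a := rfl
  rw [ha] at hz'
  push_cast
  rw [← pow_mul, ← pow_two]
  linear_combination -hz'
lemma not_mem_mT [IsNoetherianRing R] [IsLocalRing R] (r : ℕ → D.T) (h0 : r 0 = algebraMap R D.T D.c) (h1 : ∀ n, r (n + 1) ^ p = r n)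
    (hcm : D.c ∈ IsLocalRing.maximalIdeal R) :
    ∃ n, r n ∉ Ideal.map (algebraMap R D.T) (IsLocalRing.maximalIdeal R) := by
  by_contra! hall
  have hr : ∀ n, r n ^ p ^ n = algebraMap R D.T D.c := by
    intro n
    induction n with
    | zero => rw [pow_zero, pow_one, h0]
    | succ n ih => rw [pow_succ', pow_mul, h1, ih]
  have hdis : Disjoint ((⊥ : Ideal R) : Set R) (Submonoid.powers D.c : Set R) := by
    rw [Set.disjoint_left]
    rintro z hz ⟨n, rfl⟩
    exact pow_ne_zero n D.hc hz
  obtain ⟨q, hq, hqmax⟩ : ∃ q : Ideal R, Disjoint (q : Set R) (Submonoid.powers D.c : Set R) ∧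
      ∀ I : Ideal R, Disjoint (I : Set R) (Submonoid.powers D.c : Set R) → ¬ q < I :=
    set_has_maximal_iff_noetherian.mpr ‹IsNoetherianRing R›
      {I : Ideal R | Disjoint (I : Set R) (Submonoid.powers D.c : Set R)} ⟨⊥, hdis⟩
  haveI hqp : q.IsPrime := Ideal.isPrime_of_maximally_disjoint q _ hq (fun J hJ hd => hqmax J hd hJ)
  have hcq : D.c ∉ q := fun h => Set.disjoint_left.mp hq h ⟨1, pow_one _⟩
  haveI : IsLocalRing (R ⧸ q) := IsLocalRing.of_surjective' _ (Ideal.Quotient.mk_surjective (I := q))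
  have hmm : IsLocalRing.maximalIdeal (R ⧸ q) = (IsLocalRing.maximalIdeal R).map (Ideal.Quotient.mk q) :=
    (IsLocalRing.map_maximalIdeal_of_surjective _ Ideal.Quotient.mk_surjective).symm
  have hrad := goldman (Ideal.Quotient.mk q D.c) (by
    intro P hP hP0
    by_contra hcP
    apply hP0
    have h1 : ¬ q < P.comap (Ideal.Quotient.mk q) := by
      refine hqmax (P.comap (Ideal.Quotient.mk q)) ?_
      change Disjoint _ _
      rw [Set.disjoint_left]
      rintro z hz ⟨n, rfl⟩
      exact hcP (hP.mem_of_pow_mem n (by simpa using hz))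
    rw [eq_bot_iff]
    intro z hz
    obtain ⟨z, rfl⟩ := Ideal.Quotient.mk_surjective z
    by_contra hzq
    apply h1
    refine lt_of_le_of_ne (fun w hw => ?_) ?_
    · rw [Ideal.mem_comap, Ideal.Quotient.eq_zero_iff_mem.mpr hw]; exact P.zero_mem
    · intro he
      have : z ∈ q := by rw [he]; exact hz
      exact hzq (Ideal.Quotient.eq_zero_iff_mem.mpr this)) (fun h => hcq (Ideal.Quotient.eq_zero_iff_mem.mp h)) (by
    rw [hmm]; exact Ideal.mem_map_of_mem _ hcm)
  obtain ⟨s, hs⟩ := Ideal.exists_pow_le_of_le_radical_of_fg hrad (IsNoetherian.noetherian _)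
  haveI : FaithfulSMul R D.T := (faithfulSMul_iff_algebraMap_injective R D.T).mpr (fun x y h => D.inj (congrArg Subtype.val h))
  obtain ⟨Q, hQ, hQq⟩ := Ideal.exists_ideal_over_prime_of_isIntegral_of_isDomain (S := D.T) q (by
    rw [(RingHom.injective_iff_ker_eq_bot _).mp (FaithfulSMul.algebraMap_injective R D.T)]; exact bot_le)
  let π : R →+* D.T ⧸ Q := (Ideal.Quotient.mk Q).comp (algebraMap R D.T)
  have hπq : ∀ a ∈ q, π a = 0 := by
    intro a ha
    rw [← hQq] at ha
    exact Ideal.Quotient.eq_zero_iff_mem.mpr ha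
  let π' : R ⧸ q →+* D.T ⧸ Q := Ideal.Quotient.lift q π hπq
  -- `m^s` maps into `(c)`
  have hms : (Ideal.map π (IsLocalRing.maximalIdeal R)) ^ s ≤ Ideal.span {π D.c} := by
    have e : Ideal.map π (IsLocalRing.maximalIdeal R) = Ideal.map π' (IsLocalRing.maximalIdeal (R ⧸ q)) := by
      rw [hmm, Ideal.map_map]; rfl
    rw [e, ← Ideal.map_pow]
    refine (Ideal.map_mono hs).trans ?_
    rw [Ideal.map_span, Set.image_singleton]; rfl
  obtain ⟨n, hn⟩ : ∃ n, s * 2 ≤ p ^ n := ⟨s * 2, (Nat.lt_pow_self hp.out.one_lt).le⟩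
  have h5 : π D.c ∈ (Ideal.map π (IsLocalRing.maximalIdeal R)) ^ (s * 2) := by
    have h6 : Ideal.Quotient.mk Q (r n) ∈ Ideal.map π (IsLocalRing.maximalIdeal R) := by
      rw [← Ideal.map_map]; exact Ideal.mem_map_of_mem _ (hall n)
    have h7 : π D.c = (Ideal.Quotient.mk Q (r n)) ^ p ^ n := by rw [← map_pow, hr]; rfl
    rw [h7]
    exact Ideal.pow_le_pow_right hn (Ideal.pow_mem_pow h6 _)
  rw [pow_mul] at h5
  have h8 := Ideal.pow_right_mono hms 2 h5
  rw [Ideal.span_singleton_pow, Ideal.mem_span_singleton] at h8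
  obtain ⟨v, hv⟩ := h8
  have hc1 : π D.c ≠ 0 := by
    intro h
    apply hcq
    rw [← hQq, Ideal.mem_comap]
    exact Ideal.Quotient.eq_zero_iff_mem.mp h
  have hcu : π D.c * v = 1 := by
    apply mul_left_cancel₀ hc1
    rw [mul_one, ← mul_assoc, ← pow_two]; exact hv.symm
  obtain ⟨M, hM, hQM⟩ := Ideal.exists_le_maximal Q hQ.ne_top
  have := Ideal.isMaximal_comap_of_isIntegral_of_isMaximal (R := R) M
  rw [← IsLocalRing.eq_maximalIdeal this, Ideal.mem_comap] at hcm
  apply hM.ne_top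
  obtain ⟨v, rfl⟩ := Ideal.Quotient.mk_surjective v
  rw [Ideal.eq_top_iff_one]
  have h9 : algebraMap R D.T D.c * v - 1 ∈ M := hQM (Ideal.Quotient.eq_zero_iff_mem.mp (by
    rw [map_sub, map_mul, map_one]; exact sub_eq_zero.mpr hcu))
  have := M.sub_mem (M.mul_mem_right v hcm) h9
  rwa [sub_sub_cancel] at this
end TData
end
end ACM
namespace ACM
section
variable {p : ℕ} [hp : Fact p.Prime]
variable {P : Type*} [CommRing P] [CharP P p] [PerfectRing P p]
lemma charP_of_hom {S : Type*} [CommRing S] [Nontrivial S] (φ : P →+* S) : CharP S p :=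
  (CharP.charP_iff_prime_eq_zero hp.out).mpr (by rw [← map_natCast φ, CharP.cast_eq_zero, map_zero])
lemma perfect_of {S : Type*} [CommRing S] [CharP S p] (h1 : ∀ z : S, z ^ p = 0 → z = 0) (h2 : ∀ z : S, ∃ w, w ^ p = z) :
    PerfectRing S p where
  bijective_frobenius := by
    constructor
    · exact (injective_iff_map_eq_zero (frobenius S p)).mpr h1
    · exact h2
lemma loc_perfect {Lp : Type*} [CommRing Lp] [Algebra P Lp] (c : P) [IsLocalization.Away c Lp] [CharP Lp p] : PerfectRing Lp p := by
  have hu : IsUnit (algebraMap P Lp c) := IsLocalization.Away.algebraMap_isUnit c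
  apply perfect_of
  · intro z hz
    obtain ⟨n, a, h⟩ := IsLocalization.Away.surj c z
    have h1 : algebraMap P Lp (a ^ p) = 0 := by rw [map_pow, ← h, mul_pow, hz, zero_mul]
    obtain ⟨⟨_, m, rfl⟩, hm⟩ := (IsLocalization.map_eq_zero_iff (Submonoid.powers c) Lp _).mp h1
    simp only at hm
    have h2 : (c ^ m * a) ^ p ^ 1 = 0 ^ p ^ 1 := by
      rw [pow_one, mul_pow, zero_pow hp.out.ne_zero]
      obtain ⟨k, hk⟩ := Nat.exists_eq_succ_of_ne_zero hp.out.ne_zero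
      rw [hk, pow_succ (c ^ m), ← hk, mul_assoc, hm, mul_zero]
    have h3 := pow_inj (p := p) 1 h2
    have h4 : algebraMap P Lp a = 0 :=
      (IsLocalization.map_eq_zero_iff (Submonoid.powers c) Lp _).mpr ⟨⟨_, m, rfl⟩, h3⟩
    rw [h4] at h
    exact (hu.pow n).mul_left_eq_zero.mp h
  · intro z
    obtain ⟨n, a, h⟩ := IsLocalization.Away.surj c z
    have hu1 : IsUnit (algebraMap P Lp (rt p 1 c ^ n)) := by
      refine isUnit_of_dvd_unit ?_ (hu.pow n)
      rw [← map_pow (algebraMap P Lp)]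
      apply map_dvd
      conv_rhs => rw [← rt_pow (p := p) 1 c, pow_one]
      exact pow_dvd_pow_of_dvd (dvd_pow_self _ hp.out.ne_zero) n
    obtain ⟨u, hu1⟩ := hu1
    refine ⟨↑u⁻¹ * algebraMap P Lp (rt p 1 a), ?_⟩
    have h5 : rt p 1 a ^ p = a := by have := rt_pow (p := p) 1 a; rwa [pow_one] at this
    have h6 : (rt p 1 c ^ n) ^ p = c ^ n := by
      have := rt_pow (p := p) 1 c; rw [pow_one] at this
      rw [← pow_mul, mul_comm, pow_mul, this]
    rw [mul_pow, ← map_pow, h5, ← h, ← map_pow, ← h6, map_pow, ← hu1, mul_comm z, ← mul_assoc, ← mul_pow, Units.inv_mul, one_pow, one_mul]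
variable {Lp : Type*} [CommRing Lp] [Algebra P Lp] [CharP Lp p] [PerfectRing Lp p]
noncomputable def RE (p : ℕ) [Fact p.Prime] {P : Type*} [CommRing P] [CharP P p] [PerfectRing P p] (Lp : Type*) [CommRing Lp] [Algebra P Lp] [CharP Lp p] [PerfectRing Lp p]
    (f g : P) [IsLocalization.Away (f * g) Lp] : REdata p Lp where
  N := (algebraMap P Lp).range
  hN := by
    rintro _ ⟨a, rfl⟩ j
    exact ⟨rt p j a, rt_map (p := p) _ _ _⟩
  f := algebraMap P Lp f
  g := algebraMap P Lp g
  fi := algebraMap P Lp g * IsLocalization.Away.invSelf (f * g)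
  gi := algebraMap P Lp f * IsLocalization.Away.invSelf (f * g)
  hf := ⟨f, rfl⟩
  hg := ⟨g, rfl⟩
  hfi := by rw [← mul_assoc, ← map_mul, IsLocalization.Away.mul_invSelf]
  hgi := by rw [← mul_assoc, ← map_mul, mul_comm g, IsLocalization.Away.mul_invSelf]
variable (Lp) (f g : P) [IsLocalization.Away (f * g) Lp]
noncomputable def sN : P →+* (RE p Lp f g).N := (algebraMap P Lp).rangeRestrict
noncomputable def sn (n : ℕ) : P →+* (RE p Lp f g).Nn n := ((RE p Lp f g).inc n).comp (sN Lp f g)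
lemma sN_f : sN (p := p) Lp f g f = (RE p Lp f g).f0 := rfl
lemma sn_f (n : ℕ) : sn (p := p) Lp f g n f = (RE p Lp f g).fn n := rfl
lemma sN_rt (j : ℕ) : rt p j ((RE p Lp f g).f0 * (RE p Lp f g).g0) = sN (p := p) Lp f g (rt p j (f * g)) := by
  have h : sN (p := p) Lp f g (f * g) = (RE p Lp f g).f0 * (RE p Lp f g).g0 := map_mul _ _ _
  rw [← h]
  exact (rt_map (p := p) _ _ _).symm
noncomputable def sL (n : ℕ) : EE p f →+* LL p ((RE p Lp f g).fn n) :=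
  (algebraMap (EE p ((RE p Lp f g).fn n)) _).comp (EEmap (sn Lp f g n) (sn_f Lp f g n))
lemma sL_p (n : ℕ) : IsUnit (sL (p := p) Lp f g n p) := by rw [map_natCast]; exact LL_unit _
lemma sL_g (n : ℕ) : IsUnit (sL (p := p) Lp f g n (te p f g)) := by
  have := (RE p Lp f g).g_unit n
  rw [sL, RingHom.comp_apply, EEmap_te]
  exact this
lemma tr_sL {m n : ℕ} (h : m ≤ n) (z : EE p f) : LLmap ((RE p Lp f g).tr h) ((RE p Lp f g).tr_fn h) (sL Lp f g n z) = sL Lp f g m z := by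
  rw [sL, RingHom.comp_apply, LLmap_algebraMap, EEmap_comp]; rfl
lemma RE_lift (j : ℕ) (y : LL p ((RE p Lp f g).fn (2 * p ^ j))) (hy : IsIntegral (EE p ((RE p Lp f g).fn (2 * p ^ j))) y) :
    ∃ (a : P) (e : EE p ((RE p Lp f g).fn (p ^ j))), sL Lp f g (p ^ j) (te p f a) = sL Lp f g (p ^ j) (te p f (rt p j (f * g))) *
      LLmap ((RE p Lp f g).tr (show p ^ j ≤ 2 * p ^ j by omega)) ((RE p Lp f g).tr_fn _) y + algebraMap _ _ (p * e) := by
  obtain ⟨⟨_, a, rfl⟩, e, h⟩ := (RE p Lp f g).lift j y hy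
  refine ⟨a, e, ?_⟩
  have e1 := sN_rt (p := p) Lp f g j
  rw [e1] at h
  rw [sL, RingHom.comp_apply, EEmap_te, RingHom.comp_apply, EEmap_te]
  exact h
lemma RE_down0 (j : ℕ) (z : EE p f) (e : EE p ((RE p Lp f g).fn (p ^ j)))
    (hz : sL Lp f g (p ^ j) z = algebraMap _ _ (p * e)) :
    (p : EE p f) ∣ te p f (rt p j (f * g)) ^ 2 * z := by
  have h1 : EEmap (p := p) (sn (p := p) Lp f g (p ^ j)) (sn_f (p := p) Lp f g (p ^ j)) z = p * e :=
    LL_inj (p := p) (f := (RE p Lp f g).fn (p ^ j)) ((RE p Lp f g).nzd _) hz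
  have h2 := (RE p Lp f g).down j (EEmap (p := p) (f' := (RE p Lp f g).f0) (sN (p := p) Lp f g) (sN_f (p := p) Lp f g) z) ⟨e, by
    refine Eq.trans ?_ h1
    exact EEmap_comp (p := p) (sN (p := p) Lp f g) ((RE p Lp f g).inc (p ^ j)) (sN_f (p := p) Lp f g) ((RE p Lp f g).inc_f _) z⟩
  obtain ⟨k, w, rfl⟩ := E_exists z
  rw [mul_add]
  refine dvd_add ?_ (dvd_mul_of_dvd_right (dvd_mul_right _ _) _)
  have e1 := sN_rt (p := p) Lp f g j
  rw [e1, map_add, map_mul (EEmap _ _), map_natCast, mul_add, mul_left_comm, dvd_add_left (dvd_mul_right _ _), EEmap_te, ← map_mul, ← map_mul,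
    ← red_eq_zero, red_te, Ideal.Quotient.eq_zero_iff_mem, Ideal.mem_span_singleton] at h2
  obtain ⟨⟨_, b, rfl⟩, hb⟩ := h2
  have h3 : algebraMap P Lp (rt p j (f * g) * k - f * b) = 0 := by
    rw [map_sub, map_mul (algebraMap P Lp) f, sub_eq_zero]; exact congrArg Subtype.val hb
  obtain ⟨⟨_, m, rfl⟩, hm⟩ := (IsLocalization.map_eq_zero_iff (Submonoid.powers (f * g)) Lp _).mp h3
  have h4 := rt_mul_eq_zero (p := p) hm j
  rw [← map_pow, ← map_mul, ← red_eq_zero, red_te, Ideal.Quotient.eq_zero_iff_mem, Ideal.mem_span_singleton]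
  exact ⟨rt p j (f * g) * b, by linear_combination h4⟩
end
section
variable {p : ℕ} [hp : Fact p.Prime]
variable {P P' Lp Lp' : Type*} [CommRing P] [CharP P p] [PerfectRing P p] [CommRing P'] [CharP P' p] [PerfectRing P' p]
  [CommRing Lp] [Algebra P Lp] [CharP Lp p] [PerfectRing Lp p] [CommRing Lp'] [Algebra P' Lp'] [CharP Lp' p] [PerfectRing Lp' p]
lemma RE_map (f g : P) [IsLocalization.Away (f * g) Lp] (φ : P →+* P') (f' g' h : P') (hf : φ f = f') (hg : g' = φ g * h)
    [IsLocalization.Away (f' * g') Lp'] (n : ℕ) :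
    ∃ Φ : EE p ((RE p Lp f g).fn n) →+* EE p ((RE p Lp' f' g').fn n), ∃ Ψ : LL p ((RE p Lp f g).fn n) →+* LL p ((RE p Lp' f' g').fn n),
      (∀ z, Ψ (algebraMap _ _ z) = algebraMap _ _ (Φ z)) ∧ ∀ z, Ψ (sL Lp f g n z) = sL Lp' f' g' n (EEmap φ hf z) := by
  set D := RE p Lp f g
  set D' := RE p Lp' f' g'
  have hu : IsUnit (((algebraMap P' Lp').comp φ) (f * g)) := by
    refine isUnit_of_dvd_unit ?_ (IsLocalization.Away.algebraMap_isUnit (S := Lp') (f' * g'))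
    rw [RingHom.comp_apply]
    exact map_dvd _ ⟨h, by rw [map_mul, hf, hg, mul_assoc]⟩
  let φ1 : Lp →+* Lp' := IsLocalization.Away.lift (f * g) hu
  have h1 : ∀ a, φ1 (algebraMap P Lp a) = algebraMap P' Lp' (φ a) := fun a => IsLocalization.Away.lift_eq _ _ _
  have h2 : φ1 D.gi = D'.gi * algebraMap P' Lp' h := by
    have e1 : φ1 D.g * φ1 D.gi = 1 := by rw [← map_mul, D.hgi, map_one]
    have e2 : φ1 D.g * (D'.gi * algebraMap P' Lp' h) = 1 := by
      rw [← D'.hgi]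
      change φ1 (algebraMap P Lp g) * _ = algebraMap P' Lp' g' * _
      rw [h1, hg, map_mul]; ring
    calc _ = φ1 D.gi * (φ1 D.g * (D'.gi * algebraMap P' Lp' h)) := by rw [e2, mul_one]
      _ = φ1 D.g * φ1 D.gi * (D'.gi * algebraMap P' Lp' h) := by ring
      _ = _ := by rw [e1, one_mul]
  have h3 : ∀ z ∈ D.Nn n, φ1 z ∈ D'.Nn n := by
    change D.Nn n ≤ (D'.Nn n).comap φ1
    apply Subring.closure_le.mpr
    rintro x (⟨a, rfl⟩ | ⟨l, rfl⟩)
    · change φ1 (algebraMap P Lp a) ∈ D'.Nn n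
      rw [h1]; exact le_Nw _ _ ⟨_, rfl⟩
    · change φ1 (rt p l (D.f ^ n * D.gi)) ∈ D'.Nn n
      rw [rt_map, map_mul, map_pow, h2, ← mul_assoc]
      have : φ1 D.f = D'.f := (h1 f).trans (by rw [hf]; rfl)
      rw [this, rt_mul]
      refine Subring.mul_mem _ (rt_mem_Nw _ _ _) (le_Nw _ _ ⟨rt p l h, rt_map (p := p) _ _ _⟩)
  let Φ : D.Nn n →+* D'.Nn n := φ1.restrict _ _ h3
  have hΦ : Φ (D.fn n) = D'.fn n := Subtype.ext ((h1 f).trans (by rw [hf]; rfl))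
  refine ⟨EEmap Φ hΦ, LLmap Φ hΦ, fun z => LLmap_algebraMap _ _ _, fun z => ?_⟩
  rw [sL, RingHom.comp_apply, LLmap_algebraMap, sL, RingHom.comp_apply, EEmap_comp, EEmap_comp]
  congr 2
  have : Φ.comp (sn Lp f g n) = (sn Lp' f' g' n).comp φ := RingHom.ext fun a => Subtype.ext (h1 a)
  simp only [this]
end
end ACM
namespace ACM
open TensorProduct
lemma tlift.{u} {P Q P' Z : Type u} [CommRing P] [CommRing Q] [CommRing P'] [CommRing Z] [Algebra P Q] [Algebra P P']
    (α : Q →+* Z) (β : P' →+* Z) (h : ∀ a, α (algebraMap P Q a) = β (algebraMap P P' a)) :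
    ∃ γ : Q ⊗[P] P' →+* Z, ∀ a b, γ (a ⊗ₜ b) = α a * β b := by
  letI : Algebra P Z := (α.comp (algebraMap P Q)).toAlgebra
  let α' : Q →ₐ[P] Z := { α with commutes' := fun a => rfl }
  let β' : P' →ₐ[P] Z := { β with commutes' := fun a => (h a).symm }
  exact ⟨(Algebra.TensorProduct.lift α' β' (fun _ _ => Commute.all _ _)).toRingHom, fun a b => Algebra.TensorProduct.lift_tmul _ _ _ _ _⟩
theorem pushout.{u} {p : ℕ} [hp : Fact p.Prime] {P Q P' : Type u} [CommRing P] [CommRing Q] [CommRing P']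
    [CharP P p] [PerfectRing P p] [CharP Q p] [PerfectRing Q p] [CharP P' p] [PerfectRing P' p]
    (η : P →+* Q) (φ : P →+* P') {f : P} {f' : P'} {fQ : Q} (hη : η f = fQ) (hφ : φ f = f') (hff : (qmap φ hφ).FaithfullyFlat)
    (hfQ : ¬ IsUnit fQ) :
    ∃ (N : Type u) (_ : CommRing N) (_ : CharP N p) (_ : PerfectRing N p) (i1 : Q →+* N) (i2 : P' →+* N),
      (∀ a, i1 (η a) = i2 (φ a)) ∧ ∀ (I : Ideal (Q ⧸ Ideal.span {fQ})) z,
        qmap i1 (f := fQ) rfl z ∈ I.map (qmap i1 (f := fQ) rfl) → z ∈ I := by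
  letI : Algebra P Q := η.toAlgebra
  letI : Algebra P P' := φ.toAlgebra
  let N := Q ⊗[P] P'
  let i1 : Q →+* N := (Algebra.TensorProduct.includeLeft (R := P) (S := Q) (A := Q) (B := P')).toRingHom
  let i2 : P' →+* N := (Algebra.TensorProduct.includeRight (R := P) (A := Q) (B := P')).toRingHom
  have hi : ∀ a, i1 (η a) = i2 (φ a) := fun a =>
    ((Algebra.TensorProduct.includeLeft (R := P) (S := P) (A := Q) (B := P')).commutes a).trans
      ((Algebra.TensorProduct.includeRight (R := P) (A := Q) (B := P')).commutes a).symm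
  have hi12 : ∀ a b, i1 a * i2 b = a ⊗ₜ[P] b := fun a b => by
    change (a ⊗ₜ[P] (1 : P')) * ((1 : Q) ⊗ₜ[P] b) = _
    rw [Algebra.TensorProduct.tmul_mul_tmul, one_mul, mul_one]
  -- the ring S
  let Pb := P ⧸ Ideal.span {f}
  let Qb := Q ⧸ Ideal.span {fQ}
  let P'b := P' ⧸ Ideal.span {f'}
  letI : Algebra Pb Qb := (qmap η hη).toAlgebra
  letI : Algebra Pb P'b := (qmap φ hφ).toAlgebra
  haveI : Module.FaithfullyFlat Pb P'b := hff
  let S := Qb ⊗[Pb] P'b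
  let q1 : Qb →+* S := algebraMap Qb S
  have hS : ∀ (I : Ideal Qb) z, q1 z ∈ I.map q1 → z ∈ I := by
    intro I z hz
    have := Ideal.comap_map_eq_self_of_faithfullyFlat (A := Qb) (B := S) I
    rw [← this]; exact hz
  obtain ⟨γ, hγ⟩ := tlift (P := P) (Q := Q) (P' := P') (Z := S) (q1.comp (Ideal.Quotient.mk _))
    ((Algebra.TensorProduct.includeRight (R := Pb) (A := Qb) (B := P'b)).toRingHom.comp (Ideal.Quotient.mk _)) (by
      intro a
      exact ((Algebra.TensorProduct.includeLeft (R := Pb) (S := Pb) (A := Qb) (B := P'b)).commutes (Ideal.Quotient.mk _ a)).trans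
        ((Algebra.TensorProduct.includeRight (R := Pb) (A := Qb) (B := P'b)).commutes (Ideal.Quotient.mk _ a)).symm)
  have hγ1 : ∀ a, γ (i1 a) = q1 (Ideal.Quotient.mk _ a) := by
    intro a
    have := hγ a 1
    rw [map_one, mul_one] at this
    exact this
  haveI hQb : Nontrivial Qb := Ideal.Quotient.nontrivial_iff.mpr (by rwa [Ne, Ideal.span_singleton_eq_top])
  haveI : Nontrivial S := by
    refine ⟨0, 1, fun h => ?_⟩
    have := hS ⊥ 1 (by rw [map_one, ← h]; exact Ideal.zero_mem _)
    exact one_ne_zero ((Submodule.mem_bot _).mp this)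
  haveI : Nontrivial N := γ.domain_nontrivial
  haveI : CharP N p := charP_of_hom (p := p) i1
  have hrt : ∀ {K : Type u} [CommRing K] [CharP K p] [PerfectRing K p] (a : K), rt p 1 a ^ p = a := fun a => by
    have := rt_pow (p := p) 1 a; rwa [pow_one] at this
  obtain ⟨ι, hι⟩ := tlift (P := P) (Q := Q) (P' := P') (Z := N) (i1.comp (rt p 1 : Q ≃+* Q).toRingHom)
    (i2.comp (rt p 1 : P' ≃+* P').toRingHom) (by
      intro a
      change i1 (rt p 1 (η a)) = i2 (rt p 1 (φ a))
      rw [← rt_map, ← rt_map, hi])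
  have hι' : ∀ a b, ι (a ⊗ₜ b) = i1 (rt p 1 a) * i2 (rt p 1 b) := hι
  have h1 : ∀ z : N, ι z ^ p = z := by
    intro z
    induction z using TensorProduct.induction_on with
    | zero => rw [map_zero, zero_pow hp.out.ne_zero]
    | tmul a b => rw [hι', mul_pow, ← map_pow i1, ← map_pow i2, hrt, hrt, hi12]
    | add a b ha hb => rw [map_add, add_pow_char, ha, hb]
  have h2 : ∀ z : N, ι (z ^ p) = z := by
    intro z
    induction z using TensorProduct.induction_on with
    | zero => rw [zero_pow hp.out.ne_zero, map_zero]
    | tmul a b => rw [Algebra.TensorProduct.tmul_pow, hι', map_pow (rt p 1), map_pow (rt p 1), hrt, hrt, hi12]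
    | add a b ha hb => rw [add_pow_char, map_add, ha, hb]
  have hperf : PerfectRing N p := perfect_of (fun z hz => by rw [← h2 z, hz, map_zero]) (fun z => ⟨ι z, h1 z⟩)
  refine ⟨N, inferInstance, inferInstance, hperf, i1, i2, hi, ?_⟩
  intro I z hz
  apply hS
  let γ' : N ⧸ Ideal.span {i1 fQ} →+* S := Ideal.Quotient.lift _ γ (by
    intro a ha
    obtain ⟨b, rfl⟩ := Ideal.mem_span_singleton'.mp ha
    rw [map_mul, hγ1, Ideal.Quotient.eq_zero_iff_mem.mpr (Ideal.mem_span_singleton_self _), map_zero, mul_zero])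
  have hγ' : γ'.comp (qmap i1 (f := fQ) rfl) = q1 := by
    refine RingHom.ext fun w => ?_
    obtain ⟨w, rfl⟩ := Ideal.Quotient.mk_surjective w
    exact hγ1 w
  have := Ideal.mem_map_of_mem γ' hz
  rwa [Ideal.map_map, hγ', ← RingHom.comp_apply, hγ'] at this
end ACM
namespace ACM
section
variable {p : ℕ} [hp : Fact p.Prime]
lemma nil_or.{u} {N : Type u} [CommRing N] [CharP N p] [PerfectRing N p] (c : N) :
    (∀ j, rt p j c = 0) ∨ ∃ (L : Type u) (_ : CommRing L) (_ : CharP L p) (_ : PerfectRing L p) (_ : Algebra N L), IsLocalization.Away c L := by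
  by_cases h : ∃ n, c ^ n = 0
  · obtain ⟨n, hn⟩ := h
    left
    intro j
    have := rt_mul_eq_zero (p := p) (f := c) (z := 1) (n := n) (by rw [hn, zero_mul]) j
    rwa [mul_one] at this
  · right
    haveI : Nontrivial (Localization.Away c) := by
      refine ⟨0, 1, fun h01 => h ?_⟩
      have h1 : algebraMap N (Localization.Away c) 1 = 0 := by rw [map_one, h01]
      obtain ⟨⟨_, n, rfl⟩, hn⟩ := (IsLocalization.map_eq_zero_iff (Submonoid.powers c) (Localization.Away c) _).mp h1
      exact ⟨n, by simpa using hn⟩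
    haveI : CharP (Localization.Away c) p := charP_of_hom (p := p) (algebraMap N (Localization.Away c))
    exact ⟨Localization.Away c, inferInstance, inferInstance, loc_perfect (p := p) c, inferInstance, inferInstance⟩
lemma isIntegral_hom {E E' L L' : Type*} [CommRing E] [CommRing E'] [CommRing L] [CommRing L'] [Algebra E L] [Algebra E' L']
    {φ : E →+* E'} {ψ : L →+* L'} (h : ∀ z, ψ (algebraMap E L z) = algebraMap E' L' (φ z)) {y : L} (hy : IsIntegral E y) : IsIntegral E' (ψ y) := by
  obtain ⟨μ, m1, m2⟩ := hy
  refine ⟨μ.map φ, m1.map _, ?_⟩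
  rw [Polynomial.eval₂_map, show (algebraMap E' L').comp φ = ψ.comp (algebraMap E L) from RingHom.ext fun z => (h z).symm,
    ← Polynomial.hom_eval₂, m2, map_zero]
theorem conv.{u} {N : Type u} [CommRing N] [CharP N p] [PerfectRing N p] (f gT gQ : N) (h : te p f gT = te p f gQ) (j : ℕ) :
    ∃ a : N, f ∣ rt p j (f * gT) ^ 2 * (rt p j gQ * a - rt p j (f * gT) * rt p j gT) := by
  obtain h0 | ⟨L, _, _, _, _, _⟩ := nil_or (p := p) (f * gT)
  · exact ⟨0, by rw [h0]; simp⟩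
  have hgQ : ∀ n, IsUnit (sL (p := p) L f gT n (te p f (rt p j gQ))) := by
    intro n
    have h1 := sL_g (p := p) L f gT n
    rw [h, ← rt_pow (p := p) j gQ, map_pow, map_pow] at h1
    exact (isUnit_pow_iff (pow_ne_zero _ hp.out.ne_zero)).mp h1
  obtain ⟨u, hu⟩ := hgQ (2 * p ^ j)
  set y := sL (p := p) L f gT (2 * p ^ j) (te p f (rt p j gT)) * ↑u⁻¹
  have hy : y ^ p ^ j = 1 := by
    rw [mul_pow, ← map_pow, ← map_pow, rt_pow, h, ← rt_pow (p := p) j gQ, map_pow, map_pow, ← hu, ← mul_pow, Units.mul_inv, one_pow]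
  obtain ⟨a, e, ha⟩ := RE_lift L f gT j y (IsIntegral.of_pow (n := p ^ j) (pow_pos hp.out.pos _) (by rw [hy]; exact isIntegral_one))
  refine ⟨a, ?_⟩
  have hle : p ^ j ≤ 2 * p ^ j := by omega
  have hy2 : sL (p := p) L f gT (p ^ j) (te p f (rt p j gQ)) * LLmap ((RE p L f gT).tr hle) ((RE p L f gT).tr_fn _) y = sL (p := p) L f gT (p ^ j) (te p f (rt p j gT)) := by
    rw [← tr_sL (p := p) L f gT hle, ← tr_sL (p := p) L f gT hle, ← map_mul, ← hu, mul_left_comm, Units.mul_inv, mul_one]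
  have h3 := RE_down0 L f gT j (te p f (rt p j gQ) * te p f a - te p f (rt p j (f * gT)) * te p f (rt p j gT))
    (EEmap (sn L f gT _) (sn_f L f gT _) (te p f (rt p j gQ)) * e) (by
      rw [map_sub, map_mul, map_mul, ha, mul_add, mul_left_comm, hy2, add_sub_cancel_left, mul_left_comm (p : EE p _)]; exact (map_mul (algebraMap (EE p ((RE p L f gT).fn (p ^ j))) (LL p ((RE p L f gT).fn (p ^ j)))) _ _).symm)
  generalize rt p j (f * gT) = C at h3 ⊢
  rw [← red_eq_zero, map_mul, map_sub, map_mul, map_mul, map_pow, red_te, red_te, red_te, red_te, ← map_mul, ← map_mul, ← map_sub, ← map_pow, ← map_mul] at h3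
  exact mk_eq_zero_iff_dvd.mp h3
theorem bstep {P L : Type*} [CommRing P] [CharP P p] [PerfectRing P p] [CommRing L] [Algebra P L] [CharP L p] [PerfectRing L p]
    (f g : P) [IsLocalization.Away (f * g) L] {J : Type*} [Fintype J] (xr : EE p f) (x : J → EE p f)
    (hreg : ∀ u, red p f xr * u ∈ Ideal.span (Set.range fun k => red p f (x k)) → u ∈ Ideal.span (Set.range fun k => red p f (x k))) (j : ℕ)
    (y : LL p ((RE p L f g).fn (2 * p ^ j))) (hy : IsIntegral (EE p ((RE p L f g).fn (2 * p ^ j))) y)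
    (y0 : LL p ((RE p L f g).fn (2 * p ^ j))) (hy0 : IsIntegral (EE p ((RE p L f g).fn (2 * p ^ j))) y0)
    (y' : J → LL p ((RE p L f g).fn (2 * p ^ j))) (hy' : ∀ k, IsIntegral (EE p ((RE p L f g).fn (2 * p ^ j))) (y' k))
    (hrel : sL L f g (2 * p ^ j) xr * y = ∑ k, sL L f g (2 * p ^ j) (x k) * y' k + (p : LL p ((RE p L f g).fn (2 * p ^ j))) * y0) :
    ∃ (b : P) (e : EE p ((RE p L f g).fn (p ^ j))), sL L f g (p ^ j) (te p f b) = sL L f g (p ^ j) (te p f (rt p j (f * g))) *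
      LLmap ((RE p L f g).tr (show p ^ j ≤ 2 * p ^ j by omega)) ((RE p L f g).tr_fn _) y + algebraMap _ _ (p * e) ∧
      Ideal.Quotient.mk (Ideal.span {f}) (rt p j (f * g) ^ 2 * b) ∈ Ideal.span (Set.range fun k => red p f (x k)) := by
  obtain ⟨b, e, hb⟩ := RE_lift L f g j y hy
  obtain ⟨b0, e0, hb0⟩ := RE_lift L f g j y0 hy0
  choose b' e' hb' using fun k => RE_lift L f g j (y' k) (hy' k)
  refine ⟨b, e, hb, ?_⟩
  have hle : p ^ j ≤ 2 * p ^ j := by omega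
  have hrel2 := congrArg (LLmap ((RE p L f g).tr hle) ((RE p L f g).tr_fn _)) hrel
  simp only [map_mul, map_add, map_sum, tr_sL, map_natCast] at hrel2
  set S := sL (p := p) L f g (p ^ j)
  set al := algebraMap (EE p ((RE p L f g).fn (p ^ j))) (LL p ((RE p L f g).fn (p ^ j)))
  set ss := EEmap (p := p) (sn L f g (p ^ j)) (sn_f L f g (p ^ j))
  have hS : ∀ z, S z = al (ss z) := fun z => rfl
  set C := te p f (rt p j (f * g))
  have h3 := RE_down0 L f g j (xr * te p f b - ∑ k, x k * te p f (b' k)) (ss (te p f b0) - p * e0 + ss xr * e - ∑ k, ss (x k) * e' k) (by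
    change S _ = al _
    rw [map_sub, map_sum, map_mul]
    simp only [map_mul S, hb', hb, mul_add, Finset.sum_add_distrib]
    have e1 : ∀ k, S (x k) * (S C * (LLmap ((RE p L f g).tr hle) ((RE p L f g).tr_fn _)) (y' k)) = S C * (S (x k) * (LLmap ((RE p L f g).tr hle) ((RE p L f g).tr_fn _)) (y' k)) := fun k => by ring
    have e2 : ∑ k, S (x k) * al (p * e' k) = p * ∑ k, al (ss (x k) * e' k) := by
      rw [Finset.mul_sum]
      refine Finset.sum_congr rfl fun k _ => ?_
      rw [hS, map_mul, map_mul, map_natCast]; ring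
    simp only [e1, ← Finset.mul_sum]
    rw [e2]
    simp only [map_mul al, map_sub, map_add, map_natCast, map_sum, ← hS] at hb0 e2 ⊢
    linear_combination S C * hrel2 - p * hb0)
  change (p : EE p f) ∣ te p f (rt p j (f * g)) ^ 2 * _ at h3
  clear hb hb' hb0 C
  generalize rt p j (f * g) = C at h3 ⊢
  rw [← red_eq_zero, map_mul, map_pow, red_te, map_sub, map_sum, map_mul, red_te] at h3
  simp only [map_mul (red p f), red_te] at h3
  apply hreg
  have h4 : red p f xr * Ideal.Quotient.mk (Ideal.span {f}) (C ^ 2 * b) =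
      Ideal.Quotient.mk (Ideal.span {f}) C ^ 2 * ∑ k, red p f (x k) * Ideal.Quotient.mk (Ideal.span {f}) (b' k) := by
    rw [map_mul, map_pow]
    linear_combination h3
  rw [h4]
  refine Ideal.mul_mem_left _ _ (Ideal.sum_mem _ fun k _ => Ideal.mul_mem_right _ _ (Ideal.subset_span ⟨k, rfl⟩))
end
end ACM
namespace ACM
section
variable {p : ℕ} [hp : Fact p.Prime]
lemma flat_colon {A B J : Type*} [CommRing A] [CommRing B] [Fintype J] {φ : A →+* B} (h : φ.Flat) (x : A) (y : J → A)
    (hx : ∀ u, x * u ∈ Ideal.span (Set.range y) → u ∈ Ideal.span (Set.range y)) (u : B)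
    (hu : φ x * u ∈ Ideal.span (Set.range fun k => φ (y k))) : u ∈ Ideal.span (Set.range fun k => φ (y k)) := by
  obtain ⟨v, hv⟩ := (Ideal.mem_span_range_iff_exists_fun).mp hu
  obtain ⟨k, c, w, h1, h2⟩ := flat_rel h (ι := Option J) (fun o => o.elim x (fun k => - y k)) (fun o => o.elim u v) (by
    rw [Fintype.sum_option]
    simp only [Option.elim, map_neg, neg_mul, Finset.sum_neg_distrib]
    rw [← hv, add_neg_eq_zero]
    exact Finset.sum_congr rfl fun i _ => mul_comm _ _)
  have h3 : u = _ := h1 none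
  rw [h3]
  refine Ideal.sum_mem _ fun i _ => Ideal.mul_mem_right _ _ ?_
  have h4 : c none i ∈ Ideal.span (Set.range y) := by
    apply hx
    have := h2 i
    rw [Fintype.sum_option] at this
    simp only [Option.elim, neg_mul, Finset.sum_neg_distrib, add_neg_eq_zero] at this
    rw [this]
    exact Ideal.sum_mem _ fun i _ => Ideal.mul_mem_right _ _ (Ideal.subset_span ⟨i, rfl⟩)
  have := Ideal.mem_map_of_mem φ h4
  rwa [Ideal.map_span, ← Set.range_comp] at this
theorem core {P L : Type*} [CommRing P] [CharP P p] [PerfectRing P p] [CommRing L] [Algebra P L] [CharP L p] [PerfectRing L p]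
    (f g : P) [IsLocalization.Away (f * g) L] {ι : Type*} [Fintype ι] (j : ℕ) (e y : ι → LL p ((RE p L f g).fn (2 * p ^ j)))
    (he : ∀ l, e l * e l = e l) (he1 : ∑ l, e l = 1) (τ : EE p f) (hτ : ∀ l, e l * sL L f g (2 * p ^ j) τ = e l * y l)
    (b : ι → P) (cq : P) (ε' : ι → EE p ((RE p L f g).fn (p ^ j)))
    (hb : ∀ l, sL L f g (p ^ j) (te p f (b l)) = sL L f g (p ^ j) (te p f cq) *
      LLmap ((RE p L f g).tr (show p ^ j ≤ 2 * p ^ j by omega)) ((RE p L f g).tr_fn _) (y l) + algebraMap _ _ (p * ε' l)) :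
    ∃ a : ι → P, (∀ l, Ideal.Quotient.mk (Ideal.span {f}) (rt p j (f * g)) ^ 2 * (Ideal.Quotient.mk (Ideal.span {f}) (a l) *
      (Ideal.Quotient.mk (Ideal.span {f}) cq * red p f τ - Ideal.Quotient.mk (Ideal.span {f}) (b l))) = 0) ∧
      Ideal.Quotient.mk (Ideal.span {f}) (rt p j (f * g)) ^ 2 * (∑ l, Ideal.Quotient.mk (Ideal.span {f}) (a l) - Ideal.Quotient.mk (Ideal.span {f}) (rt p j (f * g))) = 0 := by
  have hint : ∀ l, IsIntegral (EE p ((RE p L f g).fn (2 * p ^ j))) (e l) := by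
    intro l
    refine ⟨Polynomial.X ^ 2 - Polynomial.X, Polynomial.monic_X_pow_sub (n := 2) (lt_of_le_of_lt Polynomial.degree_X_le (by norm_num)), ?_⟩
    rw [Polynomial.eval₂_sub, Polynomial.eval₂_pow, Polynomial.eval₂_X, pow_two, he, sub_self]
  choose a ε ha using fun l => RE_lift L f g j (e l) (hint l)
  have hle : p ^ j ≤ 2 * p ^ j := by omega
  refine ⟨a, ?_, ?_⟩
  · intro l
    have h1 := congrArg (LLmap ((RE p L f g).tr hle) ((RE p L f g).tr_fn _)) (hτ l)
    simp only [map_mul, tr_sL] at h1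
    have h2 := ha l
    have h3 := hb l
    set S := sL (p := p) L f g (p ^ j)
    set al := algebraMap (EE p ((RE p L f g).fn (p ^ j))) (LL p ((RE p L f g).fn (p ^ j)))
    set ss := EEmap (p := p) (sn L f g (p ^ j)) (sn_f L f g (p ^ j))
    have hS : ∀ z, S z = al (ss z) := fun z => rfl
    have h4 := RE_down0 L f g j (te p f (a l) * (te p f cq * τ - te p f (b l)))
      (ε l * (ss (te p f cq * τ - te p f (b l))) - (ss (te p f (a l)) - p * ε l) * ε' l) (by
      change S _ = al _
      simp only [map_mul S, map_mul al, map_sub, map_natCast, map_mul ss, ← hS] at h2 h3 ⊢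
      linear_combination -(S (te p f (a l)) - p * al (ε l)) * h3 + S (te p f cq) * S (te p f (rt p j (f * g))) * h1
        + S (te p f cq) * (S τ - (LLmap ((RE p L f g).tr hle) ((RE p L f g).tr_fn _)) (y l)) * h2)
    clear hb h2 h3 ha
    generalize rt p j (f * g) = C at h4 ⊢
    rw [← red_eq_zero] at h4
    simp only [map_mul (red p f), map_sub, map_pow, red_te] at h4
    exact h4
  · set S := sL (p := p) L f g (p ^ j)
    set al := algebraMap (EE p ((RE p L f g).fn (p ^ j))) (LL p ((RE p L f g).fn (p ^ j)))
    have h4 := RE_down0 L f g j (∑ l, te p f (a l) - te p f (rt p j (f * g))) (∑ l, ε l) (by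
      change S _ = al _
      rw [map_sub, map_sum]
      simp only [ha, Finset.sum_add_distrib, ← Finset.mul_sum, ← map_sum, he1, map_one]
      rw [mul_one, add_sub_cancel_left])
    clear hb ha
    generalize rt p j (f * g) = C at h4 ⊢
    rw [← red_eq_zero] at h4
    simp only [map_mul (red p f), map_sub, map_pow, red_te, map_sum] at h4
    exact h4
end
end ACM
namespace ACM
section
variable {p : ℕ} [hp : Fact p.Prime]
lemma red_EEmap {K L : Type*} [CommRing K] [CommRing L] [CharP K p] [PerfectRing K p] [CharP L p] [PerfectRing L p]
    (φ : K →+* L) {f : K} {f' : L} (h : φ f = f') (z : EE p f) : red p f' (EEmap φ h z) = qmap φ h (red p f z) := by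
  obtain ⟨z, rfl⟩ := Ideal.Quotient.mk_surjective z
  rw [EEmap_mk, red_mk, red_mk, qmap_mk, WittVector.map_coeff]
theorem asm1.{u} {A T Ω : Type u} [CommRing A] [CommRing T] [Field Ω] (aT : A →+* T) (jT : T →+* Ω) (g : A)
    (hint : ∀ t, aT.IsIntegralElem t) {Y : PObj.{u} p A} (y1 : Y.P) (hy1 : te p Y.f y1 = Y.ι g)
    {N : Type u} [CommRing N] [CharP N p] [PerfectRing N p] (i2 : Y.P →+* N) (fN : N) (hi : i2 Y.f = fN) (κ : T →+* EE p fN)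
    (hκ : ∀ a, EEmap i2 hi (Y.ι a) = κ (aT a)) (GT : N) {J : Type} [Fintype J] (xr : A) (x : J → A)
    (hreg : ∀ u, red p Y.f (Y.ι xr) * u ∈ Ideal.span (Set.range fun k => red p Y.f (Y.ι (x k))) →
      u ∈ Ideal.span (Set.range fun k => red p Y.f (Y.ι (x k))))
    (hGT : te p fN GT = κ (aT g)) (B : Subring Ω) (hAB : ∀ a, jT (aT a) ∈ B) (hB : SPL (p * g) (jT.comp aT) Y B)
    (hext : ∀ (𝓔 : Type u) [CommRing 𝓔] (ω : T →+* 𝓔), IsUnit (ω (aT (p * g))) → ∃ α : B →+* 𝓔, ∀ (b : B) t, (b : Ω) = jT t → α b = ω t)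
    (t s0 : T) (s : J → T) (ht : jT t ∈ B) (hs0 : jT s0 ∈ B) (hs : ∀ k, jT (s k) ∈ B)
    (hrel : aT xr * t = ∑ k, aT (x k) * s k + p * s0) (j : ℕ) :
    Ideal.Quotient.mk (Ideal.span {fN}) (rt p j (fN * (i2 y1 * GT)) ^ 3 * rt p j (fN * i2 y1) ^ 3) * red p fN (κ t) ∈
      Ideal.span (Set.range fun k => red p fN (κ (aT (x k)))) := by
  obtain h0 | ⟨LN, _, _, _, _, _⟩ := nil_or (p := p) (fN * (i2 y1 * GT))
  · simp [h0]
  have hcq : i2 (rt p j (Y.f * y1)) = rt p j (fN * i2 y1) := by rw [rt_map, map_mul, hi]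
  obtain h0 | ⟨LY, _, _, _, _, _⟩ := nil_or (p := p) (Y.f * y1)
  · rw [← hcq, h0]; simp
  set G := i2 y1 * GT with hG
  obtain ⟨Φ, Ψ, hΨ1, hΨ2⟩ := RE_map (p := p) (Lp := LY) (Lp' := LN) Y.f y1 i2 fN G GT hi rfl (p ^ j)
  have hle : p ^ j ≤ 2 * p ^ j := by omega
  -- the maps out of the localisation
  have uY : ∀ m, IsUnit (sL (p := p) LY Y.f y1 m (Y.ι (p * g))) := by
    intro m
    rw [map_mul, map_mul, map_natCast, ← hy1]
    exact (sL_p (p := p) LY Y.f y1 m).mul (sL_g (p := p) LY Y.f y1 m)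
  have uN : ∀ m, IsUnit (sL (p := p) LN fN G m (EEmap i2 hi (Y.ι (p * g)))) := by
    intro m
    have h1 := sL_g (p := p) LN fN G m
    rw [show te p fN G = te p fN (i2 y1) * te p fN GT from map_mul _ _ _, map_mul] at h1
    rw [map_mul, map_mul, map_mul, map_natCast, map_natCast, ← hy1, EEmap_te]
    exact (sL_p (p := p) LN fN G m).mul (isUnit_of_mul_isUnit_left h1)
  let βY := fun m => IsLocalization.Away.lift (S := Y.Qg (p * g)) (Y.ι (p * g)) (g := sL (p := p) LY Y.f y1 m) (uY m)
  let βN := fun m => IsLocalization.Away.lift (S := Y.Qg (p * g)) (Y.ι (p * g)) (g := (sL (p := p) LN fN G m).comp (EEmap i2 hi)) (uN m)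
  have hβY : ∀ m z, βY m (algebraMap _ _ z) = sL (p := p) LY Y.f y1 m z := fun m z => IsLocalization.Away.lift_eq _ _ _
  have hβN : ∀ m z, βN m (algebraMap _ _ z) = sL (p := p) LN fN G m (EEmap i2 hi z) := fun m z => IsLocalization.Away.lift_eq _ _ _
  have hcomm : ∀ z, LLmap ((RE p LN fN G).tr hle) ((RE p LN fN G).tr_fn _) (βN (2 * p ^ j) z) =
      Ψ (LLmap ((RE p LY Y.f y1).tr hle) ((RE p LY Y.f y1).tr_fn _) (βY (2 * p ^ j) z)) := by
    intro z
    refine RingHom.congr_fun (f := (LLmap ((RE p LN fN G).tr hle) ((RE p LN fN G).tr_fn _)).comp (βN (2 * p ^ j)))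
      (g := Ψ.comp ((LLmap ((RE p LY Y.f y1).tr hle) ((RE p LY Y.f y1).tr_fn _)).comp (βY (2 * p ^ j)))) ?_ z
    refine IsLocalization.ringHom_ext (Submonoid.powers (Y.ι (p * g))) (RingHom.ext fun z => ?_)
    simp only [RingHom.comp_apply]
    rw [hβY, hβN, tr_sL, tr_sL, hΨ2]
  obtain ⟨ι, _, ρ, hρ, hsplit⟩ := hB
  obtain ⟨α, hα⟩ := hext _ ((sL (p := p) LN fN G (2 * p ^ j)).comp κ) (by
    rw [RingHom.comp_apply, ← hκ]; exact uN _)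
  obtain ⟨e, he, he1, he2⟩ := hsplit _ α (βN (2 * p ^ j)) (by
    intro b a hb
    rw [hα b (aT a) hb, RingHom.comp_apply, ← hκ]; exact (hβN _ _).symm)
  let aB : A →+* B := (jT.comp aT).codRestrict B hAB
  have hr : ∀ l a, βY (2 * p ^ j) (ρ l (aB a)) = sL (p := p) LY Y.f y1 (2 * p ^ j) (Y.ι a) := by
    intro l a
    rw [hρ l (aB a) a rfl]; exact hβY _ _
  have hI : ∀ l (t : T) (ht : jT t ∈ B), IsIntegral (EE p ((RE p LY Y.f y1).fn (2 * p ^ j))) (βY (2 * p ^ j) (ρ l ⟨jT t, ht⟩)) := by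
    intro l t ht
    obtain ⟨μ, m1, m2⟩ := hint t
    refine ⟨μ.map ((EEmap (sn LY Y.f y1 (2 * p ^ j)) (sn_f LY Y.f y1 (2 * p ^ j))).comp Y.ι), m1.map _, ?_⟩
    have h1 : Polynomial.eval₂ aB ⟨jT t, ht⟩ μ = 0 := by
      apply Subtype.ext
      rw [← Subring.subtype_apply, Polynomial.hom_eval₂]
      change Polynomial.eval₂ (jT.comp aT) (jT t) μ = 0
      rw [← Polynomial.hom_eval₂, m2, map_zero]
    have h2 := congrArg ((βY (2 * p ^ j)).comp (ρ l)) h1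
    rw [Polynomial.hom_eval₂, map_zero] at h2
    rw [Polynomial.eval₂_map, ← h2]
    exact congrArg (fun r => Polynomial.eval₂ r _ μ) (RingHom.ext fun a => (hr l a).symm)
  have hb := fun l => bstep (p := p) (L := LY) Y.f y1 (Y.ι xr) (fun k => Y.ι (x k)) hreg j _ (hI l t ht) _ (hI l s0 hs0) _
    (fun k => hI l (s k) (hs k)) (by
      have h1 : aB xr * ⟨jT t, ht⟩ = ∑ k, aB (x k) * ⟨jT (s k), hs k⟩ + p * (⟨jT s0, hs0⟩ : B) := by
        apply B.subtype_injective
        rw [map_add, map_mul, map_mul, map_sum, map_natCast]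
        simp only [map_mul B.subtype]
        have := congrArg jT hrel
        simp only [map_mul, map_add, map_sum, map_natCast] at this
        exact this
      have h2 := congrArg ((βY (2 * p ^ j)).comp (ρ l)) h1
      simp only [map_mul, map_add, map_sum, map_natCast] at h2
      simpa only [RingHom.comp_apply, hr] using h2)
  choose b ε hb1 hb2 using hb
  obtain ⟨a, ha1, ha2⟩ := core (p := p) (L := LN) fN G j e (fun l => βN (2 * p ^ j) (ρ l ⟨jT t, ht⟩)) he he1 (κ t)
    (fun l => by rw [← he2, hα _ t rfl]; rfl) (fun l => i2 (b l)) (i2 (rt p j (Y.f * y1))) (fun l => Φ (ε l)) (fun l => by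
      have := congrArg Ψ (hb1 l)
      rw [map_add, map_mul, hΨ1, hΨ2, hΨ2, EEmap_te, EEmap_te, ← hcomm, map_mul Φ, map_natCast] at this
      exact this)
  rw [hcq] at ha1
  have hb3 : ∀ l, Ideal.Quotient.mk (Ideal.span {fN}) (rt p j (fN * i2 y1) ^ 2 * i2 (b l)) ∈
      Ideal.span (Set.range fun k => red p fN (κ (aT (x k)))) := by
    intro l
    have h1 := Ideal.mem_map_of_mem (qmap i2 hi) (hb2 l)
    rw [Ideal.map_span, ← Set.range_comp, qmap_mk, map_mul, map_pow, hcq] at h1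
    convert h1 using 3
    funext k
    rw [← hκ, red_EEmap]; rfl
  clear hb1 hb2 hcq
  generalize rt p j (fN * G) = C1 at *
  generalize rt p j (fN * i2 y1) = C2 at *
  have key : Ideal.Quotient.mk (Ideal.span {fN}) (C1 ^ 3 * C2 ^ 3) * red p fN (κ t) =
      ∑ l, Ideal.Quotient.mk (Ideal.span {fN}) (C1 ^ 2 * a l) * Ideal.Quotient.mk (Ideal.span {fN}) (C2 ^ 2 * i2 (b l)) := by
    have h1 : ∀ l, Ideal.Quotient.mk (Ideal.span {fN}) (C1 ^ 2 * a l) * Ideal.Quotient.mk (Ideal.span {fN}) (C2 ^ 2 * i2 (b l)) =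
        Ideal.Quotient.mk (Ideal.span {fN}) (a l) * (Ideal.Quotient.mk (Ideal.span {fN}) (C1 ^ 2 * C2 ^ 3) * red p fN (κ t)) := by
      intro l
      have := ha1 l
      simp only [map_mul, map_pow] at this ⊢
      linear_combination (-(Ideal.Quotient.mk (Ideal.span {fN}) C2) ^ 2) * this
    rw [Finset.sum_congr rfl fun l _ => h1 l, ← Finset.sum_mul]
    simp only [map_mul, map_pow] at ha2 ⊢
    linear_combination (-(Ideal.Quotient.mk (Ideal.span {fN}) C2) ^ 3 * red p fN (κ t)) * ha2
  rw [key]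
  exact Ideal.sum_mem _ fun l _ => Ideal.mul_mem_left _ _ (hb3 l)
theorem assembly.{u} {A T Ω : Type u} [CommRing A] [CommRing T] [Field Ω] (aT : A →+* T) (jT : T →+* Ω) (g : A)
    (hint : ∀ t, aT.IsIntegralElem t) {X Y : PObj.{u} p A} (h : PHom X Y) (y1 : Y.P) (hy1 : te p Y.f y1 = Y.ι g)
    {Q : Type u} [CommRing Q] [CharP Q p] [PerfectRing Q p] (η : X.P →+* Q) (fQ : Q) (hη : η X.f = fQ) (hfQ : ¬ IsUnit fQ)
    (κ : T →+* EE p fQ) (hκ : ∀ a, EEmap η hη (X.ι a) = κ (aT a)) (gT : Q) (hgT : te p fQ gT = κ (aT g))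
    {J : Type} [Fintype J] (xr : A) (x : J → A)
    (hreg : ∀ u, red p X.f (X.ι xr) * u ∈ Ideal.span (Set.range fun k => red p X.f (X.ι (x k))) →
      u ∈ Ideal.span (Set.range fun k => red p X.f (X.ι (x k))))
    (B : Subring Ω) (hAB : ∀ a, jT (aT a) ∈ B) (hB : SPL (p * g) (jT.comp aT) Y B)
    (hext : ∀ (𝓔 : Type u) [CommRing 𝓔] (ω : T →+* 𝓔), IsUnit (ω (aT (p * g))) → ∃ α : B →+* 𝓔, ∀ (b : B) t, (b : Ω) = jT t → α b = ω t)
    (t s0 : T) (s : J → T) (ht : jT t ∈ B) (hs0 : jT s0 ∈ B) (hs : ∀ k, jT (s k) ∈ B)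
    (hrel : aT xr * t = ∑ k, aT (x k) * s k + p * s0) (n : ℕ) :
    Ideal.Quotient.mk (Ideal.span {fQ}) (rt p n (fQ * gT)) * red p fQ (κ t) ∈
      Ideal.span (Set.range fun k => red p fQ (κ (aT (x k)))) := by
  obtain ⟨N, _, _, _, i1, i2, hi, hI⟩ := pushout (p := p) η h.φ hη h.hf h.good.ff hfQ
  have hiY : i2 Y.f = i1 fQ := by rw [← h.hf, ← hi, hη]
  set fN := i1 fQ with hfN
  have hκN : ∀ a, EEmap i2 hiY (Y.ι a) = (EEmap i1 hfN.symm).comp κ (aT a) := by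
    intro a
    rw [RingHom.comp_apply, ← hκ, ← h.comm, EEmap_comp, EEmap_comp]
    have : i2.comp h.φ = i1.comp η := RingHom.ext fun z => (hi z).symm
    congr 1
    simp only [this]
  have hGT : te p fN (i1 gT) = (EEmap i1 hfN.symm).comp κ (aT g) := by
    rw [RingHom.comp_apply, ← hgT, EEmap_te]
  have hregY : ∀ u, red p Y.f (Y.ι xr) * u ∈ Ideal.span (Set.range fun k => red p Y.f (Y.ι (x k))) →
      u ∈ Ideal.span (Set.range fun k => red p Y.f (Y.ι (x k))) := by
    have := flat_colon h.good.ff.flat _ _ hreg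
    simpa only [← red_EEmap, h.comm] using this
  have h1 := asm1 aT jT g hint y1 hy1 i2 fN hiY _ hκN (i1 gT) xr x hregY hGT B hAB hB hext t s0 s ht hs0 hs hrel (n + 5)
  obtain ⟨a, ha⟩ := conv (p := p) fN (i1 gT) (i2 y1) (by rw [hGT, ← hκN, ← hy1, EEmap_te]) (n + 5)
  apply hI
  rw [map_mul, qmap_mk, Ideal.map_span, ← Set.range_comp]
  change _ ∈ Ideal.span (Set.range fun k => qmap i1 hfN.symm (red p fQ (κ (aT (x k)))))
  have h3 : i1 (rt p n (fQ * gT)) = (rt p (n + 5) fN * rt p (n + 5) (i1 gT)) ^ p ^ 5 := by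
    rw [rt_map, map_mul, ← hfN, ← rt_mul, rt_add_pow]
  rw [h3]
  simp only [rt_mul] at h1 ha
  rw [← mk_eq_zero_iff_dvd] at ha
  simp only [RingHom.comp_apply, red_EEmap] at h1
  change _ * (qmap i1 hfN.symm (red p fQ (κ t))) ∈ _
  set I := Ideal.span (Set.range fun k => qmap i1 hfN.symm (red p fQ (κ (aT (x k)))))
  generalize qmap i1 hfN.symm (red p fQ (κ t)) = τ at *
  generalize rt p (n + 5) fN = F at *
  generalize rt p (n + 5) (i1 gT) = u at *
  generalize rt p (n + 5) (i2 y1) = v at *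
  have h4 : 27 ≤ p ^ 5 := le_trans (by norm_num) (Nat.pow_le_pow_left hp.out.two_le 5)
  obtain ⟨m, hm⟩ := Nat.exists_eq_add_of_le h4
  rw [hm, pow_add, map_mul]
  simp only [map_mul, map_pow, map_sub] at h1 ha ⊢
  generalize Ideal.Quotient.mk (Ideal.span {fN}) F = F at *
  generalize Ideal.Quotient.mk (Ideal.span {fN}) u = u at *
  generalize Ideal.Quotient.mk (Ideal.span {fN}) v = v at *
  generalize Ideal.Quotient.mk (Ideal.span {fN}) a = a at *
  have h5 : (F * u) ^ 2 * a * v = (F * u) ^ 3 * u := by linear_combination ha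
  have h6 := I.mul_mem_left ((F * u) ^ m * F ^ 3 * ((F * u) ^ 2 * a) ^ 6) h1
  convert h6 using 1
  have h7 := congrArg (· ^ 6) h5
  linear_combination (-(F * u) ^ m * F ^ 9 * u ^ 3 * τ) * h7
end
end ACM
namespace ACM
section
open WittVector
variable {p : ℕ} [hp : Fact p.Prime] {S K : Type*} [CommRing S] [CommRing K]
lemma ghost_eq {S : Type*} [CommRing S] (n : ℕ) (y : WittVector p S) : ghostComponent n y = ∑ i ∈ Finset.range (n + 1), (p : S) ^ i * y.coeff i ^ p ^ (n - i) := by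
  rw [ghostComponent_apply, wittPolynomial_eq_sum_C_mul_X_pow, map_sum]
  refine Finset.sum_congr rfl fun i _ => ?_
  simp
lemma ghost_map {S S' : Type*} [CommRing S] [CommRing S'] (φ : S →+* S') (n : ℕ) (y : WittVector p S) :
    ghostComponent n (map φ y) = φ (ghostComponent n y) := by
  rw [ghost_eq, ghost_eq, map_sum]
  refine Finset.sum_congr rfl fun i _ => ?_
  rw [map_coeff, map_mul, map_pow, map_pow, map_natCast]
lemma ghost_mem (I : Ideal S) (hI : (p : S) ∈ I) (n : ℕ) (y : WittVector p S) (hy : map (Ideal.Quotient.mk I) y = 0) :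
    ghostComponent n y ∈ I ^ (n + 1) := by
  rw [ghost_eq]
  refine Ideal.sum_mem _ fun i hi => ?_
  have h1 : y.coeff i ∈ I := by
    rw [← Ideal.Quotient.eq_zero_iff_mem, ← map_coeff, hy, zero_coeff]
  have h2 : n + 1 ≤ i + p ^ (n - i) := by
    have := Nat.lt_pow_self (n := n - i) hp.out.one_lt
    have := Finset.mem_range.mp hi
    omega
  refine Ideal.pow_le_pow_right h2 ?_
  rw [pow_add]
  exact Ideal.mul_mem_mul (Ideal.pow_mem_pow hI _) (Ideal.pow_mem_pow h1 _)
noncomputable def th (I : Ideal S) (hI : (p : S) ∈ I) (h : ℕ → K →+* S ⧸ I) (n : ℕ) : WittVector p K →+* S ⧸ I ^ (n + 1) :=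
  (RingHom.liftOfSurjective (map (Ideal.Quotient.mk I)) (map_surjective _ Ideal.Quotient.mk_surjective)
    ⟨(Ideal.Quotient.mk (I ^ (n + 1))).comp (ghostComponent n), fun y hy => by
      rw [RingHom.mem_ker, RingHom.comp_apply, Ideal.Quotient.eq_zero_iff_mem]
      exact ghost_mem I hI n y hy⟩).comp (map (h n))
variable {I : Ideal S} {hI : (p : S) ∈ I} {h : ℕ → K →+* S ⧸ I}
lemma th_eq {n : ℕ} {z : WittVector p K} (y : WittVector p S) (hy : map (Ideal.Quotient.mk I) y = map (h n) z) :
    th I hI h n z = Ideal.Quotient.mk _ (ghostComponent n y) := by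
  rw [th, RingHom.comp_apply, ← hy]
  exact RingHom.liftOfSurjective_comp_apply ..
lemma th_te {n : ℕ} {x : K} {s : S} (hs : Ideal.Quotient.mk I s = h n x) :
    th I hI h n (teichmuller p x) = Ideal.Quotient.mk _ (s ^ p ^ n) := by
  rw [th_eq (teichmuller p s) (by rw [map_teichmuller, map_teichmuller, hs]), ghostComponent_teichmuller]
lemma pow_congr (hI : (p : S) ∈ I) {a b : S} {m : ℕ} (hm : 0 < m) (hab : a - b ∈ I ^ m) : a ^ p - b ^ p ∈ I ^ (m + 1) := by
  obtain ⟨r, hr⟩ : ∃ r, (b + (a - b)) ^ p = b ^ p + p * (a - b) * r + (a - b) ^ p := by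
    obtain ⟨r, hr⟩ := exists_add_pow_prime_eq hp.out b (a - b)
    exact ⟨b * r, by rw [hr]; ring⟩
  rw [show a ^ p - b ^ p = p * (a - b) * r + (a - b) ^ p by
    rw [add_sub_cancel] at hr; rw [hr]; ring]
  refine Ideal.add_mem _ (Ideal.mul_mem_right _ _ ?_) ?_
  · rw [pow_succ']; exact Ideal.mul_mem_mul hI hab
  · have h1 : (a - b) ^ p ∈ (I ^ m) ^ p := Ideal.pow_mem_pow hab p
    rw [← pow_mul] at h1
    exact Ideal.pow_le_pow_right (by nlinarith [hp.out.two_le]) h1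
lemma pow_congr' (hI : (p : S) ∈ I) {a b : S} (hab : a - b ∈ I) (n : ℕ) : a ^ p ^ n - b ^ p ^ n ∈ I ^ (n + 1) := by
  induction n with
  | zero => simpa using hab
  | succ n ih => rw [pow_succ p n, pow_mul, pow_mul]; exact pow_congr hI (by omega) ih
variable [CharP K p] [PerfectRing K p]
lemma th_compat (hh : ∀ n x, h (n + 1) x ^ p = h n x) (n : ℕ) :
    (Ideal.Quotient.factor (Ideal.pow_le_pow_right (Nat.le_succ (n + 1)))).comp (th I hI h (n + 1)) = th I hI h n := by
  apply eq_of_apply_teichmuller_eq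
  · refine ⟨n + 1, ?_⟩
    rw [← map_natCast (Ideal.Quotient.mk _), ← map_pow, Ideal.Quotient.eq_zero_iff_mem]
    exact Ideal.pow_mem_pow hI _
  · intro x
    obtain ⟨s, hs⟩ := Ideal.Quotient.mk_surjective (h n x)
    obtain ⟨s', hs'⟩ := Ideal.Quotient.mk_surjective (h (n + 1) x)
    rw [RingHom.comp_apply, th_te hs, th_te hs', Ideal.Quotient.factor_mk, Ideal.Quotient.eq, pow_succ' p n, pow_mul]
    refine pow_congr' hI ?_ n
    rw [← Ideal.Quotient.eq, map_pow, hs, hs', hh]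
lemma th_le (hh : ∀ n x, h (n + 1) x ^ p = h n x) {n : ℕ} {z : WittVector p K} {s : S}
    (hs : th I hI h (n + 1) z = Ideal.Quotient.mk _ s) : th I hI h n z = Ideal.Quotient.mk _ s := by
  rw [← th_compat hh n, RingHom.comp_apply, hs, Ideal.Quotient.factor_mk]
lemma th_zero {z : WittVector p K} {s : S} (hs : th I hI h 0 z = Ideal.Quotient.mk _ s) : h 0 (z.coeff 0) = Ideal.Quotient.mk I s := by
  obtain ⟨y, hy⟩ := map_surjective _ Ideal.Quotient.mk_surjective (map (h 0) z)
  rw [th_eq y hy, Ideal.Quotient.eq, ghost_eq] at hs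
  rw [← map_coeff, ← hy, map_coeff, Ideal.Quotient.eq]
  simpa using hs
def Rep (I : Ideal S) (hI : (p : S) ∈ I) (h : ℕ → K →+* S ⧸ I) (z : WittVector p K) (s : S) : Prop := ∀ n, th I hI h n z = Ideal.Quotient.mk _ s
lemma Rep.te {x : K} {s : ℕ → S} (hs : ∀ n, s (n + 1) ^ p = s n) (hx : ∀ n, h n x = Ideal.Quotient.mk I (s n)) :
    Rep I hI h (teichmuller p x) (s 0) := by
  intro n
  rw [th_te (hx n).symm]
  congr 1
  induction n with
  | zero => simp
  | succ n ih => rw [pow_succ', pow_mul, hs, ih]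
lemma Rep.map {S' K' : Type*} [CommRing S'] [CommRing K'] {I' : Ideal S'} {hI' : (p : S') ∈ I'}
    {h' : ℕ → K' →+* S' ⧸ I'} (c : S →+* S') (hc : I ≤ I'.comap c) (η : K →+* K')
    (hη : ∀ n x, h' n (η x) = Ideal.quotientMap I' c hc (h n x)) {z : WittVector p K} {s : S} (hz : Rep I hI h z s) :
    Rep I' hI' h' (WittVector.map η z) (c s) := by
  intro n
  obtain ⟨y, hy⟩ := map_surjective _ Ideal.Quotient.mk_surjective (WittVector.map (h n) z)
  have h1 := hz n
  rw [th_eq y hy, Ideal.Quotient.eq] at h1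
  rw [th_eq (WittVector.map c y), ghost_map, Ideal.Quotient.eq, ← map_sub]
  · have := Ideal.mem_map_of_mem c h1
    rw [Ideal.map_pow] at this
    exact Ideal.pow_right_mono (Ideal.map_le_iff_le_comap.mpr hc) _ this
  · ext i
    have := congrArg (fun w => Ideal.quotientMap I' c hc (w.coeff i)) hy
    simp only [map_coeff, Ideal.quotientMap_mk] at this
    simp only [map_coeff, this, hη]
lemma witt_lim (z : ℕ → WittVector p K) (hz : ∀ n, (p : WittVector p K) ^ n ∣ z (n + 1) - z n) :
    ∃ L, ∀ n, (p : WittVector p K) ^ n ∣ z n - L := by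
  have h1 : ∀ n k, (p : WittVector p K) ^ n ∣ z (n + k) - z n := by
    intro n k
    induction k with
    | zero => simp
    | succ k ih =>
      rw [show z (n + (k + 1)) - z n = (z (n + k + 1) - z (n + k)) + (z (n + k) - z n) by rw [add_assoc]; ring]
      exact dvd_add (dvd_trans (pow_dvd_pow _ (Nat.le_add_right _ _)) (hz _)) ih
  obtain ⟨L, hL⟩ := IsPrecomplete.prec (I := Ideal.span {(p : WittVector p K)}) (M := WittVector p K) inferInstance (f := z) (by
    intro m n hmn
    obtain ⟨k, rfl⟩ := Nat.exists_eq_add_of_le hmn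
    rw [SModEq.sub_mem, smul_eq_mul, Ideal.mul_top, Ideal.span_singleton_pow, Ideal.mem_span_singleton, dvd_sub_comm]
    exact h1 m k)
  refine ⟨L, fun n => ?_⟩
  have := hL n
  rwa [SModEq.sub_mem, smul_eq_mul, Ideal.mul_top, Ideal.span_singleton_pow, Ideal.mem_span_singleton] at this
lemma witt_haus {z : WittVector p K} (hz : ∀ n, (p : WittVector p K) ^ n ∣ z) : z = 0 := by
  refine IsHausdorff.haus (I := Ideal.span {(p : WittVector p K)}) (M := WittVector p K) inferInstance z fun n => ?_
  rw [SModEq.zero, smul_eq_mul, Ideal.mul_top, Ideal.span_singleton_pow, Ideal.mem_span_singleton]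
  exact hz n
end
section
open WittVector
variable {p : ℕ} [hp : Fact p.Prime] {S K : Type*} [CommRing S] [CommRing K] [CharP K p] [PerfectRing K p]
  {hI : (p : S) ∈ Ideal.span {(p : S)}} {h : ℕ → K →+* S ⧸ Ideal.span {(p : S)}}
lemma Rep.exists (hh : ∀ n x, h (n + 1) x ^ p = h n x) (hs : Function.Surjective (h 0)) (t : S) : ∃ z, Rep _ hI h z t := by
  have step : ∀ n (z : WittVector p K), th _ hI h n z = Ideal.Quotient.mk _ t → ∃ z', th _ hI h (n + 1) z' = Ideal.Quotient.mk _ t ∧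
      (p : WittVector p K) ^ (n + 1) ∣ z' - z := by
    intro n z hz
    obtain ⟨s, hs1⟩ := Ideal.Quotient.mk_surjective (th _ hI h (n + 1) z)
    have h1 := th_le hh hs1.symm
    rw [hz, Ideal.Quotient.eq, Ideal.span_singleton_pow, Ideal.mem_span_singleton] at h1
    obtain ⟨r, hr⟩ := h1
    obtain ⟨k, hk⟩ := hs (Ideal.Quotient.mk _ r)
    refine ⟨z + p ^ (n + 1) * teichmuller p k, ?_, by simp⟩
    obtain ⟨r', hr'⟩ := Ideal.Quotient.mk_surjective (th _ hI h (n + 1) (teichmuller p k))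
    have h2 : h 0 k = Ideal.Quotient.mk _ r' := by
      have h3 : ∀ m, th _ hI h m (teichmuller p k) = Ideal.Quotient.mk _ r' → th _ hI h 0 (teichmuller p k) = Ideal.Quotient.mk _ r' := by
        intro m
        induction m with
        | zero => exact id
        | succ m ih => exact fun h => ih (th_le hh h)
      have := th_zero (h3 _ hr'.symm)
      rwa [teichmuller_coeff_zero] at this
    rw [hk, Ideal.Quotient.eq, Ideal.mem_span_singleton] at h2
    obtain ⟨c, hc⟩ := h2
    rw [map_add, map_mul, map_pow, map_natCast, ← hs1, ← hr', ← map_natCast (Ideal.Quotient.mk _), ← map_pow, ← map_mul, ← map_add,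
      Ideal.Quotient.eq, Ideal.span_singleton_pow, Ideal.mem_span_singleton]
    exact ⟨-c, by linear_combination -hr - p ^ (n + 1) * hc⟩
  have h0 : ∃ z, th _ hI h 0 z = Ideal.Quotient.mk _ t := by
    obtain ⟨k, hk⟩ := hs (Ideal.Quotient.mk _ t)
    exact ⟨teichmuller p k, by rw [th_te hk.symm]; simp⟩
  choose F hF1 hF2 using step
  let z : (n : ℕ) → {z : WittVector p K // th _ hI h n z = Ideal.Quotient.mk _ t} :=
    fun n => Nat.rec ⟨h0.choose, h0.choose_spec⟩ (fun n z => ⟨F n z.1 z.2, hF1 n z.1 z.2⟩) n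
  obtain ⟨L, hL⟩ := witt_lim (fun n => (z n).1) (fun n => dvd_trans (pow_dvd_pow _ n.le_succ) (hF2 n (z n).1 (z n).2))
  refine ⟨L, fun n => ?_⟩
  obtain ⟨c, hc⟩ := hL (n + 1)
  have h1 := th_le hh (z (n + 1)).2
  have h2 := congrArg (th _ hI h n) hc
  rw [map_sub, h1, map_mul, map_pow, map_natCast, ← map_natCast (Ideal.Quotient.mk _), ← map_pow,
    Ideal.Quotient.eq_zero_iff_mem.mpr (Ideal.pow_mem_pow hI _), zero_mul, sub_eq_zero] at h2
  exact h2.symm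
lemma Rep.dvd (hh : ∀ n x, h (n + 1) x ^ p = h n x) (hS : ∀ s : S, (p : S) * s = 0 → s = 0) (ξ : WittVector p K)
    (hξ : Rep _ hI h ξ 0) (hk : ∀ x, h 0 x = 0 → ξ.coeff 0 ∣ x) {z : WittVector p K} (hz : Rep _ hI h z 0) : ξ ∣ z := by
  have step : ∀ z : WittVector p K, Rep _ hI h z 0 → ∃ v z', Rep _ hI h z' 0 ∧ z = ξ * v + p * z' := by
    intro z hz
    obtain ⟨c, hc⟩ := hk _ ((th_zero (hz 0)).trans (map_zero _))
    have h1 : z - ξ * teichmuller p c ∈ Ideal.span {(p : WittVector p K)} := by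
      rw [mem_span_p_iff_coeff_zero_eq_zero]
      change constantCoeff (z - ξ * teichmuller p c) = 0
      rw [map_sub, map_mul, constantCoeff_apply, constantCoeff_apply, constantCoeff_apply, teichmuller_coeff_zero, hc, sub_self]
    obtain ⟨z', hz'⟩ := Ideal.mem_span_singleton.mp h1
    refine ⟨teichmuller p c, z', fun n => ?_, by rw [← hz']; ring⟩
    obtain ⟨s, hs⟩ := Ideal.Quotient.mk_surjective (th _ hI h (n + 1) z')
    rw [th_le hh hs.symm, Ideal.Quotient.eq, sub_zero, Ideal.span_singleton_pow, Ideal.mem_span_singleton]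
    have h2 := congrArg (th _ hI h (n + 1)) hz'
    rw [map_sub, map_mul, hz, hξ, map_zero, map_mul, zero_mul, sub_zero, map_natCast, ← hs, ← map_natCast (Ideal.Quotient.mk _),
      ← map_mul, eq_comm, Ideal.Quotient.eq_zero_iff_mem, Ideal.span_singleton_pow, Ideal.mem_span_singleton] at h2
    obtain ⟨c, hc⟩ := h2
    refine ⟨c, ?_⟩
    rw [← sub_eq_zero]
    apply hS
    rw [mul_sub, hc]; ring
  choose V Z hZ hVZ using step
  let zz : ℕ → {z : WittVector p K // Rep _ hI h z 0} := fun n => Nat.rec ⟨z, hz⟩ (fun _ z => ⟨Z z.1 z.2, hZ z.1 z.2⟩) n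
  let w : ℕ → WittVector p K := fun n => ∑ i ∈ Finset.range n, p ^ i * V (zz i).1 (zz i).2
  have hw : ∀ n, z = ξ * w n + p ^ n * (zz n).1 := by
    intro n
    induction n with
    | zero => simp [w, zz]
    | succ n ih =>
      conv_lhs => rw [ih, hVZ (zz n).1 (zz n).2]
      have : w (n + 1) = w n + p ^ n * V (zz n).1 (zz n).2 := Finset.sum_range_succ _ _
      rw [this]
      change _ = _ + _ * (Z (zz n).1 (zz n).2)
      ring
  obtain ⟨L, hL⟩ := witt_lim w (fun n => ⟨V (zz n).1 (zz n).2, by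
    rw [show w (n + 1) = w n + p ^ n * V (zz n).1 (zz n).2 from Finset.sum_range_succ _ _]; ring⟩)
  refine ⟨L, ?_⟩
  rw [← sub_eq_zero]
  refine witt_haus fun n => ?_
  rw [show z - ξ * L = ξ * (w n - L) + p ^ n * (zz n).1 by linear_combination hw n]
  exact dvd_add (Dvd.dvd.mul_left (hL n) _) (dvd_mul_right _ _)
theorem kap (hh : ∀ n x, h (n + 1) x ^ p = h n x) (hs : Function.Surjective (h 0)) (hS : ∀ s : S, (p : S) * s = 0 → s = 0) (ξ : WittVector p K)
    (hξ : Rep _ hI h ξ 0) (hk : ∀ x, h 0 x = 0 → ξ.coeff 0 ∣ x) {E : Type*} [CommRing E] (Λ : WittVector p K →+* E) (hΛ : Λ ξ = 0) :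
    ∃ κ : S →+* E, ∀ z t, Rep _ hI h z t → κ t = Λ z := by
  choose Z hZ using Rep.exists (hI := hI) hh hs
  have hu : ∀ z t, Rep _ hI h z t → Λ (Z t) = Λ z := by
    intro z t hz
    obtain ⟨c, hc⟩ := Rep.dvd (hI := hI) hh hS ξ hξ hk (z := Z t - z) (fun n => by rw [map_sub, hZ, hz, sub_self, map_zero])
    rw [← sub_eq_zero, ← map_sub, hc, map_mul, hΛ, zero_mul]
  refine ⟨⟨⟨⟨fun t => Λ (Z t), ?_⟩, ?_⟩, ?_, ?_⟩, fun z t hz => hu z t hz⟩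
  · rw [hu 1 1 (fun n => by rw [map_one, map_one]), map_one]
  · intro a b
    change Λ (Z (a * b)) = Λ (Z a) * Λ (Z b)
    rw [hu (Z a * Z b) _ (fun n => by rw [map_mul, hZ, hZ, map_mul]), map_mul]
  · change Λ (Z 0) = 0
    rw [hu 0 0 (fun n => by rw [map_zero, map_zero]), map_zero]
  · intro a b
    change Λ (Z (a + b)) = Λ (Z a) + Λ (Z b)
    rw [hu (Z a + Z b) _ (fun n => by rw [map_add, hZ, hZ, map_add]), map_add]
end
end ACM
namespace ACM
section
open WittVector
variable {p : ℕ} [hp : Fact p.Prime] {T : Type*} [CommRing T] [IsDomain T] [CharP (T ⧸ Ideal.span {(p : T)}) p]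
lemma xi_dvd {K : Type*} [CommRing K] [CharP K p] {f x : K} (h : f ∣ x) : ((p : WittVector p K) - teichmuller p f).coeff 0 ∣ x := by
  have : ((p : WittVector p K) - teichmuller p f).coeff 0 = -f := by
    change constantCoeff ((p : WittVector p K) - teichmuller p f) = _
    rw [map_sub, map_natCast, CharP.cast_eq_zero, zero_sub, constantCoeff_apply, teichmuller_coeff_zero]
  rwa [this, neg_dvd]
def tlm (s : ℕ → T) (hs : ∀ n, s (n + 1) ^ p = s n) : Perfection (T ⧸ Ideal.span {(p : T)}) p :=
  ⟨fun n => Ideal.Quotient.mk _ (s n), fun n => by rw [← map_pow, hs]⟩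
lemma tlm_coeff (s : ℕ → T) (hs : ∀ n, s (n + 1) ^ p = s n) (n : ℕ) : Perfection.coeff _ p n (tlm s hs) = Ideal.Quotient.mk _ (s n) := rfl
lemma pow_root (s : ℕ → T) (hs : ∀ n, s (n + 1) ^ p = s n) (n m : ℕ) : s (n + m) ^ p ^ n = s m := by
  induction n with
  | zero => simp
  | succ n ih => rw [show n + 1 + m = n + m + 1 by ring, pow_succ', pow_mul, hs, ih]
lemma rt_tlm (s : ℕ → T) (hs : ∀ n, s (n + 1) ^ p = s n) (n : ℕ) : rt p n (tlm s hs) = tlm (fun m => s (n + m)) (fun m => hs (n + m)) := by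
  symm
  apply rt_unique
  refine Perfection.ext fun m => ?_
  rw [map_pow, tlm_coeff, tlm_coeff, ← map_pow, pow_root s hs]
lemma tilt_hk (hp0 : (p : T) ≠ 0) (hroot : ∀ {a b : T} {n : ℕ}, 0 < n → a ^ n ∣ b ^ n → a ∣ b) (pr : ℕ → T) (hpr0 : pr 0 = p)
    (hpr : ∀ n, pr (n + 1) ^ p = pr n) (x : Perfection (T ⧸ Ideal.span {(p : T)}) p) (hx : Perfection.coeff _ p 0 x = 0) :
    tlm pr hpr ∣ x := by
  choose s hs using fun n => Ideal.Quotient.mk_surjective (Perfection.coeff _ p n x)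
  have hpp : ∀ n, pr n ^ p ^ n = p := fun n => by have := pow_root pr hpr n 0; rwa [add_zero, hpr0] at this
  have hpn : ∀ n, pr n ≠ 0 := fun n h => hp0 (by rw [← hpp n, h, zero_pow (by have := hp.out.pos; positivity)])
  have h1 : ∀ n, pr n ∣ s n := by
    intro n
    apply hroot (n := p ^ n) (by have := hp.out.pos; positivity)
    rw [hpp, ← Ideal.mem_span_singleton, ← Ideal.Quotient.eq_zero_iff_mem, map_pow, hs, ← hx]
    exact Perfection.coeffMonoidHom_pow_p_pow_self x n
  choose r hr using h1
  have h2 : ∀ n, pr n ^ (p ^ n - 1) ∣ r (n + 1) ^ p - r n := by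
    intro n
    have : (p : T) ∣ s (n + 1) ^ p - s n := by
      rw [← Ideal.mem_span_singleton, ← Ideal.Quotient.eq, map_pow, hs, hs]
      exact x.2 n
    obtain ⟨c, hc⟩ := this
    refine ⟨c, mul_left_cancel₀ (hpn n) ?_⟩
    rw [← mul_assoc, ← pow_succ', Nat.sub_add_cancel (Nat.one_le_pow _ _ hp.out.pos), hpp, ← hc, hr, hr, mul_pow, hpr]
    ring
  have h3 : ∀ n, (p : T) ∣ (r (n + 2) ^ p) ^ p - r (n + 1) ^ p := by
    intro n
    obtain ⟨c, hc⟩ := h2 (n + 1)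
    have e : r (n + 2) ^ p = r (n + 1) + pr (n + 1) ^ (p ^ (n + 1) - 1) * c := by rw [← hc]; ring
    rw [e, ← Ideal.mem_span_singleton, ← Ideal.Quotient.eq, map_pow, map_add, add_pow_char, map_pow, ← map_pow, ← map_pow, add_eq_left,
      Ideal.Quotient.eq_zero_iff_mem, Ideal.mem_span_singleton, mul_pow, ← pow_mul]
    refine Dvd.dvd.mul_right ?_ _
    rw [← hpp (n + 1)]
    refine pow_dvd_pow _ ?_
    have := Nat.one_lt_pow (n := n + 1) (by omega) hp.out.one_lt
    have h2 := hp.out.two_le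
    zify [this.le]
    nlinarith
  let y : Perfection (T ⧸ Ideal.span {(p : T)}) p := ⟨fun n => Ideal.Quotient.mk _ (r (n + 1) ^ p), fun n => by
    rw [← map_pow, Ideal.Quotient.eq, Ideal.mem_span_singleton]; exact h3 n⟩
  refine ⟨y, ?_⟩
  · refine Perfection.ext fun n => ?_
    rw [map_mul, tlm_coeff]
    change _ = _ * Ideal.Quotient.mk _ _
    rw [← map_mul, ← hpr, ← mul_pow, ← hr, map_pow, hs]
    exact (x.2 n).symm
theorem tilt (hp0 : (p : T) ≠ 0) (hroot : ∀ {a b : T} {n : ℕ}, 0 < n → a ^ n ∣ b ^ n → a ∣ b) (pr : ℕ → T) (hpr0 : pr 0 = p)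
    (hpr : ∀ n, pr (n + 1) ^ p = pr n) (hF : ∀ a : T, ∃ b c, a - b ^ p = p * c) :
    ∃ κ : T →+* EE p (tlm pr hpr), (∀ z t, Rep (Ideal.span {(p : T)}) (Ideal.mem_span_singleton_self _) (Perfection.coeff _ p) z t →
      κ t = Ideal.Quotient.mk _ z) ∧ (∀ t, red p _ (κ t) = 0 → (p : T) ∣ t) ∧ Function.Surjective (fun t => red p _ (κ t)) ∧
      (∀ s hs, te p _ (tlm s hs) = κ (s 0)) := by
  have hs : Function.Surjective (Perfection.coeff (T ⧸ Ideal.span {(p : T)}) p 0) := by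
    apply Perfection.coeff_surjective
    intro a
    obtain ⟨a, rfl⟩ := Ideal.Quotient.mk_surjective a
    obtain ⟨b, c, h⟩ := hF a
    refine ⟨Ideal.Quotient.mk _ b, ?_⟩
    rw [frobenius_def, ← map_pow, eq_comm, Ideal.Quotient.eq, Ideal.mem_span_singleton]
    exact ⟨c, h⟩
  have hh : ∀ n x, Perfection.coeff (T ⧸ Ideal.span {(p : T)}) p (n + 1) x ^ p = Perfection.coeff _ p n x := fun n x => x.2 n
  have hte : ∀ s hs, Rep (p := p) (Ideal.span {(p : T)}) (Ideal.mem_span_singleton_self _) (Perfection.coeff _ p)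
      (teichmuller p (tlm s hs)) (s 0) := fun s hs => Rep.te hs (fun n => rfl)
  have hk0 := tilt_hk hp0 hroot pr hpr0 hpr
  obtain ⟨κ, hκ⟩ := kap (hI := Ideal.mem_span_singleton_self _) hh hs (fun s h => (mul_eq_zero.mp h).resolve_left hp0)
    ((p : WittVector p _) - teichmuller p (tlm pr hpr)) (fun n => by
      rw [map_sub, hte pr hpr n, hpr0, map_natCast, map_natCast, sub_self, map_zero])
    (fun x hx => xi_dvd (hk0 x hx)) (Ideal.Quotient.mk (Ideal.span {(p : WittVector p _) - teichmuller p (tlm pr hpr)}))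
    (Ideal.Quotient.eq_zero_iff_mem.mpr (Ideal.mem_span_singleton_self _))
  have hz : ∀ t, ∃ y, Perfection.coeff _ p 0 y = Ideal.Quotient.mk _ t ∧ red p _ (κ t) = Ideal.Quotient.mk _ y := by
    intro t
    obtain ⟨z, hz⟩ := Rep.exists (hI := Ideal.mem_span_singleton_self _) hh hs t
    exact ⟨z.coeff 0, th_zero (hz 0), by rw [hκ z t hz, red_mk]⟩
  refine ⟨κ, hκ, fun t ht => ?_, fun y => ?_, fun s hs => (hκ _ _ (hte s hs)).symm⟩
  · obtain ⟨y, h1, h2⟩ := hz t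
    rw [ht, eq_comm, Ideal.Quotient.eq_zero_iff_mem, Ideal.mem_span_singleton] at h2
    obtain ⟨c, rfl⟩ := h2
    rw [map_mul, tlm_coeff, hpr0, Ideal.Quotient.eq_zero_iff_mem.mpr (Ideal.mem_span_singleton_self _), zero_mul, eq_comm,
      Ideal.Quotient.eq_zero_iff_mem, Ideal.mem_span_singleton] at h1
    exact h1
  · obtain ⟨y, rfl⟩ := Ideal.Quotient.mk_surjective y
    obtain ⟨t, ht⟩ := Ideal.Quotient.mk_surjective (Perfection.coeff _ p 0 y)
    obtain ⟨y', h1, h2⟩ := hz t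
    refine ⟨t, ?_⟩
    change red p _ (κ t) = _
    rw [h2, Ideal.Quotient.eq, Ideal.mem_span_singleton]
    exact hk0 _ (by rw [map_sub, h1, ht, sub_self])
end
end ACM
namespace ACM
section
open WittVector
variable {p : ℕ} [hp : Fact p.Prime]
section
variable {P0 : Type*} [CommRing P0] [CharP P0 p] [PerfectRing P0 p]
noncomputable def fX (p : ℕ) [Fact p.Prime] (P0 : Type*) [CommRing P0] [CharP P0 p] : PerfectClosure (Polynomial P0) p := PerfectClosure.of _ p Polynomial.X
noncomputable def cX (p : ℕ) [Fact p.Prime] (P0 : Type*) [CommRing P0] [CharP P0 p] : P0 →+* PerfectClosure (Polynomial P0) p :=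
  (PerfectClosure.of _ p).comp Polynomial.C
lemma fX_nzd (b : PerfectClosure (Polynomial P0) p) (h : fX p P0 * b = 0) : b = 0 := by
  obtain ⟨m, hm⟩ := perfectClosure_mk_common (p := p) {()} (fun _ => b)
  obtain ⟨c, hc⟩ := hm m le_rfl () (by simp)
  have h1 : PerfectClosure.of _ p (Polynomial.X ^ p ^ m * c) = 0 := by
    rw [map_mul, map_pow, ← hc, ← mul_pow]
    change (fX p P0 * b) ^ _ = 0
    rw [h, zero_pow (by have := hp.out.pos; positivity)]
  obtain ⟨k, hk⟩ := perfectClosure_of_eq_zero h1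
  have h2 := hk k le_rfl
  rw [mul_pow, ← pow_mul] at h2
  have h3 : c ^ p ^ k = 0 := (Polynomial.monic_X_pow _).mul_right_eq_zero_iff.mp h2
  apply pow_inj (p := p) (m + k)
  rw [pow_add, pow_mul, hc, ← map_pow, h3, map_zero, zero_pow (mul_ne_zero (pow_ne_zero _ hp.out.ne_zero) (pow_ne_zero _ hp.out.ne_zero))]
lemma fX_nu [Nontrivial P0] : ¬ IsUnit (fX p P0) := by
  rintro h
  obtain ⟨b, hb⟩ := h.exists_right_inv
  obtain ⟨m, hm⟩ := perfectClosure_mk_common (p := p) {()} (fun _ => b)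
  obtain ⟨c, hc⟩ := hm m le_rfl () (by simp)
  have h1 : PerfectClosure.of _ p (Polynomial.X ^ p ^ m * c - 1) = 0 := by
    rw [map_sub, map_mul, map_pow, ← hc, ← mul_pow, map_one, sub_eq_zero]
    change (fX p P0 * b) ^ _ = 1
    rw [hb, one_pow]
  obtain ⟨k, hk⟩ := perfectClosure_of_eq_zero h1
  have h2 := congrArg (Polynomial.eval 0) (hk k le_rfl)
  have h0 : ∀ i, p ^ i ≠ 0 := fun i => pow_ne_zero _ hp.out.ne_zero
  rw [Polynomial.eval_pow, Polynomial.eval_sub, Polynomial.eval_mul, Polynomial.eval_pow, Polynomial.eval_X, zero_pow (h0 m), zero_mul,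
    Polynomial.eval_one, Polynomial.eval_zero, zero_sub] at h2
  exact ((isUnit_one.neg.pow _).ne_zero) h2
lemma reg_pc {J : Type} [Fintype J] (xr : P0) (x : J → P0)
    (h : ∀ u, xr * u ∈ Ideal.span (Set.range x) → u ∈ Ideal.span (Set.range x)) (u : PerfectClosure (Polynomial P0) p ⧸ Ideal.span {fX p P0})
    (hu : Ideal.Quotient.mk (Ideal.span {fX p P0}) (cX p P0 xr) * u ∈ Ideal.span (Set.range fun k => Ideal.Quotient.mk (Ideal.span {fX p P0}) (cX p P0 (x k)))) :
    u ∈ Ideal.span (Set.range fun k => Ideal.Quotient.mk (Ideal.span {fX p P0}) (cX p P0 (x k))) := by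
  obtain ⟨u, rfl⟩ := Ideal.Quotient.mk_surjective u
  rw [Ideal.mem_span_range_iff_exists_fun] at hu
  obtain ⟨v, hv⟩ := hu
  choose v' hv' using fun k => Ideal.Quotient.mk_surjective (v k)
  obtain rfl : (fun k => Ideal.Quotient.mk _ (v' k)) = v := funext hv'
  have h1 : fX p P0 ∣ cX p P0 xr * u - ∑ k, v' k * cX p P0 (x k) := by
    rw [← Ideal.mem_span_singleton, ← Ideal.Quotient.eq, map_mul, ← hv, map_sum]
    simp only [map_mul]
  obtain ⟨w, hw⟩ := h1
  obtain ⟨m0, hm0⟩ := perfectClosure_mk_common (p := p) Finset.univ (fun i : Option (Option J) => i.elim u (fun i => i.elim w v'))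
  obtain ⟨U, hU⟩ := hm0 m0 le_rfl none (by simp)
  obtain ⟨W, hW⟩ := hm0 m0 le_rfl (some none) (by simp)
  choose V hV using fun k => hm0 m0 le_rfl (some (some k)) (by simp)
  simp only [Option.elim] at hU hW hV
  have h2 : PerfectClosure.of _ p (Polynomial.C xr ^ p ^ m0 * U - ∑ k, V k * Polynomial.C (x k) ^ p ^ m0 - Polynomial.X ^ p ^ m0 * W) = 0 := by
    have := congrArg (· ^ p ^ m0) hw
    simp only [sub_pow_char_pow, sum_pow_char_pow, mul_pow, hU, hW, hV] at this
    rw [map_sub, map_sub, sub_eq_zero, map_sum]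
    simp only [map_mul, map_pow]
    exact this
  obtain ⟨k, hk⟩ := perfectClosure_of_eq_zero h2
  have h3 := hk k le_rfl
  rw [sub_pow_char_pow, sub_pow_char_pow, sum_pow_char_pow, mul_pow, mul_pow, ← pow_mul, ← pow_mul, ← pow_add] at h3
  simp only [mul_pow, ← pow_mul, ← pow_add] at h3
  set q := p ^ (m0 + k) with hq
  have h4 : ∀ l, l < q → ∃ b : J → P0, (U ^ p ^ k).coeff l = ∑ i, (b i) ^ q * x i ^ q := by
    intro l hl
    have h5 := congrArg (fun F => F.coeff l) h3
    simp only [Polynomial.coeff_sub, Polynomial.coeff_zero, Polynomial.finsetSum_coeff, ← Polynomial.C_pow, Polynomial.coeff_C_mul,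
      Polynomial.coeff_mul_C, Polynomial.coeff_X_pow_mul', if_neg (not_le.mpr hl), sub_zero, sub_eq_zero] at h5
    have h6 : xr * rt p (m0 + k) ((U ^ p ^ k).coeff l) ∈ Ideal.span (Set.range x) := by
      rw [Ideal.mem_span_range_iff_exists_fun]
      refine ⟨fun i => rt p (m0 + k) ((V i ^ p ^ k).coeff l), ?_⟩
      apply pow_inj (p := p) (m0 + k)
      rw [mul_pow, rt_pow, h5, sum_pow_char_pow]
      exact Finset.sum_congr rfl fun i _ => by rw [mul_pow, rt_pow]
    obtain ⟨b, hb⟩ := Ideal.mem_span_range_iff_exists_fun.mp (h _ h6)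
    refine ⟨b, ?_⟩
    rw [← rt_pow (p := p) (m0 + k) ((U ^ p ^ k).coeff l), ← hb, sum_pow_char_pow]
    exact Finset.sum_congr rfl fun i _ => by rw [mul_pow]
  choose! b hb using h4
  let Bp : J → Polynomial P0 := fun i => ∑ l ∈ Finset.range q, Polynomial.monomial l (b l i ^ q)
  have h7 : (Polynomial.X : Polynomial P0) ^ q ∣ U ^ p ^ k - ∑ i, Bp i * Polynomial.C (x i ^ q) := by
    rw [Polynomial.X_pow_dvd_iff]
    intro l hl
    rw [Polynomial.coeff_sub, hb l hl, Polynomial.finsetSum_coeff, sub_eq_zero]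
    refine Finset.sum_congr rfl fun i _ => ?_
    simp only [Bp, Polynomial.coeff_mul_C, Polynomial.finsetSum_coeff, Polynomial.coeff_monomial]
    rw [Finset.sum_ite_eq', if_pos (Finset.mem_range.mpr hl)]
  obtain ⟨W', hW'⟩ := h7
  rw [sub_eq_iff_eq_add'] at hW'
  have h8 : u = ∑ i, rt p (m0 + k) (PerfectClosure.of _ p (Bp i)) * cX p P0 (x i) + fX p P0 * rt p (m0 + k) (PerfectClosure.of _ p W') := by
    apply pow_inj (p := p) (m0 + k)
    conv_lhs => rw [pow_add, pow_mul, hU, ← map_pow, hW', map_add, map_mul, map_sum, map_pow]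
    rw [add_pow_char_pow, sum_pow_char_pow, mul_pow, rt_pow, ← hq]
    congr 1
    refine Finset.sum_congr rfl fun i _ => ?_
    rw [mul_pow, rt_pow, map_mul, ← map_pow]; rfl
  rw [h8, map_add, map_mul (Ideal.Quotient.mk _) (fX p P0), Ideal.Quotient.eq_zero_iff_mem.mpr (Ideal.mem_span_singleton_self _), zero_mul, add_zero, map_sum,
    Ideal.mem_span_range_iff_exists_fun]
  exact ⟨fun i => Ideal.Quotient.mk _ (rt p (m0 + k) (PerfectClosure.of _ p (Bp i))), Finset.sum_congr rfl fun i _ => (map_mul _ _ _).symm⟩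
end
theorem base.{u} {A C T : Type u} [CommRing A] [CommRing C] [CommRing T] [IsDomain T] [CharP (T ⧸ Ideal.span {(p : T)}) p]
    [CharP (C ⧸ Ideal.span {(p : C)}) p] [PerfectRing (C ⧸ Ideal.span {(p : C)}) p] (hC : ∀ s : C, (p : C) * s = 0 → s = 0)
    (aC : A →+* C) (c : C →+* T) (pr : ℕ → T) (hpr : ∀ n, pr (n + 1) ^ p = pr n) (κ : T →+* EE p (tlm pr hpr))
    (hκ : ∀ z t, Rep (Ideal.span {(p : T)}) (Ideal.mem_span_singleton_self _) (Perfection.coeff _ p) z t → κ t = Ideal.Quotient.mk _ z) :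
    ∃ (X : PObj.{u} p A) (η : X.P →+* Perfection (T ⧸ Ideal.span {(p : T)}) p) (hη : η X.f = tlm pr hpr),
      (∀ a, EEmap η hη (X.ι a) = κ (c (aC a))) ∧ ∀ {J : Type} [Fintype J] (xr : A) (x : J → A),
      (∀ u, Ideal.Quotient.mk (Ideal.span {(p : C)}) (aC xr) * u ∈ Ideal.span (Set.range fun k => Ideal.Quotient.mk (Ideal.span {(p : C)}) (aC (x k))) →
        u ∈ Ideal.span (Set.range fun k => Ideal.Quotient.mk (Ideal.span {(p : C)}) (aC (x k)))) →
      ∀ u, red p X.f (X.ι xr) * u ∈ Ideal.span (Set.range fun k => red p X.f (X.ι (x k))) →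
        u ∈ Ideal.span (Set.range fun k => red p X.f (X.ι (x k))) := by
  let P0 := C ⧸ Ideal.span {(p : C)}
  haveI : Nontrivial P0 := CharP.nontrivial_of_char_ne_one (v := p) hp.out.one_lt.ne'
  have hI : (p : C) ∈ Ideal.span {(p : C)} := Ideal.mem_span_singleton_self _
  let h : ℕ → P0 →+* C ⧸ Ideal.span {(p : C)} := fun n => (rt p n : P0 ≃+* P0).toRingHom
  have hh : ∀ n x, h (n + 1) x ^ p = h n x := fun n x => by
    have := rt_add_pow (p := p) n 1 x; rwa [pow_one] at this
  have hh0 : ∀ x, h 0 x = x := fun x => (rt_unique (by simp)).symm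
  have hs : Function.Surjective (h 0) := fun x => ⟨x, hh0 x⟩
  obtain ⟨κC, hκC⟩ := kap (hI := hI) hh hs hC 0 (fun n => by rw [map_zero, map_zero]) (fun x hx => by
    rw [hh0] at hx; rw [hx]; exact dvd_zero _) ((Ideal.Quotient.mk (Ideal.span {(p : WittVector p _) - teichmuller p (fX p P0)})).comp (map (cX p P0)))
    (map_zero _)
  have hcI : Ideal.span {(p : C)} ≤ (Ideal.span {(p : T)}).comap c := by
    rw [Ideal.span_singleton_le_iff_mem, Ideal.mem_comap, map_natCast]; exact Ideal.mem_span_singleton_self _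
  let cb : P0 →+* T ⧸ Ideal.span {(p : T)} := Ideal.quotientMap _ c hcI
  let η0 : P0 →+* Perfection (T ⧸ Ideal.span {(p : T)}) p := Perfection.lift p P0 _ cb
  have hη0 : ∀ x, Perfection.coeff _ p 0 (η0 x) = cb x := fun x =>
    DFunLike.congr_fun ((Perfection.lift p P0 (T ⧸ Ideal.span {(p : T)})).symm_apply_apply cb) x
  have hη1 : ∀ n x, Perfection.coeff _ p n (η0 x) = cb (h n x) := by
    intro n x
    rw [← hη0, ← Perfection.coeffMonoidHom_eq_coeff, ← Perfection.coeffMonoidHom_eq_coeff,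
      ← Perfection.coeffMonoidHom_pow_p_pow (η0 (h n x)) 0 n, ← map_pow, zero_add]
    congr 2
    exact (rt_pow n x).symm
  let η : PerfectClosure (Polynomial P0) p →+* Perfection (T ⧸ Ideal.span {(p : T)}) p :=
    PerfectClosure.lift (Polynomial P0) p _ (Polynomial.eval₂RingHom η0 (tlm pr hpr))
  have hηo : ∀ F, η (PerfectClosure.of _ p F) = Polynomial.eval₂ η0 (tlm pr hpr) F := fun F =>
    DFunLike.congr_fun ((PerfectClosure.lift (Polynomial P0) p _).symm_apply_apply (Polynomial.eval₂RingHom η0 (tlm pr hpr))) F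
  have hη : η (fX p P0) = tlm pr hpr := by rw [fX, hηo, Polynomial.eval₂_X]
  have hηc : η.comp (cX p P0) = η0 := RingHom.ext fun x => by
    rw [RingHom.comp_apply, cX, RingHom.comp_apply, hηo, Polynomial.eval₂_C]
  refine ⟨⟨_, fX p P0, fX_nzd, fX_nu, κC.comp aC⟩, η, hη, fun a => ?_, ?_⟩
  · obtain ⟨z, hz⟩ := Rep.exists (hI := hI) hh hs (aC a)
    change EEmap η hη (κC (aC a)) = _
    have e : map η0 z = map η (map (cX p P0) z) := by
      ext i
      rw [map_coeff, map_coeff, map_coeff, ← hηc, RingHom.comp_apply]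
    have hm : Rep (Ideal.span {(p : T)}) (Ideal.mem_span_singleton_self _) (Perfection.coeff _ p) (map η0 z) (c (aC a)) :=
      Rep.map (I := Ideal.span {(p : C)}) (hI := hI) (h := h) (z := z) (s := aC a) (K := P0) (h' := Perfection.coeff (T ⧸ Ideal.span {(p : T)}) p) c hcI η0 hη1 hz
    rw [hκ _ _ hm, e]
    rw [hκC z _ hz]
    rfl
  · intro J _ xr x hx
    have hr : ∀ a, red p (fX p P0) (κC (aC a)) = Ideal.Quotient.mk _ (cX p P0 (Ideal.Quotient.mk _ (aC a))) := by
      intro a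
      obtain ⟨z, hz⟩ := Rep.exists (hI := hI) hh hs (aC a)
      rw [hκC z _ hz, RingHom.comp_apply, red_mk, map_coeff, ← th_zero (hz 0), hh0]
    intro u hu
    change red p (fX p P0) (κC (aC xr)) * u ∈ Ideal.span (Set.range fun k => red p (fX p P0) (κC (aC (x k)))) at hu
    change u ∈ Ideal.span (Set.range fun k => red p (fX p P0) (κC (aC (x k))))
    simp only [hr] at hu ⊢
    exact reg_pc _ _ hx u hu
end
end ACM
namespace ACM
section
variable {p : ℕ} [hp : Fact p.Prime]
structure CD (p : ℕ) (A σ : Type*) [CommRing A] where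
  φ : A →+* A
  X : σ → A
  inj : Function.Injective φ
  φX : ∀ i, φ (X i) = X i ^ p
  gen : ∀ a, a ∈ Subring.closure (Set.range φ ∪ Set.range X)
  frob : ∀ a, (p : A) ∣ φ a - a ^ p
  red : ∀ a, (p : A) ∣ a ^ p → (p : A) ∣ a
  nu : ¬ IsUnit (p : A)
  reg : ∀ (q : ℕ) (r : σ) (J : Finset σ), r ∉ J → ∀ (a : A) (b : σ → A) (e : A), X r ^ q * a = ∑ j ∈ J, b j * X j ^ q + p * e →
    ∃ (b' : σ → A) (e' : A), a = ∑ j ∈ J, b' j * X j ^ q + p * e'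
lemma ext_int {A B Ω : Type*} [CommRing A] [CommRing B] [IsDomain A] [IsDomain B] [Field Ω] [IsAlgClosed Ω] (φ : A →+* B)
    (hφ : Function.Injective φ) (hi : φ.IsIntegral) (f : A →+* Ω) (hf : Function.Injective f) :
    ∃ f' : B →+* Ω, f'.comp φ = f ∧ Function.Injective f' := by
  letI := φ.toAlgebra
  letI := f.toAlgebra
  haveI : FaithfulSMul A B := (faithfulSMul_iff_algebraMap_injective A B).mpr hφ
  haveI : FaithfulSMul A Ω := (faithfulSMul_iff_algebraMap_injective A Ω).mpr hf
  haveI : Algebra.IsIntegral A B := ⟨hi⟩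
  let f' : B →ₐ[A] Ω := IsAlgClosed.lift
  refine ⟨f'.toRingHom, f'.comp_algebraMap, ?_⟩
  rw [RingHom.injective_iff_ker_eq_bot]
  apply Ideal.eq_bot_of_comap_eq_bot (R := A)
  rw [eq_bot_iff]
  intro a ha
  rw [Ideal.mem_bot]
  apply hf
  rw [map_zero]
  exact (f'.commutes a).symm.trans ha
variable {A σ Ω : Type*} [CommRing A] [IsDomain A] [Field Ω] [IsAlgClosed Ω] (D : CD p A σ)
lemma CD.int : D.φ.IsIntegral := by
  intro a
  letI := D.φ.toAlgebra
  have : Subring.closure (Set.range D.φ ∪ Set.range D.X) ≤ (integralClosure A A).toSubring := by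
    rw [Subring.closure_le]
    rintro _ (⟨b, rfl⟩ | ⟨i, rfl⟩)
    · exact D.φ.isIntegralElem_map
    · exact ⟨Polynomial.X ^ p - Polynomial.C (D.X i), Polynomial.monic_X_pow_sub_C _ hp.out.ne_zero, by
        rw [Polynomial.eval₂_sub, Polynomial.eval₂_pow, Polynomial.eval₂_X, Polynomial.eval₂_C]
        exact sub_eq_zero.mpr (D.φX i).symm⟩
  exact this (D.gen a)
structure PT (D : CD p A σ) (Ω : Type*) [Field Ω] where
  ψ : ℕ → A →+* Ω
  ψi : ∀ n, Function.Injective (ψ n)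
  comm : ∀ n a, ψ (n + 1) (D.φ a) = ψ n a
lemma CD.exists_PT (j0 : A →+* Ω) (hj : Function.Injective j0) : ∃ P : PT D Ω, P.ψ 0 = j0 := by
  choose F hF1 hF2 using fun (f : {f : A →+* Ω // Function.Injective f}) => ext_int D.φ D.inj D.int f.1 f.2
  let s : ℕ → {f : A →+* Ω // Function.Injective f} := fun n => Nat.rec ⟨j0, hj⟩ (fun _ f => ⟨F f, hF2 f⟩) n
  exact ⟨⟨fun n => (s n).1, fun n => (s n).2, fun n a => RingHom.congr_fun (hF1 (s n)) a⟩, rfl⟩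
namespace PT
variable {D} (P : PT D Ω)
lemma up (n k : ℕ) (a : A) : ∃ b, P.ψ (n + k) b = P.ψ n a := by
  induction k with
  | zero => exact ⟨a, rfl⟩
  | succ k ih => obtain ⟨b, hb⟩ := ih; exact ⟨D.φ b, by rw [← add_assoc, P.comm, hb]⟩
lemma upX (n : ℕ) (i : σ) : P.ψ n (D.X i ^ p ^ n) = P.ψ 0 (D.X i) := by
  induction n with
  | zero => simp
  | succ n ih => rw [pow_succ', pow_mul, ← D.φX, ← map_pow, P.comm, ih]
lemma up' {n m : ℕ} (h : n ≤ m) (a : A) : ∃ b, P.ψ m b = P.ψ n a := by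
  obtain ⟨k, rfl⟩ := Nat.exists_eq_add_of_le h; exact P.up n k a
def C : Subring Ω where
  carrier := {z | ∃ n a, P.ψ n a = z}
  zero_mem' := ⟨0, 0, map_zero _⟩
  one_mem' := ⟨0, 1, map_one _⟩
  neg_mem' := by rintro _ ⟨n, a, rfl⟩; exact ⟨n, -a, map_neg _ _⟩
  add_mem' := by
    rintro _ _ ⟨n, a, rfl⟩ ⟨m, b, rfl⟩
    obtain ⟨a', ha⟩ := P.up' (le_max_left n m) a
    obtain ⟨b', hb⟩ := P.up' (le_max_right n m) b
    exact ⟨_, a' + b', by rw [map_add, ha, hb]⟩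
  mul_mem' := by
    rintro _ _ ⟨n, a, rfl⟩ ⟨m, b, rfl⟩
    obtain ⟨a', ha⟩ := P.up' (le_max_left n m) a
    obtain ⟨b', hb⟩ := P.up' (le_max_right n m) b
    exact ⟨_, a' * b', by rw [map_mul, ha, hb]⟩
def ψC (n : ℕ) : A →+* P.C := (P.ψ n).codRestrict P.C fun a => ⟨n, a, rfl⟩
lemma ψC_inj (n : ℕ) : Function.Injective (P.ψC n) := fun _ _ h => P.ψi n (congrArg Subtype.val h)
lemma common (s : Finset P.C) : ∃ n0, ∀ z ∈ s, ∃ a, P.ψC n0 a = z := by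
  have h : ∀ z : P.C, ∃ n a, P.ψC n a = z := fun z => by
    obtain ⟨n, a, h⟩ := z.2; exact ⟨n, a, Subtype.ext h⟩
  choose n a ha using h
  refine ⟨s.sup n, fun z hz => ?_⟩
  obtain ⟨b, hb⟩ := P.up' (Finset.le_sup (f := n) hz) (a z)
  exact ⟨b, Subtype.ext (hb.trans (congrArg Subtype.val (ha z)))⟩
lemma upXC (n : ℕ) (i : σ) : P.ψC n (D.X i ^ p ^ n) = P.ψC 0 (D.X i) := Subtype.ext (P.upX n i)
lemma C_charP : CharP (P.C ⧸ Ideal.span {(p : P.C)}) p := by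
  have hn : Ideal.span {(p : P.C)} ≠ ⊤ := by
    intro h
    obtain ⟨z, hz⟩ := (Ideal.span_singleton_eq_top.mp h).exists_right_inv
    obtain ⟨n, hn⟩ := P.common {z}
    obtain ⟨a, rfl⟩ := hn z (by simp)
    apply D.nu
    refine IsUnit.of_mul_eq_one a (P.ψC_inj n ?_)
    rw [map_mul, map_natCast, hz, map_one]
  haveI := Ideal.Quotient.nontrivial_iff.mpr hn
  rw [CharP.charP_iff_prime_eq_zero hp.out, ← map_natCast (Ideal.Quotient.mk _), Ideal.Quotient.eq_zero_iff_mem]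
  exact Ideal.mem_span_singleton_self _
lemma C_perfect [CharP (P.C ⧸ Ideal.span {(p : P.C)}) p] : PerfectRing (P.C ⧸ Ideal.span {(p : P.C)}) p := by
  constructor
  constructor
  · change Function.Injective (frobenius (P.C ⧸ Ideal.span {(p : P.C)}) p)
    rw [injective_iff_map_eq_zero]
    intro x hx
    obtain ⟨z, rfl⟩ := Ideal.Quotient.mk_surjective x
    rw [frobenius_def, ← map_pow, Ideal.Quotient.eq_zero_iff_mem, Ideal.mem_span_singleton] at hx
    obtain ⟨w, hw⟩ := hx
    classical
    obtain ⟨n, hn⟩ := P.common {z, w}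
    obtain ⟨a, rfl⟩ := hn z (by simp)
    obtain ⟨b, rfl⟩ := hn w (by simp)
    rw [Ideal.Quotient.eq_zero_iff_mem, Ideal.mem_span_singleton]
    obtain ⟨c, hc⟩ := D.red a ⟨b, P.ψC_inj n (by rw [map_pow, hw, map_mul, map_natCast])⟩
    exact ⟨P.ψC n c, by rw [hc, map_mul, map_natCast]⟩
  · intro x
    obtain ⟨z, rfl⟩ := Ideal.Quotient.mk_surjective x
    obtain ⟨n, hn⟩ := P.common {z}
    obtain ⟨a, rfl⟩ := hn z (by simp)
    obtain ⟨c, hc⟩ := D.frob a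
    refine ⟨Ideal.Quotient.mk _ (P.ψC (n + 1) a), ?_⟩
    change _ ^ p = _
    rw [← map_pow, eq_comm, Ideal.Quotient.eq, Ideal.mem_span_singleton]
    refine ⟨P.ψC (n + 1) c, ?_⟩
    have : P.ψC n a = P.ψC (n + 1) (D.φ a) := Subtype.ext (P.comm n a).symm
    rw [this, ← map_pow, ← map_sub, hc, map_mul, map_natCast]
lemma C_reg (r : σ) (J : Finset σ) (hr : r ∉ J) (u : P.C ⧸ Ideal.span {(p : P.C)})
    (hu : Ideal.Quotient.mk (Ideal.span {(p : P.C)}) (P.ψC 0 (D.X r)) * u ∈ Ideal.span (Set.range fun k : J => Ideal.Quotient.mk (Ideal.span {(p : P.C)}) (P.ψC 0 (D.X k)))) :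
    u ∈ Ideal.span (Set.range fun k : J => Ideal.Quotient.mk (Ideal.span {(p : P.C)}) (P.ψC 0 (D.X k))) := by
  classical
  obtain ⟨z, rfl⟩ := Ideal.Quotient.mk_surjective u
  rw [Ideal.mem_span_range_iff_exists_fun] at hu ⊢
  obtain ⟨v, hv⟩ := hu
  choose v' hv' using fun k => Ideal.Quotient.mk_surjective (v k)
  have h1 : (p : P.C) ∣ P.ψC 0 (D.X r) * z - ∑ k : J, v' k * P.ψC 0 (D.X k) := by
    rw [← Ideal.mem_span_singleton, ← Ideal.Quotient.eq, map_mul, ← hv, map_sum]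
    exact Finset.sum_congr rfl fun k _ => by rw [map_mul, hv']
  obtain ⟨w, hw⟩ := h1
  obtain ⟨n, hn⟩ := P.common ({z, w} ∪ Finset.univ.image v')
  obtain ⟨a, rfl⟩ := hn z (by simp)
  obtain ⟨e, rfl⟩ := hn w (by simp)
  choose b hb using fun k => hn (v' k) (by simp)
  have key : D.X r ^ p ^ n * a = ∑ j ∈ J, (if h : j ∈ J then b ⟨j, h⟩ else 0) * D.X j ^ p ^ n + p * e := by
    apply P.ψC_inj n
    rw [map_mul, P.upXC, map_add, map_mul, map_natCast, ← hw, map_sum, ← Finset.sum_coe_sort J]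
    rw [Finset.sum_congr rfl (g := fun k : J => v' k * P.ψC 0 (D.X k)) fun k _ => by
      rw [dif_pos k.2, map_mul, P.upXC, hb]]
    ring
  obtain ⟨b', e', h2⟩ := D.reg _ r J hr a _ e key
  refine ⟨fun k => Ideal.Quotient.mk _ (P.ψC n (b' k)), ?_⟩
  rw [h2, map_add, map_mul, map_natCast, map_add, map_mul (Ideal.Quotient.mk _) (p : P.C), Ideal.Quotient.eq_zero_iff_mem.mpr (Ideal.mem_span_singleton_self _), zero_mul,
    add_zero, map_sum, map_sum, ← Finset.sum_coe_sort J]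
  exact Finset.sum_congr rfl fun k _ => by rw [map_mul, map_mul, P.upXC]
end PT
end
end ACM
/-! ## The choice of the element `g` -/
namespace ACM
open Polynomial
lemma bez {A : Type*} [CommRing A] [IsDomain A] [CharZero A] [IsIntegrallyClosed A] {Ω : Type*} [Field Ω] [Algebra A Ω]
    [FaithfulSMul A Ω] {r : Ω} (hr : IsIntegral A r) : ∃ (c : A) (μ u v : A[X]), c ≠ 0 ∧ μ.Monic ∧ aeval r μ = 0 ∧
      u * μ + v * derivative μ = C c := by
  letI : Algebra (FractionRing A) Ω := FractionRing.liftAlgebra A Ω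
  haveI : IsScalarTower A (FractionRing A) Ω := FractionRing.isScalarTower_liftAlgebra A Ω
  let K := FractionRing A
  have hs : (minpoly K r).Separable := (minpoly.irreducible hr.tower_top).separable
  have he := minpoly.isIntegrallyClosed_eq_field_fractions K Ω hr
  rw [Algebra.algebraMap_self_apply] at he
  rw [he] at hs
  obtain ⟨a, b, hab⟩ := hs
  obtain ⟨s, hs, hs'⟩ := IsLocalization.integerNormalization_spec (nonZeroDivisors A) a
  obtain ⟨t, ht, ht'⟩ := IsLocalization.integerNormalization_spec (nonZeroDivisors A) b
  refine ⟨s * t, minpoly A r, C t * IsLocalization.integerNormalization (nonZeroDivisors A) a,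
    C s * IsLocalization.integerNormalization (nonZeroDivisors A) b, nonZeroDivisors.ne_zero (mul_mem hs ht), minpoly.monic hr, minpoly.aeval _ _,
    map_injective (algebraMap A K) (IsFractionRing.injective A K) ?_⟩
  rw [Polynomial.map_add, Polynomial.map_mul, Polynomial.map_mul, Polynomial.map_mul, Polynomial.map_mul, hs', ht', ← derivative_map, map_C, map_C, map_C,
    algebra_compatible_smul K s, algebra_compatible_smul K t, smul_eq_C_mul, smul_eq_C_mul, map_mul, C_mul]
  linear_combination (C (algebraMap A K s) * C (algebraMap A K t)) * hab
variable {Ω : Type*} [Field Ω]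
lemma locS_nrm {A : Type*} [CommRing A] [IsDomain A] [IsIntegrallyClosed A] (j : A →+* Ω) (hj : Function.Injective j) (c : A)
    (hc : c ≠ 0) : Nrm (locS j.range (j c) ⟨c, rfl⟩) := by
  rw [← nrm_iff]
  let S := locS j.range (j c) ⟨c, rfl⟩
  letI : Algebra A S := (j.codRestrict S fun a => le_locS _ ⟨a, rfl⟩).toAlgebra
  have hm : ∀ a, ((algebraMap A S a : S) : Ω) = j a := fun a => rfl
  have h0 : j c ≠ 0 := (map_ne_zero_iff j hj).mpr hc
  haveI : IsLocalization.Away c S := by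
    refine ⟨⟨?_, ?_, ?_⟩⟩
    · rintro ⟨_, n, rfl⟩
      rw [map_pow]
      refine IsUnit.pow n (.of_mul_eq_one ⟨(j c)⁻¹, inv_mem_locS _⟩ (Subtype.ext ?_))
      exact mul_inv_cancel₀ h0
    · rintro ⟨z, n, a, ha⟩
      refine ⟨(a, ⟨c ^ n, n, rfl⟩), Subtype.ext ?_⟩
      change z * j (c ^ n) = j a
      rw [map_pow, ha]
    · intro a b h
      exact ⟨1, by rw [hj (congrArg Subtype.val h)]⟩
  exact isIntegrallyClosed_of_isLocalization S (Submonoid.powers c) (powers_le_nonZeroDivisors_of_noZeroDivisors hc)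
lemma tow_adj {B0 : Subring Ω} (h0 : Nrm B0) (s : Finset Ω) (hs : ∀ r ∈ s, ∃ μ : B0[X], μ.Monic ∧ μ.Separable ∧ aeval r μ = 0) :
    ∃ B, Tow B0 B ∧ ∀ C : Subring Ω, B ≤ C ↔ B0 ≤ C ∧ ∀ r ∈ s, r ∈ C := by
  classical
  induction s using Finset.induction_on with
  | empty => exact ⟨B0, Tow.base, by simp⟩
  | insert a s ha ih =>
    obtain ⟨B, hB, ih⟩ := ih fun r hr => hs r (Finset.mem_insert_of_mem hr)
    obtain ⟨μ, h1, h2, h3⟩ := hs a (Finset.mem_insert_self _ _)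
    have := step_exists (hB.nrm h0) a (μ.map (Subring.inclusion hB.le)) (h1.map _) (h2.map) (by
      rw [aeval_def, eval₂_map]; exact h3)
    refine ⟨_, Tow.step hB this, fun C => ?_⟩
    rw [Finset.forall_mem_insert, and_left_comm, ← ih]
    refine ⟨fun h => ⟨h (mem_adj.mpr ⟨X, aeval_X a⟩), fun b hb => h (mem_adj.mpr ⟨Polynomial.C ⟨b, hb⟩, aeval_C _ _⟩)⟩, ?_⟩
    rintro ⟨ha, hb⟩ z hz
    obtain ⟨q, rfl⟩ := mem_adj.mp hz
    rw [aeval_eq_sum_range]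
    exact Subring.sum_mem _ fun i _ => Subring.mul_mem _ (hb (q.coeff i).2) (Subring.pow_mem _ ha i)
lemma gchoice {A R : Type*} [CommRing A] [IsDomain A] [CharZero A] [IsIntegrallyClosed A] [CommRing R] [Algebra R Ω]
    (ψ : A →+* R) (hf : ψ.Finite) (hj : Function.Injective ((algebraMap R Ω).comp ψ)) (e : A) (he : e ≠ 0) :
    ∃ g : A, g ≠ 0 ∧ e ∣ g ∧ ∀ c, c ≠ 0 → g ∣ c →
      ∃ B0 Rg : Subring Ω, Nrm B0 ∧ Tow B0 Rg ∧ (∀ z, z ∈ B0 ↔ ∃ (n : ℕ) (a : A), z * (algebraMap R Ω (ψ c)) ^ n = algebraMap R Ω (ψ a)) ∧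
        ∀ z, z ∈ Rg ↔ ∃ (n : ℕ) (a : R), z * (algebraMap R Ω (ψ c)) ^ n = algebraMap R Ω a := by
  classical
  letI := ψ.toAlgebra
  letI : Algebra A Ω := ((algebraMap R Ω).comp ψ).toAlgebra
  haveI : IsScalarTower A R Ω := IsScalarTower.of_algebraMap_eq fun _ => rfl
  haveI : FaithfulSMul A Ω := (faithfulSMul_iff_algebraMap_injective A Ω).mpr hj
  haveI : Module.Finite A R := hf
  obtain ⟨s, hs⟩ := Module.Finite.fg_top (R := A) (M := R)
  choose d μ u v hd h1 h2 h3 using fun r : R => bez (A := A) (Ω := Ω) ((Algebra.IsIntegral.isIntegral (R := A) r).algebraMap (B := Ω))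
  refine ⟨e * ∏ r ∈ s, d r, mul_ne_zero he (Finset.prod_ne_zero_iff.mpr fun r _ => hd r), Dvd.intro _ rfl, fun c hc hg => ?_⟩
  have hj0 : algebraMap R Ω (ψ c) ≠ 0 := (map_ne_zero_iff _ hj).mpr hc
  let B0 := locS ((algebraMap R Ω).comp ψ).range (algebraMap R Ω (ψ c)) ⟨c, rfl⟩
  let i : A →+* B0 := (algebraMap A Ω).codRestrict B0 fun a => le_locS _ ⟨a, rfl⟩
  have h0 : Nrm B0 := locS_nrm _ hj c hc
  have hcu : IsUnit (i c) := .of_mul_eq_one ⟨_, inv_mem_locS _⟩ (Subtype.ext (mul_inv_cancel₀ hj0))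
  obtain ⟨B, hB, hle⟩ := tow_adj h0 (s.image (algebraMap R Ω)) (by
    intro r hr'
    obtain ⟨r, hr, rfl⟩ := Finset.mem_image.mp hr'
    refine ⟨(μ r).map i, (h1 r).map _, ?_, ?_⟩
    · have hu : IsUnit (C (i (d r))) := isUnit_C.mpr (isUnit_of_dvd_unit (map_dvd i
        (((Finset.dvd_prod_of_mem d hr).trans (Dvd.intro_left _ rfl)).trans hg)) hcu)
      obtain ⟨w, hw⟩ := hu.exists_left_inv
      refine ⟨w * (u r).map i, w * (v r).map i, ?_⟩
      have := congrArg (Polynomial.map i) (h3 r)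
      rw [Polynomial.map_add, Polynomial.map_mul, Polynomial.map_mul, map_C, ← derivative_map] at this
      rw [← hw, ← this]; ring
    · rw [aeval_def, eval₂_map]; exact h2 r)
  obtain ⟨hb1, hb2⟩ := (hle B).mp le_rfl
  refine ⟨B0, B, h0, hB, fun z => ⟨?_, ?_⟩, fun z => ⟨?_, ?_⟩⟩
  · rintro ⟨n, a, h⟩; exact ⟨n, a, h.symm⟩
  · rintro ⟨n, a, h⟩; exact ⟨n, a, h.symm⟩
  · intro hz
    have := (hle (locS (algebraMap R Ω).range (algebraMap R Ω (ψ c)) ⟨_, rfl⟩)).mpr ⟨?_, ?_⟩ hz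
    · obtain ⟨n, a, h⟩ := this; exact ⟨n, a, h.symm⟩
    · rintro z ⟨n, a, h⟩; exact ⟨n, ψ a, h⟩
    · intro r hr
      obtain ⟨r, -, rfl⟩ := Finset.mem_image.mp hr
      exact le_locS _ ⟨r, rfl⟩
  · rintro ⟨n, a, h⟩
    have ha : algebraMap R Ω a ∈ B := by
      clear h
      have : a ∈ Submodule.span A (s : Set R) := by rw [hs]; trivial
      induction this using Submodule.span_induction with
      | mem x hx => exact hb2 _ (Finset.mem_image_of_mem _ hx)
      | zero => rw [map_zero]; exact B.zero_mem
      | add x y _ _ hx hy => rw [map_add]; exact B.add_mem hx hy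
      | smul b x _ hx =>
        rw [Algebra.smul_def, map_mul]; exact B.mul_mem (hb1 (i b).2) hx
    rw [← mul_inv_cancel_right₀ (pow_ne_zero n hj0) z, h, ← inv_pow]
    exact B.mul_mem ha (B.pow_mem (hb1 (inv_mem_locS _)) n)
end ACM
/-! ## The almost Cohen-Macaulay property -/
namespace ACM
open Polynomial
universe u
variable {p : ℕ} [hp : Fact p.Prime] {A R Ω : Type u} [CommRing A] [IsDomain A] [CommRing R] [IsDomain R] [IsLocalRing R]
  [CharZero R] [Field Ω] [IsAlgClosed Ω] [Algebra R Ω] (E : TData R Ω)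
lemma TData.inv_U {a : R} (h : a ∣ E.c) : algebraMap R Ω a ≠ 0 ∧ (algebraMap R Ω a)⁻¹ ∈ UU E.Rg E.h0 := by
  obtain ⟨b, hb⟩ := h
  have h0 := E.c0
  have h1 := E.cinv
  rw [hb, map_mul] at h0 h1
  refine ⟨left_ne_zero_of_mul h0, ?_⟩
  have := Subring.mul_mem _ h1 (le_UU Tow.base ((E.hRg (algebraMap R Ω b)).mpr ⟨0, b, by simp⟩))
  rwa [mul_inv, mul_assoc, inv_mul_cancel₀ (right_ne_zero_of_mul h0), mul_one] at this
lemma TData.ext (B : Subring Ω) (hB : B ≤ UU E.Rg E.h0) {𝓔 : Type*} [CommRing 𝓔] (ω : E.T →+* 𝓔) (h : IsUnit (ω (algebraMap R E.T E.c))) :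
    ∃ α : B →+* 𝓔, ∀ (b : B) (t : E.T), (b : Ω) = t → α b = ω t := by
  let U := UU E.Rg E.h0
  letI : Algebra E.T U := (E.T.val.toRingHom.codRestrict U fun t => t.2.1).toAlgebra
  haveI : IsLocalization.Away (algebraMap R E.T E.c) U := by
    refine ⟨⟨?_, ?_, ?_⟩⟩
    · rintro ⟨_, n, rfl⟩
      rw [map_pow]
      exact IsUnit.pow n (.of_mul_eq_one ⟨_, E.cinv⟩ (Subtype.ext (mul_inv_cancel₀ E.c0)))
    · rintro ⟨z, hz⟩
      obtain ⟨n, hn⟩ := (E.U_iff z).mp hz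
      refine ⟨(⟨_, hn⟩, ⟨_, n, rfl⟩), Subtype.ext ?_⟩
      change z * ((algebraMap R E.T E.c ^ n : E.T) : Ω) = _
      rw [SubmonoidClass.coe_pow]; rfl
    · intro a b h
      exact ⟨1, by rw [show a = b from Subtype.ext (congrArg (Subtype.val (p := fun z => z ∈ U)) h)]⟩
  refine ⟨(IsLocalization.Away.lift (algebraMap R E.T E.c) h).comp (Subring.inclusion hB), fun b t hb => ?_⟩
  rw [RingHom.comp_apply, show Subring.inclusion hB b = algebraMap E.T U t from Subtype.ext hb, IsLocalization.Away.lift_eq]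
lemma PT_mem {σ : Type*} {D : CD p A σ} (P : PT D Ω) (hpU : (p : Ω)⁻¹ ∈ UU E.Rg E.h0) (hp0 : (p : Ω) ≠ 0) (ψ : A →+* R)
    (hP : ∀ a, P.ψ 0 a = algebraMap R Ω (ψ a)) (hX : ∀ i, ψ (D.X i) ∣ E.c) (n : ℕ) :
    (∀ a, P.ψ n a ∈ E.T) ∧ ∀ i, P.ψ n (D.X i) ≠ 0 ∧ (P.ψ n (D.X i))⁻¹ ∈ UU E.Rg E.h0 := by
  induction n with
  | zero => exact ⟨fun a => by rw [hP]; exact E.T.algebraMap_mem _, fun i => by rw [hP]; exact E.inv_U (hX i)⟩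
  | succ n ih =>
    have hx : ∀ i, P.ψ (n + 1) (D.X i) ^ p = P.ψ n (D.X i) := fun i => by rw [← map_pow, ← D.φX, P.comm]
    have h := fun i => E.U_root p hpU hp0 (ih.1 (D.X i)).1 (ih.2 i).1 (ih.2 i).2 (hx i)
    refine ⟨fun a => ?_, fun i => (h i).2⟩
    have : Subring.closure (Set.range D.φ ∪ Set.range D.X) ≤ E.T.toSubring.comap (P.ψ (n + 1)) := by
      rw [Subring.closure_le]
      rintro _ (⟨b, rfl⟩ | ⟨i, rfl⟩)
      · change P.ψ (n + 1) (D.φ b) ∈ E.T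
        rw [P.comm]; exact ih.1 b
      · exact ⟨(h i).1, IsIntegral.of_pow hp.out.pos (by rw [hx]; exact (ih.1 _).2)⟩
    exact this (D.gen a)
lemma T_charP (hinj : Function.Injective (algebraMap R E.T)) (hpm : (p : R) ∈ IsLocalRing.maximalIdeal R) :
    CharP (E.T ⧸ Ideal.span {(p : E.T)}) p := by
  have hn : Ideal.span {(p : E.T)} ≠ ⊤ := by
    intro h
    have h1 := Ideal.span_singleton_eq_top.mp h
    rw [← map_natCast (algebraMap R E.T)] at h1
    have := (RingHom.IsIntegral.isLocalHom (f := algebraMap R E.T) (fun t => Algebra.IsIntegral.isIntegral t) hinj).map_nonunit _ h1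
    exact hpm this
  haveI := Ideal.Quotient.nontrivial_iff.mpr hn
  exact (CharP.charP_iff_prime_eq_zero hp.out).mpr (by
    rw [← map_natCast (Ideal.Quotient.mk _)]; exact Ideal.Quotient.eq_zero_iff_mem.mpr (Ideal.mem_span_singleton_self _))
lemma key_aux {T J : Type*} [CommRing T] [IsDomain T] [CharP (T ⧸ Ideal.span {(p : T)}) p] [Fintype J] (pr gr : ℕ → T)
    (hpr : ∀ n, pr (n + 1) ^ p = pr n) (hgr : ∀ n, gr (n + 1) ^ p = gr n) (κ : T →+* EE p (tlm pr hpr))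
    (k2 : ∀ t, red p _ (κ t) = 0 → (p : T) ∣ t) (k3 : Function.Surjective (fun t => red p _ (κ t)))
    (k4 : ∀ s hs, te p _ (tlm s hs) = κ (s 0)) (t : T) (x : J → T) (n : ℕ)
    (hA : Ideal.Quotient.mk (Ideal.span {tlm pr hpr}) (rt p n (tlm pr hpr * tlm gr hgr)) * red p _ (κ t) ∈
      Ideal.span (Set.range fun k => red p _ (κ (x k)))) :
    ∃ (v0 : T) (v : J → T), pr n * gr n * t = ∑ k, x k * v k + p * v0 := by
  set ρ := (red p (tlm pr hpr)).comp κ with hρ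
  have h1 : ∀ s hs, Ideal.Quotient.mk (Ideal.span {tlm pr hpr}) (rt p n (tlm s hs)) = ρ (s n) := fun s hs => by
    rw [rt_tlm, ← red_te, k4, hρ, RingHom.comp_apply, add_zero]
  change ∀ t, ρ t = 0 → _ at k2
  change Function.Surjective ρ at k3
  change _ * ρ t ∈ Ideal.span (Set.range fun k => ρ (x k)) at hA
  rw [rt_mul, map_mul (Ideal.Quotient.mk _), h1, h1] at hA
  clear_value ρ
  rw [← map_mul ρ, ← map_mul ρ, Ideal.mem_span_range_iff_exists_fun] at hA
  obtain ⟨w, hw⟩ := hA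
  choose v hv using fun k => k3 (w k)
  obtain ⟨v0, hv0⟩ := k2 (pr n * gr n * t - ∑ k, x k * v k) (by
    rw [map_sub, ← hw, map_sum, ← Finset.sum_sub_distrib]
    refine Finset.sum_eq_zero fun k _ => ?_
    rw [← hv, map_mul, mul_comm, sub_self])
  exact ⟨v0, v, by rw [← hv0]; ring⟩
set_option maxHeartbeats 800000 in
theorem key {σ : Type} (D : CD p A σ) (ψ : A →+* R) (hψ : Function.Injective ψ) (hf : ψ.Finite) (g : A) (hc : E.c = ψ (p * g))
    (hpm : (p : R) ∈ IsLocalRing.maximalIdeal R) (hX : ∀ i, D.X i ∣ g) (B0 : Subring Ω) (hB0 : Tow B0 E.Rg)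
    (hz : ∀ z, z ∈ B0 ↔ ∃ (n : ℕ) (a : A), z * (algebraMap R Ω E.c) ^ n = algebraMap R Ω (ψ a))
    (pr gr : ℕ → E.T) (hpr0 : pr 0 = p) (hpr : ∀ n, pr (n + 1) ^ p = pr n) (hgr0 : gr 0 = algebraMap R E.T (ψ g))
    (hgr : ∀ n, gr (n + 1) ^ p = gr n) (n : ℕ) (r : σ) (J : Finset σ) (hr : r ∉ J) (t s0 : E.T) (s : J → E.T)
    (hrel : algebraMap R E.T (ψ (D.X r)) * t = ∑ k : J, algebraMap R E.T (ψ (D.X k)) * s k + p * s0) :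
    ∃ (v0 : E.T) (v : J → E.T), pr n * gr n * t = ∑ k : J, algebraMap R E.T (ψ (D.X k)) * v k + p * v0 := by
  classical
  have hTi : Function.Injective (algebraMap R E.T) := fun a b h => E.inj (congrArg Subtype.val h)
  have hj : Function.Injective ((algebraMap R Ω).comp ψ) := E.inj.comp hψ
  have hpc := E.inv_U (a := (p : R)) ⟨ψ g, by rw [hc, map_mul, map_natCast]⟩
  rw [map_natCast] at hpc
  obtain ⟨P, hP⟩ := D.exists_PT _ hj
  have hPm := PT_mem E P hpc.2 hpc.1 ψ (fun a => by rw [hP]; rfl) (fun i => by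
    rw [hc]; exact map_dvd ψ ((hX i).trans (Dvd.intro_left _ rfl)))
  let c : P.C →+* E.T := P.C.subtype.codRestrict E.T (by
    rintro ⟨_, n, a, rfl⟩; exact (hPm n).1 a)
  let aT : A →+* E.T := (algebraMap R E.T).comp ψ
  have hcP : ∀ a, c (P.ψC 0 a) = aT a := fun a => Subtype.ext (by change P.ψ 0 a = _; rw [hP]; rfl)
  haveI := T_charP E hTi hpm
  haveI := P.C_charP
  haveI := P.C_perfect
  have hp0 : (p : E.T) ≠ 0 := by
    rw [← map_natCast (algebraMap R E.T), Ne, map_eq_zero_iff _ hTi]; exact Nat.cast_ne_zero.mpr hp.out.ne_zero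
  obtain ⟨κ, k1, k2, k3, k4⟩ := tilt hp0 (fun {a b n} => E.T_root) pr hpr0 hpr (E.frob_surj p hpm hpc.2 hpc.1)
  obtain ⟨X, η, hη, hX1, hX2⟩ := base (fun s h => Subtype.ext ((mul_eq_zero.mp (congrArg Subtype.val h)).resolve_left hpc.1))
    (P.ψC 0) c pr hpr κ k1
  haveI : Nontrivial (EE p X.f) := by
    haveI : Nontrivial (X.P ⧸ Ideal.span {X.f}) := Ideal.Quotient.nontrivial_iff.mpr fun hu => X.nu (Ideal.span_singleton_eq_top.mp hu)
    exact (red p X.f).domain_nontrivial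
  obtain ⟨Y, h, y, hy⟩ := exists_root0 X (Polynomial.X - Polynomial.C (X.ι g)) (monic_X_sub_C _) (by rw [natDegree_X_sub_C]; exact one_pos)
  rw [eval₂_sub, eval₂_X, eval₂_C, sub_eq_zero, h.comm] at hy
  obtain ⟨B, hB, hB'⟩ := UU_finite (B0 := E.Rg) (h0 := E.h0) ({(t : Ω), (s0 : Ω)} ∪ Finset.univ.image fun k => (s k : Ω)) (by
    intro z hz
    simp only [Finset.mem_union, Finset.mem_insert, Finset.mem_singleton, Finset.mem_image, Finset.mem_univ, true_and] at hz
    obtain (rfl | rfl) | ⟨k, rfl⟩ := hz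
    exacts [t.2.1, s0.2.1, (s k).2.1])
  have hcj : ((algebraMap R Ω).comp ψ) (p * g) = algebraMap R Ω E.c := by rw [hc]; rfl
  obtain ⟨Z, h', hZ⟩ := Tow.spl (c := p * g) (j := (algebraMap R Ω).comp ψ) Y (B0 := B0) (B := B) hj (fun a => (hz _).mpr ⟨0, a, by simp⟩)
    (by rw [hcj]; exact E.c0) (by rw [hcj]; exact (hz _).mpr ⟨1, 1, by rw [pow_one, inv_mul_cancel₀ E.c0, map_one, map_one]⟩)
    (fun z h => by rw [hcj]; exact (hz z).mp h) (hB0.trans hB)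
  have hA := assembly aT E.T.val.toRingHom g (fun t => RingHom.IsIntegral.trans ψ (algebraMap R E.T) hf.to_isIntegral
      (fun t => Algebra.IsIntegral.isIntegral t) t) (h.comp h') (h'.φ y) (by rw [← h'.comm, ← hy, EEmap_te]) η (tlm pr hpr) hη (fun hu => ?_) κ
      (fun a => by rw [hX1, hcP]) (tlm gr hgr) (by rw [k4, hgr0]; rfl) (D.X r) (fun k : J => D.X k)
      (hX2 _ _ (P.C_reg r J hr)) B (fun a => hB.le (hB0.le ((hz _).mpr ⟨0, a, by rw [pow_zero, mul_one]; rfl⟩))) hZ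
      (fun 𝓔 _ ω hω => E.ext B (le_UU hB) ω (by rw [hc]; exact hω)) t s0 s (hB' _ (by simp)) (hB' _ (by simp))
      (fun k => hB' _ (Finset.mem_union_right _ (Finset.mem_image_of_mem _ (Finset.mem_univ k)))) hrel n
  · exact key_aux pr gr hpr hgr κ k2 k3 k4 t (fun k : J => aT (D.X k)) n hA
  · have hu2 := hu.map (Perfection.coeff (E.T ⧸ Ideal.span {(p : E.T)}) p 0)
    rw [tlm_coeff, hpr0, Ideal.Quotient.eq_zero_iff_mem.mpr (Ideal.mem_span_singleton_self _)] at hu2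
    haveI : Nontrivial (E.T ⧸ Ideal.span {(p : E.T)}) := CharP.nontrivial_of_char_ne_one (v := p) hp.out.one_lt.ne'
    exact not_isUnit_zero hu2
end ACM
namespace ACM
universe u
variable {p : ℕ} [hp : Fact p.Prime] {A R Ω : Type u} [CommRing A] [IsDomain A] [CommRing R] [IsDomain R] [IsLocalRing R]
  [CharZero R] [Field Ω] [IsAlgClosed Ω] [Algebra R Ω] (E : TData R Ω)
lemma areg {d : ℕ} (D : CD p A (Fin d)) (ψ : A →+* R) (hψ : Function.Injective ψ) (hf : ψ.Finite) (g : A) (hc : E.c = ψ (p * g))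
    (hpm : (p : R) ∈ IsLocalRing.maximalIdeal R) (hX : ∀ i, D.X i ∣ g) (B0 : Subring Ω) (hB0 : Tow B0 E.Rg)
    (hz : ∀ z, z ∈ B0 ↔ ∃ (n : ℕ) (a : A), z * (algebraMap R Ω E.c) ^ n = algebraMap R Ω (ψ a))
    (pr gr : ℕ → E.T) (hpr0 : pr 0 = p) (hpr : ∀ n, pr (n + 1) ^ p = pr n) (hgr0 : gr 0 = algebraMap R E.T (ψ g))
    (hgr : ∀ n, gr (n + 1) ^ p = gr n) (x : Fin (d + 1) → R) (hx0 : x 0 = p) (hxs : ∀ i, x (Fin.succ i) = ψ (D.X i)) (n : ℕ)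
    (i : Fin (d + 1)) (t : E.T)
    (ht : algebraMap R E.T (x i) * t ∈ Ideal.span ((fun k => algebraMap R E.T (x k)) '' {k : Fin (d + 1) | (k : ℕ) < (i : ℕ)})) :
    pr n * gr n * t ∈ Ideal.span ((fun k => algebraMap R E.T (x k)) '' {k : Fin (d + 1) | (k : ℕ) < (i : ℕ)}) := by
  classical
  induction i using Fin.cases with
  | zero =>
    have he : {k : Fin (d + 1) | (k : ℕ) < ((0 : Fin (d + 1)) : ℕ)} = ∅ := by ext; simp
    rw [he, Set.image_empty, Ideal.span_empty, Ideal.mem_bot] at ht ⊢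
    rw [hx0, map_natCast] at ht
    have : (p : E.T) ≠ 0 := fun h => Nat.cast_ne_zero.mpr hp.out.ne_zero (E.inj (a₁ := (p : R)) (a₂ := 0) (by
      rw [map_natCast, map_zero]; exact congrArg Subtype.val h))
    rw [(mul_eq_zero.mp ht).resolve_left this, mul_zero]
  | succ r =>
    let J : Finset (Fin d) := Finset.univ.filter (· < r)
    have hS : (fun k => algebraMap R E.T (x k)) '' {k : Fin (d + 1) | (k : ℕ) < ((Fin.succ r : Fin (d + 1)) : ℕ)} =
        insert (p : E.T) (Set.range fun k : J => algebraMap R E.T (ψ (D.X k))) := by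
      ext z
      constructor
      · rintro ⟨k, hk, rfl⟩
        induction k using Fin.cases with
        | zero => left; simp [hx0]
        | succ k => exact Or.inr ⟨⟨k, by simpa [J] using hk⟩, by simp [hxs]⟩
      · rintro (rfl | ⟨⟨k, hk⟩, rfl⟩)
        · exact ⟨0, by simp, by simp [hx0]⟩
        · exact ⟨Fin.succ k, by simpa [J] using hk, by simp [hxs]⟩
    rw [hS] at ht ⊢
    have hm : ∀ y : E.T, y ∈ Ideal.span (insert (p : E.T) (Set.range fun k : J => algebraMap R E.T (ψ (D.X k)))) ↔
        ∃ (v0 : E.T) (v : J → E.T), y = ∑ k : J, algebraMap R E.T (ψ (D.X k)) * v k + p * v0 := by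
      intro y
      rw [Ideal.mem_span_insert]
      constructor
      · rintro ⟨a, z, hz, rfl⟩
        obtain ⟨w, rfl⟩ := Ideal.mem_span_range_iff_exists_fun.mp hz
        exact ⟨a, w, by simp_rw [mul_comm]; ring⟩
      · rintro ⟨v0, v, rfl⟩
        exact ⟨v0, _, Ideal.mem_span_range_iff_exists_fun.mpr ⟨v, rfl⟩, by simp_rw [mul_comm]; ring⟩
    rw [hm] at ht ⊢
    obtain ⟨s0, s, hs⟩ := ht
    exact key E D ψ hψ hf g hc hpm hX B0 hB0 hz pr gr hpr0 hpr hgr0 hgr n r J (by simp [J]) t s0 s (by rw [← hxs, hs])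
def Cohen (p : ℕ) (R : Type u) [CommRing R] (d : ℕ) (x : Fin (d + 1) → R) : Prop :=
  ∃ (A : Type u) (_ : CommRing A) (_ : IsDomain A) (_ : IsIntegrallyClosed A) (D : CD p A (Fin d)) (ψ : A →+* R),
    Function.Injective ψ ∧ ψ.Finite ∧ ∀ i, x (Fin.succ i) = ψ (D.X i) ∧ D.X i ≠ 0
end ACM
namespace ACM
section
open MvPowerSeries
variable {p : ℕ} [hp : Fact p.Prime] {σ S : Type*} [CommRing S]
lemma single_le_iff' {m : σ →₀ ℕ} {j : σ} {q : ℕ} : Finsupp.single j q ≤ m ↔ q ≤ m j := by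
  classical
  exact Finsupp.single_le_iff
lemma span_crit [DecidableEq σ] (q : ℕ) (J : Finset σ) : ∀ f : MvPowerSeries σ S, (∀ m, coeff m f ≠ 0 → ∃ j ∈ J, q ≤ m j) →
    ∃ b : σ → MvPowerSeries σ S, f = ∑ j ∈ J, b j * X j ^ q := by
  induction J using Finset.induction_on with
  | empty => exact fun f h => ⟨0, by ext m; by_contra hm; obtain ⟨j, hj, -⟩ := h m (by simpa using hm); simp at hj⟩
  | insert j J hj ih =>
    intro f h
    let b0 : MvPowerSeries σ S := fun m => coeff (m + Finsupp.single j q) f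
    let u : MvPowerSeries σ S := fun m => if q ≤ m j then 0 else coeff m f
    have hu : ∀ m, coeff m u = if q ≤ m j then 0 else coeff m f := fun m => rfl
    have hb0 : ∀ m, coeff m b0 = coeff (m + Finsupp.single j q) f := fun m => rfl
    obtain ⟨b, hb⟩ := ih u (fun m hm => by
      rw [hu] at hm
      split_ifs at hm with h1
      · exact absurd rfl hm
      · obtain ⟨i, hi, h2⟩ := h m hm
        rcases Finset.mem_insert.mp hi with rfl | hi
        · exact absurd h2 h1
        · exact ⟨i, hi, h2⟩)
    refine ⟨Function.update b j b0, ?_⟩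
    rw [Finset.sum_insert hj, Function.update_self, Finset.sum_congr rfl (g := fun i => b i * X i ^ q) (fun i hi => by
      rw [Function.update_of_ne (by rintro rfl; exact hj hi)]), ← hb]
    ext m
    rw [map_add, hu, X_pow_eq, coeff_mul_monomial]
    by_cases hm : q ≤ m j
    · rw [if_pos hm, if_pos (single_le_iff'.mpr hm), hb0, tsub_add_cancel_of_le (single_le_iff'.mpr hm), mul_one, add_zero]
    · rw [if_neg hm, if_neg (mt single_le_iff'.mp hm), zero_add]
lemma ps_reg [DecidableEq σ] (q : ℕ) (r : σ) (J : Finset σ) (hr : r ∉ J) (a : MvPowerSeries σ S) (b : σ → MvPowerSeries σ S)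
    (h : X r ^ q * a = ∑ j ∈ J, b j * X j ^ q) : ∃ b' : σ → MvPowerSeries σ S, a = ∑ j ∈ J, b' j * X j ^ q := by
  refine span_crit q J a fun m hm => ?_
  by_contra! hc
  have := congrArg (coeff (Finsupp.single r q + m)) h
  rw [X_pow_eq, coeff_add_monomial_mul, one_mul, map_sum, Finset.sum_eq_zero] at this
  · exact hm this
  · intro j hj
    rw [X_pow_eq, coeff_mul_monomial, if_neg]
    rw [single_le_iff']
    have : Finsupp.single r q j = 0 := Finsupp.single_eq_of_ne (by rintro rfl; exact hr hj)
    rw [Finsupp.add_apply, this, zero_add]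
    exact not_le.mpr (hc j hj)
variable {k : Type*} [Field k] [CharP k p] [PerfectRing k p]
noncomputable def pi (p : ℕ) [Fact p.Prime] (σ k : Type*) [Field k] : MvPowerSeries σ (WittVector p k) →+* MvPowerSeries σ k :=
  MvPowerSeries.map WittVector.constantCoeff
lemma pi_surj : Function.Surjective (pi p σ k) := fun f =>
  ⟨fun m => WittVector.teichmuller p (coeff m f), by ext m; exact WittVector.teichmuller_coeff_zero p _⟩
lemma pi_zero {f : MvPowerSeries σ (WittVector p k)} : pi p σ k f = 0 ↔ (p : MvPowerSeries σ (WittVector p k)) ∣ f := by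
  constructor
  · intro h
    have : ∀ m, ∃ c, coeff m f = p * c := fun m => by
      have h1 : (coeff m f).coeff 0 = 0 := congrArg (coeff m) h
      exact Ideal.mem_span_singleton.mp ((WittVector.mem_span_p_iff_coeff_zero_eq_zero _).mpr h1)
    choose c hc using this
    let c' : MvPowerSeries σ (WittVector p k) := fun m => c m
    refine ⟨c', ?_⟩
    ext1 m
    rw [← map_natCast (C (σ := σ) (R := WittVector p k)), coeff_C_mul, hc]; rfl
  · rintro ⟨c, rfl⟩
    rw [map_mul, map_natCast, ← map_natCast (C (σ := σ) (R := k)), CharP.cast_eq_zero, map_zero, zero_mul]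
noncomputable def phi (p : ℕ) [hp : Fact p.Prime] (σ k : Type*) [Field k] [CharP k p] :
    MvPowerSeries σ (WittVector p k) →+* MvPowerSeries σ (WittVector p k) :=
  ((expand p hp.out.ne_zero : MvPowerSeries σ (WittVector p k) →ₐ[_] _) : MvPowerSeries σ (WittVector p k) →+* _).comp
    (MvPowerSeries.map WittVector.frobenius)
lemma phi_apply (f : MvPowerSeries σ (WittVector p k)) : phi p σ k f = expand p hp.out.ne_zero (MvPowerSeries.map WittVector.frobenius f) := rfl
lemma phi_gen [Fintype σ] [DecidableEq σ] (a : MvPowerSeries σ (WittVector p k)) :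
    a ∈ Subring.closure (Set.range (phi p σ k) ∪ Set.range X) := by
  let F := (WittVector.frobeniusEquiv p k).symm
  let al : (σ → Fin p) → σ →₀ ℕ := fun α => Finsupp.equivFunOnFinite.symm fun i => (α i : ℕ)
  let b : (σ → Fin p) → MvPowerSeries σ (WittVector p k) := fun α m => F (coeff (al α + p • m) a)
  have hb : ∀ α m, coeff (p • m) (phi p σ k (b α)) = coeff (al α + p • m) a := fun α m => by
    rw [phi_apply, coeff_expand_smul]
    exact (WittVector.frobeniusEquiv p k).apply_symm_apply _
  have key : a = ∑ α, monomial (al α) 1 * phi p σ k (b α) := by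
    ext1 m
    let α : σ → Fin p := fun i => ⟨m i % p, Nat.mod_lt _ hp.out.pos⟩
    let n : σ →₀ ℕ := Finsupp.equivFunOnFinite.symm fun i => m i / p
    have hm : m = al α + p • n := by
      ext i
      change m i = m i % p + p * (m i / p)
      exact (Nat.mod_add_div _ _).symm
    rw [map_sum, Finset.sum_eq_single α]
    · conv_rhs => rw [hm, coeff_add_monomial_mul, one_mul, hb, ← hm]
    · intro β _ hβ
      rw [coeff_monomial_mul]
      split_ifs with hle
      · obtain ⟨i, hi⟩ : ∃ i, β i ≠ α i := by by_contra! hc; exact hβ (funext hc)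
        rw [one_mul, phi_apply]
        apply coeff_expand_of_not_dvd (i := i)
        intro hd
        apply hi
        apply Fin.ext
        change (β i : ℕ) = m i % p
        have h1 : (β i : ℕ) ≤ m i := hle i
        have h2 : p ∣ m i - β i := hd
        rw [← Nat.mod_eq_of_lt (β i).2]
        exact (Nat.modEq_iff_dvd' h1).mpr h2
      · rfl
    · intro h; exact absurd (Finset.mem_univ _) h
  rw [key]
  refine Subring.sum_mem _ fun α _ => Subring.mul_mem _ ?_ (Subring.subset_closure (Or.inl ⟨_, rfl⟩))
  rw [monomial_eq', map_one, one_mul, Finsupp.prod]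
  refine Subring.prod_mem _ fun i _ => ?_
  refine pow_mem (Subring.subset_closure (Set.mem_union_right _ (Set.mem_range_self i))) _
noncomputable def psCD (p : ℕ) [hp : Fact p.Prime] (σ k : Type*) [Field k] [CharP k p] [PerfectRing k p] [Fintype σ] [DecidableEq σ] :
    CD p (MvPowerSeries σ (WittVector p k)) σ where
  φ := phi p σ k
  X := X
  inj := by
    intro a b h
    ext1 m
    have := congrArg (coeff (p • m)) h
    rw [phi_apply, phi_apply, coeff_expand_smul, coeff_expand_smul] at this
    exact (WittVector.frobenius_bijective p k).injective this
  φX i := by rw [phi_apply, map_X, expand_X]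
  gen := phi_gen
  frob a := by
    rw [← pi_zero, map_sub, map_pow, sub_eq_zero, ← map_frobenius_expand p hp.out.ne_zero, phi_apply, pi, map_expand, map_expand]
    have : MvPowerSeries.map WittVector.constantCoeff (MvPowerSeries.map (WittVector.frobenius (p := p)) a) =
        MvPowerSeries.map (frobenius k p) (MvPowerSeries.map WittVector.constantCoeff a) := by
      ext m
      exact WittVector.coeff_frobenius_charP (p := p) (coeff m a) 0
    rw [this]
  red a h := by
    rw [← pi_zero, map_pow] at h
    exact pi_zero.mp (eq_zero_of_pow_eq_zero h)
  nu h := by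
    have := h.map (pi p σ k)
    rw [pi_zero.mpr dvd_rfl] at this
    exact not_isUnit_zero this
  reg q r J hr a b e h := by
    have h1 := congrArg (pi p σ k) h
    rw [map_add, pi_zero.mpr (Dvd.intro _ rfl), add_zero, map_mul, map_pow, map_sum] at h1
    simp only [map_mul, map_pow] at h1
    have hX : ∀ i, pi p σ k (X i) = X i := fun i => map_X _ _
    simp only [hX] at h1
    obtain ⟨b', hb⟩ := ps_reg q r J hr _ _ h1
    choose b2 hb2 using fun j => pi_surj (p := p) (b' j)
    obtain ⟨e', he⟩ := pi_zero.mp (show pi p σ k (a - ∑ j ∈ J, b2 j * X j ^ q) = 0 by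
      rw [map_sub, map_sum, hb, sub_eq_zero]
      exact Finset.sum_congr rfl fun j _ => by rw [map_mul, map_pow, hX, hb2])
    exact ⟨b2, e', by rw [← he]; ring⟩
end
end ACM
namespace ACM
section
open PowerSeries
variable {S : Type*} [CommRing S] [IsDomain S]
def CIC (S : Type*) [CommRing S] : Prop := ∀ c f g : S, c ≠ 0 → g ≠ 0 → (∀ n, g ^ n ∣ c * f ^ n) → g ∣ f
lemma CIC_iff [IsNoetherianRing S] : IsIntegrallyClosed S ↔ CIC S := by
  have hinj := IsFractionRing.injective S (FractionRing S)
  rw [isIntegrallyClosed_iff (FractionRing S)]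
  constructor
  · intro h c f g hc hg hd
    have hg' : algebraMap S (FractionRing S) g ≠ 0 := (map_ne_zero_iff _ hinj).mpr hg
    obtain ⟨y, hy⟩ := h (x := algebraMap S (FractionRing S) f / algebraMap S (FractionRing S) g) (IsAlmostIntegral.isIntegral
      ⟨c, mem_nonZeroDivisors_of_ne_zero hc, fun n => by
        obtain ⟨w, hw⟩ := hd n
        refine ⟨w, ?_⟩
        rw [Algebra.smul_def, div_pow, ← mul_div_assoc, eq_div_iff (pow_ne_zero _ hg'), ← map_pow, ← map_pow, ← map_mul, ← map_mul, hw, mul_comm]⟩)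
    refine ⟨y, hinj ?_⟩
    rw [map_mul, hy, mul_div_cancel₀ _ hg']
  · intro h x hx
    obtain ⟨c, hc, hx⟩ := hx.isAlmostIntegral
    obtain ⟨f, g, hg, rfl⟩ := IsFractionRing.div_surjective (A := S) x
    have hg0 := nonZeroDivisors.ne_zero hg
    have hg' : algebraMap S (FractionRing S) g ≠ 0 := (map_ne_zero_iff _ hinj).mpr hg0
    obtain ⟨y, hy⟩ := h c f g (nonZeroDivisors.ne_zero hc) hg0 fun n => by
      obtain ⟨w, hw⟩ := hx n
      rw [Algebra.smul_def, div_pow, ← mul_div_assoc, eq_div_iff (pow_ne_zero _ hg'), ← map_pow, ← map_pow, ← map_mul, ← map_mul] at hw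
      exact ⟨w, by rw [← hinj hw, mul_comm]⟩
    exact ⟨y, by rw [hy, map_mul, mul_div_cancel_left₀ _ hg']⟩
lemma strip {f : S⟦X⟧} (hf : f ≠ 0) : ∃ n f', f = X ^ n * f' ∧ ¬ (X : S⟦X⟧) ∣ f' := by
  refine ⟨_, _, (X_pow_order_mul_divXPowOrder (f := f)).symm, ?_⟩
  rw [X_dvd_iff]
  exact constantCoeff_divXPowOrder_eq_zero_iff.not.mpr hf
lemma dvd_strip {g v : S⟦X⟧} {a n : ℕ} (hg : ¬ (X : S⟦X⟧) ∣ g) (h : g ^ n ∣ X ^ a * v) : g ^ n ∣ v := by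
  obtain ⟨w, hw⟩ := h
  obtain ⟨w', rfl⟩ := X_prime.pow_dvd_of_dvd_mul_left a (mt X_prime.dvd_of_dvd_pow hg) (Dvd.intro _ hw)
  exact ⟨w', mul_left_cancel₀ (pow_ne_zero a X_ne_zero) (by rw [hw]; ring)⟩
lemma cic_step (h : CIC S) {c f g : S⟦X⟧} (hc : ¬ (X : S⟦X⟧) ∣ c) (hg : ¬ (X : S⟦X⟧) ∣ g) (hd : ∀ n, g ^ n ∣ c * f ^ n) :
    ∃ a f1, f = g * C a + X * f1 ∧ ∀ n, g ^ n ∣ c * f1 ^ n := by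
  rw [X_dvd_iff] at hc
  obtain ⟨a, ha⟩ := h (constantCoeff c) (constantCoeff f) (constantCoeff g) hc (fun h => hg (X_dvd_iff.mpr h)) fun n => by
    have := map_dvd (constantCoeff (R := S)) (hd n)
    simpa only [map_pow, map_mul] using this
  obtain ⟨f1, hf1⟩ := X_dvd_iff.mpr (show constantCoeff (f - g * C a) = 0 by rw [map_sub, map_mul, constantCoeff_C, ha, sub_self])
  refine ⟨a, f1, by rw [← hf1]; ring, fun n => dvd_strip (a := n) hg ?_⟩
  have : X ^ n * (c * f1 ^ n) = c * (f + -(g * C a)) ^ n := by rw [← sub_eq_add_neg, hf1]; ring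
  rw [this, add_pow, Finset.mul_sum]
  refine Finset.dvd_sum fun i hi => ?_
  obtain ⟨w, hw⟩ := hd i
  refine ⟨w * (-C a) ^ (n - i) * n.choose i, ?_⟩
  have hi' : i + (n - i) = n := by have := Finset.mem_range.mp hi; omega
  calc c * (f ^ i * (-(g * C a)) ^ (n - i) * n.choose i) = (c * f ^ i) * (g ^ (n - i) * (-C a) ^ (n - i) * n.choose i) := by
        rw [← mul_neg, mul_pow]; ring
    _ = g ^ (i + (n - i)) * (w * (-C a) ^ (n - i) * n.choose i) := by rw [hw, pow_add]; ring
    _ = _ := by rw [hi']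
lemma cic_main (h : CIC S) {c f g : S⟦X⟧} (hc : ¬ (X : S⟦X⟧) ∣ c) (hg : ¬ (X : S⟦X⟧) ∣ g) (hd : ∀ n, g ^ n ∣ c * f ^ n) : g ∣ f := by
  let Q := {f : S⟦X⟧ // ∀ n, g ^ n ∣ c * f ^ n}
  have : ∀ q : Q, ∃ (a : S) (q' : Q), q.1 = g * C a + X * q'.1 := fun q => by
    obtain ⟨a, f1, h1, h2⟩ := cic_step h hc hg q.2
    exact ⟨a, ⟨f1, h2⟩, h1⟩
  choose a q' hq using this
  let F : ℕ → Q := fun n => Nat.rec ⟨f, hd⟩ (fun _ q => q' q) n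
  let H : ℕ → S⟦X⟧ := fun N => PowerSeries.mk fun n => a (F (N + n))
  have hH : ∀ N, H N = C (a (F N)) + X * H (N + 1) := fun N => by
    rw [eq_X_mul_shift_add_const (H N), add_comm]
    congr 2
    simp only [H, coeff_mk, ← add_assoc, add_right_comm N]
  have hD : ∀ N, (F 0).1 - g * H 0 = X ^ N * ((F N).1 - g * H N) := fun N => by
    induction N with
    | zero => simp
    | succ N ih =>
      rw [ih, hq (F N), hH N]
      change _ = X ^ (N + 1) * ((q' (F N)).1 - g * H (N + 1))
      ring
  refine ⟨H 0, sub_eq_zero.mp ?_⟩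
  ext n
  have := X_pow_dvd_iff.mp (Dvd.intro _ (hD (n + 1)).symm) n (Nat.lt_succ_self n)
  rwa [map_zero]
lemma cic_ps (h : CIC S) : CIC S⟦X⟧ := by
  intro c f g hc hg hd
  by_cases hf : f = 0
  · rw [hf]; exact dvd_zero g
  obtain ⟨a, c, rfl, hc'⟩ := strip hc
  obtain ⟨b, g, rfl, hg'⟩ := strip hg
  obtain ⟨e, f, rfl, hf'⟩ := strip hf
  have hbe : b ≤ e := by
    by_contra! hlt
    have h1 := hd (a + 1)
    have h2 : (X : S⟦X⟧) ^ (b * (a + 1)) ∣ c * f ^ (a + 1) * X ^ (a + e * (a + 1)) := by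
      refine (Dvd.intro (g ^ (a + 1)) ?_).trans (h1.trans (dvd_of_eq ?_))
      · ring
      · ring
    have h3 := X_prime.pow_dvd_of_dvd_mul_left _ (fun h => (X_prime.dvd_or_dvd h).elim hc' fun h => hf' (X_prime.dvd_of_dvd_pow h)) h2
    rw [pow_dvd_pow_iff X_ne_zero X_prime.not_isUnit] at h3
    nlinarith
  obtain ⟨e, rfl⟩ := Nat.exists_eq_add_of_le hbe
  rw [pow_add, mul_assoc]
  refine mul_dvd_mul_left _ (cic_main h hc' hg' fun n => dvd_strip (a := a) hg' ?_)
  refine (mul_dvd_mul_iff_left (pow_ne_zero (b * n) (X_ne_zero (R := S)))).mp ?_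
  refine (dvd_of_eq ?_).trans ((hd n).trans (dvd_of_eq ?_))
  · ring
  · ring
lemma ic_mvps [IsNoetherianRing S] [IsIntegrallyClosed S] (d : ℕ) : IsIntegrallyClosed (MvPowerSeries (Fin d) S) := by
  induction d with
  | zero => exact IsIntegrallyClosed.of_equiv (MvPowerSeries.isEmptyEquiv (Fin 0) S).toRingEquiv.symm
  | succ n ih =>
    haveI : IsDomain (MvPowerSeries (Fin n) S) := NoZeroDivisors.to_isDomain _
    haveI := CIC_iff.mpr (cic_ps (CIC_iff.mp ih))
    exact IsIntegrallyClosed.of_equiv (MvPowerSeries.finSuccEquiv S n).toRingEquiv.symm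
end
end ACM
namespace ACM
section
open WittVector IsAdicComplete
lemma exists_wk (p : ℕ) [hp : Fact p.Prime] (R : Type*) [CommRing R] [IsLocalRing R]
    [IsAdicComplete (IsLocalRing.maximalIdeal R) R]
    [CharP (IsLocalRing.ResidueField R) p] [PerfectRing (IsLocalRing.ResidueField R) p] :
    ∃ φ : WittVector p (IsLocalRing.ResidueField R) →+* R, ∀ z, IsLocalRing.residue R (φ z) = z.coeff 0 := by
  set I := IsLocalRing.maximalIdeal R with hIdef
  have hI : (p : R) ∈ I := by
    rw [hIdef, ← IsLocalRing.residue_eq_zero_iff, map_natCast, CharP.cast_eq_zero]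
  let h : ℕ → IsLocalRing.ResidueField R →+* R ⧸ I := fun n =>
    ((iterateFrobeniusEquiv (IsLocalRing.ResidueField R) p n).symm : IsLocalRing.ResidueField R →+* IsLocalRing.ResidueField R)
  have hh : ∀ n x, h (n + 1) x ^ p = h n x := fun n x => by
    change ((iterateFrobeniusEquiv (IsLocalRing.ResidueField R) p (n + 1)).symm x) ^ p = (iterateFrobeniusEquiv (IsLocalRing.ResidueField R) p n).symm x
    rw [RingEquiv.eq_symm_apply, iterateFrobeniusEquiv_def, ← pow_mul, ← pow_succ']
    conv_rhs => rw [← (iterateFrobeniusEquiv (IsLocalRing.ResidueField R) p (n + 1)).apply_symm_apply x, iterateFrobeniusEquiv_def]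
  refine ⟨Order.succ_strictMono.liftRingHom I (fun n => th I hI h n) fun {n} => th_compat hh n, fun z => ?_⟩
  have h1 := Order.succ_strictMono.mk_liftRingHom I (fun n => th I hI h n) (fun {n} => th_compat hh n) (n := 0) z
  have h2 := th_zero h1.symm
  refine h2.symm.trans ?_
  change (iterateFrobeniusEquiv (IsLocalRing.ResidueField R) p 0).symm _ = _
  rw [RingEquiv.symm_apply_eq, iterateFrobeniusEquiv_def, pow_zero, pow_one]
lemma exists_ev {B R : Type*} [CommRing B] [CommRing R] (φ : B →+* R) (I : Ideal R) [hc : IsAdicComplete I R] {d : ℕ}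
    (x : Fin d → R) (hx : ∀ i, x i ∈ I) :
    ∃ ψ : MvPowerSeries (Fin d) B →+* R, (∀ b, ψ (MvPowerSeries.C b) = φ b) ∧ ∀ i, ψ (MvPowerSeries.X i) = x i := by
  letI : UniformSpace B := ⊥
  haveI : DiscreteTopology B := ⟨rfl⟩
  letI : TopologicalSpace R := I.adicTopology
  haveI : IsTopologicalRing R := I.adic_basis.toRing_subgroups_basis.toRingFilterBasis.isTopologicalRing
  letI : UniformSpace R := IsTopologicalAddGroup.rightUniformSpace R
  haveI : IsUniformAddGroup R := isUniformAddGroup_of_addCommGroup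
  have hI : IsAdic I := rfl
  obtain ⟨_, _⟩ := hI.isAdicComplete_iff.mp hc
  haveI : IsLinearTopology R R := IsLinearTopology.mk_of_hasBasis R (s := fun n => I ^ n) hI.hasBasis_nhds_zero
  haveI : IsUniformAddGroup B := inferInstance
  have ha : MvPowerSeries.HasEval x := by
    refine ⟨fun i => ?_, by simp⟩
    rw [IsTopologicallyNilpotent]
    refine (hI.hasBasis_nhds_zero.tendsto_right_iff).mpr fun n _ => ?_
    filter_upwards [Filter.eventually_ge_atTop n] with m hm
    exact Ideal.pow_le_pow_right hm (Ideal.pow_mem_pow (hx i) m)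
  have hφ : Continuous φ := continuous_of_discreteTopology
  refine ⟨MvPowerSeries.eval₂Hom hφ ha, fun b => ?_, fun i => ?_⟩
  · rw [MvPowerSeries.coe_eval₂Hom, MvPowerSeries.eval₂_C]
  · rw [MvPowerSeries.coe_eval₂Hom, MvPowerSeries.eval₂_X]
end
end ACM
namespace ACM
section
lemma prec_pi {B : Type*} [CommRing B] (I : Ideal B) [IsPrecomplete I B] (n : ℕ) : IsPrecomplete I (Fin n → B) := by
  have key : ∀ (m : ℕ) (v : Fin n → B), v ∈ (I ^ m • ⊤ : Submodule B (Fin n → B)) ↔ ∀ i, v i ∈ I ^ m := fun m v => by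
    constructor
    · intro hv i
      have := Submodule.mem_map_of_mem (f := LinearMap.proj (R := B) (φ := fun _ : Fin n => B) i) hv
      rw [Submodule.map_smul''] at this
      have h2 := Submodule.smul_mono (le_refl (I ^ m)) (le_top (a := Submodule.map (LinearMap.proj (R := B) (φ := fun _ : Fin n => B) i) ⊤)) this
      rwa [smul_eq_mul, Ideal.mul_top] at h2
    · intro hv
      rw [pi_eq_sum_univ v]
      exact Submodule.sum_mem _ fun i _ => Submodule.smul_mem_smul (hv i) trivial
  refine ⟨fun f hf => ?_⟩
  have h1 : ∀ i, ∃ L : B, ∀ m, f m i ≡ L [SMOD (I ^ m • ⊤ : Submodule B B)] := fun i => by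
    refine IsPrecomplete.prec (I := I) inferInstance (f := fun m => f m i) fun {a b} hab => ?_
    have := hf hab
    rw [SModEq.sub_mem, key] at this
    rw [SModEq.sub_mem, smul_eq_mul, Ideal.mul_top]
    exact this i
  choose L hL using h1
  refine ⟨L, fun m => ?_⟩
  rw [SModEq.sub_mem, key]
  intro i
  have := hL i m
  rwa [SModEq.sub_mem, smul_eq_mul, Ideal.mul_top] at this
lemma fin_lift {B M : Type*} [CommRing B] [AddCommGroup M] [Module B M] (I : Ideal B) [IsPrecomplete I B] [IsHausdorff I M]
    (t : Submodule B M) (ht : t.FG) (h : t ⊔ I • ⊤ = ⊤) : t = ⊤ := by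
  obtain ⟨n, s, rfl⟩ := Submodule.fg_iff_exists_fin_generating_family.mp ht
  haveI := prec_pi I n
  have hr : LinearMap.range (Fintype.linearCombination B s) = Submodule.span B (Set.range s) := Fintype.range_linearCombination B s
  rw [← hr] at h ⊢
  rw [LinearMap.range_eq_top]
  refine surjective_of_mkQ_comp_surjective (I := I) fun y => ?_
  obtain ⟨y, rfl⟩ := Submodule.mkQ_surjective _ y
  obtain ⟨a, ⟨c, rfl⟩, b, hb, rfl⟩ := Submodule.mem_sup.mp (h ▸ Submodule.mem_top : y ∈ _ ⊔ _)
  refine ⟨c, ?_⟩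
  rw [LinearMap.comp_apply, map_add, Submodule.mkQ_apply _ b, (Submodule.Quotient.mk_eq_zero _).mpr hb, add_zero]
variable {W R : Type*} [CommRing W] [CommRing R] [IsNoetherianRing R] [IsLocalRing R] [Algebra W R]
lemma gen_pow (hW : Function.Surjective (algebraMap W (R ⧸ IsLocalRing.maximalIdeal R))) (N : ℕ) :
    ∃ t : Submodule W R, t.FG ∧ t ⊔ (IsLocalRing.maximalIdeal R ^ N).restrictScalars W = ⊤ := by
  induction N with
  | zero => exact ⟨⊥, Submodule.fg_bot, by simp⟩
  | succ N ih =>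
    obtain ⟨t, ht, h⟩ := ih
    obtain ⟨G, hG⟩ := (IsNoetherian.noetherian (IsLocalRing.maximalIdeal R ^ N))
    refine ⟨t ⊔ Submodule.span W G, ht.sup (Submodule.fg_span G.finite_toSet), ?_⟩
    rw [← top_le_iff, ← h, sup_assoc]
    refine sup_le_sup_left (fun x hx => ?_) _
    replace hx : x ∈ Submodule.span R (G : Set R) := hG ▸ hx
    induction hx using Submodule.span_induction with
    | mem x hx => exact Submodule.mem_sup_left (Submodule.subset_span hx)
    | zero => exact zero_mem _
    | add x y _ _ hx hy => exact add_mem hx hy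
    | smul a x hx' hx =>
      obtain ⟨w, hw⟩ := hW (Ideal.Quotient.mk _ a)
      rw [IsScalarTower.algebraMap_apply W R, Ideal.Quotient.algebraMap_eq, eq_comm, Ideal.Quotient.eq] at hw
      rw [show a • x = w • x + (a - algebraMap W R w) * x by rw [smul_eq_mul, Algebra.smul_def]; ring]
      refine add_mem (Submodule.smul_mem _ _ hx) (Submodule.mem_sup_right ?_)
      rw [Submodule.restrictScalars_mem, pow_succ']
      exact Ideal.mul_mem_mul hw (hG ▸ hx')
lemma gen_W (hW : Function.Surjective (algebraMap W (R ⧸ IsLocalRing.maximalIdeal R))) (p : ℕ) [IsPrecomplete (Ideal.span {(p : W)}) W]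
    {J : Ideal R} (hp : (p : R) ∈ IsLocalRing.maximalIdeal R)
    (hJ : IsLocalRing.maximalIdeal R ≤ (Ideal.span {(p : R)} ⊔ J).radical) :
    ∃ t : Submodule W R, t.FG ∧ t ⊔ J.restrictScalars W = ⊤ := by
  obtain ⟨N, hN⟩ := Ideal.exists_pow_le_of_le_radical_of_fg hJ (IsNoetherian.noetherian _)
  obtain ⟨t, ht, h⟩ := gen_pow hW N
  refine ⟨t, ht, ?_⟩
  let q : R →ₗ[W] R ⧸ J := (Ideal.Quotient.mkₐ W J).toLinearMap
  haveI : IsHausdorff (Ideal.span {(p : R)}) (R ⧸ J) := IsHausdorff.of_isLocalRing _ _ fun h => by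
    have h1 : (1 : R) ∈ Ideal.span {(p : R)} := h ▸ trivial
    exact (Ideal.ne_top_iff_one _).mp (IsLocalRing.maximalIdeal.isMaximal R).ne_top ((Ideal.span_singleton_le_iff_mem _).mpr hp h1)
  haveI : IsHausdorff (Ideal.span {(p : W)}) (R ⧸ J) := by
    rw [← IsHausdorff.map_algebraMap_iff (S := R), Ideal.map_span, Set.image_singleton, map_natCast]
    infer_instance
  have hm : t.map q = ⊤ := by
    refine fin_lift (Ideal.span {(p : W)}) _ (ht.map q) (top_le_iff.mp fun y _ => ?_)
    obtain ⟨y, rfl⟩ := Ideal.Quotient.mk_surjective y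
    obtain ⟨a, ha, b, hb, rfl⟩ := Submodule.mem_sup.mp (h ▸ Submodule.mem_top : y ∈ t ⊔ _)
    rw [map_add]
    refine Submodule.add_mem_sup ⟨a, ha, rfl⟩ ?_
    obtain ⟨u, hu, v, hv, rfl⟩ := Submodule.mem_sup.mp (hN hb)
    obtain ⟨r, rfl⟩ := Ideal.mem_span_singleton'.mp hu
    rw [map_add, Ideal.Quotient.eq_zero_iff_mem.mpr hv, add_zero,
      show Ideal.Quotient.mk J (r * p) = (p : W) • Ideal.Quotient.mk J r by rw [Algebra.smul_def, map_natCast, map_mul, map_natCast, mul_comm]]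
    exact Submodule.smul_mem_smul (Ideal.mem_span_singleton_self _) trivial
  refine top_le_iff.mp fun y _ => ?_
  obtain ⟨a, ha, hay⟩ : q y ∈ t.map q := hm ▸ trivial
  refine Submodule.mem_sup.mpr ⟨a, ha, y - a, ?_, by ring⟩
  exact Ideal.Quotient.eq.mp hay.symm
end
section
variable {W R : Type*} [CommRing W] [CommRing R] [IsNoetherianRing R] [IsLocalRing R]
lemma psi_finite (φ : W →+* R) (hW : Function.Surjective ((Ideal.Quotient.mk (IsLocalRing.maximalIdeal R)).comp φ)) (p : ℕ)
    [IsPrecomplete (Ideal.span {(p : W)}) W] {d : ℕ} (x : Fin d → R) (hp : (p : R) ∈ IsLocalRing.maximalIdeal R)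
    (hx : ∀ i, x i ∈ IsLocalRing.maximalIdeal R)
    (hJ : IsLocalRing.maximalIdeal R ≤ (Ideal.span {(p : R)} ⊔ Ideal.span (Set.range x)).radical)
    (ψ : MvPowerSeries (Fin d) W →+* R) (hC : ∀ b, ψ (MvPowerSeries.C b) = φ b) (hX : ∀ i, ψ (MvPowerSeries.X i) = x i) :
    ψ.Finite := by
  letI := φ.toAlgebra
  obtain ⟨t, ht, h⟩ := gen_W (W := W) hW p hp hJ
  obtain ⟨G, rfl⟩ := ht
  letI := ψ.toAlgebra
  let I : Ideal (MvPowerSeries (Fin d) W) := Ideal.span (Set.range MvPowerSeries.X)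
  have hI : I.map (algebraMap (MvPowerSeries (Fin d) W) R) = Ideal.span (Set.range x) := by
    rw [Ideal.map_span, ← Set.range_comp]
    congr 2
    exact funext hX
  haveI : IsHausdorff I R := by
    rw [← IsHausdorff.map_algebraMap_iff (S := R), hI]
    refine IsHausdorff.of_isLocalRing _ _ fun h => ?_
    refine (Ideal.ne_top_iff_one _).mp (IsLocalRing.maximalIdeal.isMaximal R).ne_top (Ideal.span_le.mpr ?_ (h ▸ trivial : (1 : R) ∈ Ideal.span (Set.range x)))
    rintro _ ⟨i, rfl⟩
    exact hx i
  change Module.Finite _ _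
  refine ⟨⟨G, fin_lift I _ ⟨G, rfl⟩ (top_le_iff.mp fun y _ => ?_)⟩⟩
  obtain ⟨a, ha, b, hb, rfl⟩ := Submodule.mem_sup.mp (h ▸ Submodule.mem_top : y ∈ Submodule.span W (G : Set R) ⊔ _)
  refine Submodule.add_mem_sup ?_ ?_
  · clear * - ha hC
    induction ha using Submodule.span_induction with
    | mem x hx => exact Submodule.subset_span hx
    | zero => exact zero_mem _
    | add x y _ _ hx hy => exact add_mem hx hy
    | smul w x _ hx =>
      rw [show w • x = (MvPowerSeries.C w : MvPowerSeries (Fin d) W) • x by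
        rw [Algebra.smul_def, Algebra.smul_def]; exact congrArg (· * x) (hC w).symm]
      exact Submodule.smul_mem _ _ hx
  · rw [Ideal.smul_top_eq_map, hI]
    exact hb
end
end ACM
namespace ACM
section
open WittVector
lemma dim_A (p : ℕ) [hp : Fact p.Prime] (k : Type*) [Field k] [CharP k p] [PerfectRing k p] (d : ℕ) :
    ringKrullDim (MvPowerSeries (Fin d) (WittVector p k)) ≤ (d + 1 : ℕ) := by
  haveI : IsNoetherianRing (WittVector p k) := inferInstance
  let s : Set (MvPowerSeries (Fin d) (WittVector p k)) := insert (p : MvPowerSeries (Fin d) (WittVector p k)) (Set.range MvPowerSeries.X)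
  have hs : s.Finite := (Set.finite_range _).insert _
  have hm : IsLocalRing.maximalIdeal (MvPowerSeries (Fin d) (WittVector p k)) = Ideal.span s := by
    have hu : ∀ f : MvPowerSeries (Fin d) (WittVector p k), f ∈ IsLocalRing.maximalIdeal _ ↔ (p : WittVector p k) ∣ MvPowerSeries.constantCoeff f := fun f => by
      rw [IsLocalRing.mem_maximalIdeal, mem_nonunits_iff, MvPowerSeries.isUnit_iff_constantCoeff, ← Ideal.mem_span_singleton,
        mem_span_p_iff_coeff_zero_eq_zero, not_iff_comm]
      exact ⟨isUnit_of_coeff_zero_ne_zero _, fun h => (h.map (WittVector.constantCoeff (p := p) (R := k))).ne_zero⟩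
    refine le_antisymm (fun f hf => ?_) (Ideal.span_le.mpr ?_)
    · obtain ⟨c, hc⟩ := (hu f).mp hf
      obtain ⟨b, hb⟩ := span_crit 1 Finset.univ (f - MvPowerSeries.C (MvPowerSeries.constantCoeff f)) fun m hm => by
        by_contra! h
        have h0 : m = 0 := Finsupp.ext fun j => Nat.lt_one_iff.mp (h j (Finset.mem_univ j))
        subst h0
        apply hm
        change MvPowerSeries.constantCoeff (f - MvPowerSeries.C (MvPowerSeries.constantCoeff f)) = _
        rw [map_sub, MvPowerSeries.constantCoeff_C, sub_self]
      rw [← sub_add_cancel f (MvPowerSeries.C (MvPowerSeries.constantCoeff f)), hb, hc, map_mul, map_natCast]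
      refine add_mem (Ideal.sum_mem _ fun j _ => Ideal.mul_mem_left _ _ ?_) (Ideal.mul_mem_right _ _ (Ideal.subset_span (Set.mem_insert _ _)))
      rw [pow_one]
      exact Ideal.subset_span (Set.mem_insert_of_mem _ ⟨j, rfl⟩)
    · rintro f (rfl | ⟨j, rfl⟩)
      · exact (hu _).mpr (by rw [map_natCast])
      · exact (hu _).mpr (by rw [MvPowerSeries.constantCoeff_X]; exact dvd_zero _)
  refine (ringKrullDim_le_spanFinrank_maximalIdeal _).trans ?_
  rw [hm]
  refine Nat.cast_le.mpr ((Submodule.spanFinrank_span_le_ncard_of_finite hs).trans ((Set.ncard_insert_le _ _).trans ?_))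
  have := Set.ncard_image_le (f := (MvPowerSeries.X : Fin d → MvPowerSeries (Fin d) (WittVector p k))) Set.finite_univ
  rw [Set.image_univ, Set.ncard_univ, Nat.card_fin] at this
  omega
lemma psi_inj {A R : Type*} [CommRing A] [IsDomain A] [CommRing R] [Nontrivial R] (ψ : A →+* R) (hψ : ψ.IsIntegral) (n : ℕ)
    (hA : ringKrullDim A ≤ n) (hR : ringKrullDim R = n) : Function.Injective ψ := by
  refine (injective_iff_map_eq_zero ψ).mpr fun a ha => ?_
  by_contra h0
  have h1 := ringKrullDim_succ_le_of_surjective ψ.rangeRestrict ψ.rangeRestrict_surjective (mem_nonZeroDivisors_of_ne_zero h0) (Subtype.ext ha)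
  haveI : Algebra.IsIntegral ψ.range R := ⟨fun r => by
    obtain ⟨q, hq, h⟩ := hψ r
    refine ⟨q.map ψ.rangeRestrict, hq.map _, ?_⟩
    rw [Polynomial.eval₂_map]
    exact h⟩
  have h2 : ringKrullDim R ≤ ringKrullDim ψ.range :=
    Order.krullDim_le_of_strictMono (PrimeSpectrum.comap (algebraMap ψ.range R)) fun P Q h => Ideal.IsIntegral.comap_lt_comap h
  rw [hR] at h2
  have h3 : ((n : WithBot ℕ∞)) + 1 ≤ n := (add_le_add_left h2 1).trans (h1.trans hA)
  have h4 : n + 1 ≤ n := by exact_mod_cast h3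
  omega
universe u
theorem cohen (p : ℕ) [hp : Fact p.Prime] (R : Type u) [CommRing R] [IsDomain R] [IsNoetherianRing R] [IsLocalRing R]
    [IsAdicComplete (IsLocalRing.maximalIdeal R) R]
    [CharP (IsLocalRing.ResidueField R) p] [PerfectRing (IsLocalRing.ResidueField R) p]
    (d : ℕ) (hdim : ringKrullDim R = (d + 1 : ℕ)) (x : Fin (d + 1) → R) (hx0 : x 0 = (p : R))
    (h1 : Ideal.span (Set.range x) ≤ IsLocalRing.maximalIdeal R)
    (h2 : IsLocalRing.maximalIdeal R ≤ (Ideal.span (Set.range x)).radical) : Cohen p R d x := by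
  have hx : ∀ i, x i ∈ IsLocalRing.maximalIdeal R := fun i => h1 (Ideal.subset_span ⟨i, rfl⟩)
  obtain ⟨φ, hφ⟩ := exists_wk p R
  obtain ⟨ψ, hC, hX⟩ := exists_ev φ (IsLocalRing.maximalIdeal R) (fun i => x (Fin.succ i)) fun i => hx _
  haveI : IsDomain (MvPowerSeries (Fin d) (WittVector p (IsLocalRing.ResidueField R))) := NoZeroDivisors.to_isDomain _
  have hf : ψ.Finite := by
    refine psi_finite φ (fun y => ?_) p (fun i => x (Fin.succ i)) (hx0 ▸ hx 0) (fun i => hx _) (h2.trans (Ideal.radical_mono ?_)) ψ hC hX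
    · obtain ⟨z, hz⟩ := WittVector.constantCoeff_surjective p (R := IsLocalRing.ResidueField R) y
      exact ⟨z, (hφ z).trans hz⟩
    · rw [Ideal.span_le]
      rintro _ ⟨i, rfl⟩
      induction i using Fin.cases with
      | zero => rw [hx0]; exact Ideal.mem_sup_left (Ideal.mem_span_singleton_self _)
      | succ i => exact Ideal.mem_sup_right (Ideal.subset_span ⟨i, rfl⟩)
  exact ⟨_, _, inferInstance, ic_mvps d, psCD p (Fin d) (IsLocalRing.ResidueField R), ψ,
    psi_inj ψ hf.to_isIntegral _ (dim_A p _ d) hdim, hf, fun i => ⟨(hX i).symm, fun h => by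
      change (MvPowerSeries.X i : MvPowerSeries (Fin d) (WittVector p (IsLocalRing.ResidueField R))) = 0 at h
      have := congrArg (MvPowerSeries.coeff (Finsupp.single i 1)) h
      rw [MvPowerSeries.coeff_index_single_self_X, map_zero] at this
      exact one_ne_zero this⟩⟩
end
end ACM
open ACM in
theorem exists_almost_CohenMacaulay_algebra.{u, v}
    (p : ℕ) (hp : p.Prime)
    (R : Type u) [CommRing R] [IsDomain R] [IsNoetherianRing R] [IsLocalRing R]
    [IsAdicComplete (IsLocalRing.maximalIdeal R) R]
    [CharZero R]
    (hres : CharP (IsLocalRing.ResidueField R) p)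
    [ExpChar (IsLocalRing.ResidueField R) p]
    [PerfectRing (IsLocalRing.ResidueField R) p]
    (d : ℕ) (hd0 : 0 < d) (hdim : ringKrullDim R = d)
    (x : Fin d → R) (hx0 : x ⟨0, hd0⟩ = (p : R))
    (hsop₁ : Ideal.span (Set.range x) ≤ IsLocalRing.maximalIdeal R)
    (hsop₂ : IsLocalRing.maximalIdeal R ≤ (Ideal.span (Set.range x)).radical) :
    ∃ g : R, g ≠ 0 ∧
    ∃ T : Subalgebra R (AlgebraicClosure (FractionRing R)),
      -- R ⊆ T ⊆ R⁺
      T ≤ integralClosure R (AlgebraicClosure (FractionRing R)) ∧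
      ∃ pr gr : ℕ → ↥T,
        -- (1) compatible systems of p-power roots of p and of g in T
        (pr 0 = (p : ↥T) ∧ ∀ n, pr (n + 1) ^ p = pr n) ∧
        (gr 0 = algebraMap R ↥T g ∧ ∀ n, gr (n + 1) ^ p = gr n) ∧
        -- (2) Frobenius is surjective on T/pT
        (∀ a : ↥T, ∃ b c : ↥T, a - b ^ p = p * c) ∧
        -- (3) T is a normal domain ...
        IsIntegrallyClosed ↥T ∧
        -- ... which is (pg)^{1/p^∞}-almost Cohen–Macaulay with respect to p, x₂, …, x_d
        (∃ n : ℕ, pr n * gr n ∉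
            Ideal.map (algebraMap R ↥T) (IsLocalRing.maximalIdeal R)) ∧
        (∀ n : ℕ, 0 < n → ∀ i : Fin d, ∀ t : ↥T,
            algebraMap R ↥T (x i) * t ∈
                Ideal.span ((fun k : Fin d => algebraMap R ↥T (x k)) ''
                  {k : Fin d | (k : ℕ) < (i : ℕ)}) →
            pr n * gr n * t ∈
                Ideal.span ((fun k : Fin d => algebraMap R ↥T (x k)) ''
                  {k : Fin d | (k : ℕ) < (i : ℕ)})) ∧
        -- (4) T[1/(pg)] is an increasing union of finite étale R[1/(pg)]-subalgebras
        (∀ (Rpg : Type v) (Tpg : Type v) [CommRing Rpg] [CommRing Tpg]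
            [Algebra R Rpg] [IsLocalization.Away ((p : R) * g) Rpg]
            [Algebra ↥T Tpg]
            [IsLocalization.Away ((p : ↥T) * algebraMap R ↥T g) Tpg]
            [Algebra Rpg Tpg] [Algebra R Tpg]
            [IsScalarTower R Rpg Tpg] [IsScalarTower R ↥T Tpg],
          ∃ (ι : Type v) (F : ι → Subalgebra Rpg Tpg),
            Nonempty ι ∧
            (∀ i j : ι, ∃ k : ι, F i ≤ F k ∧ F j ≤ F k) ∧
            (∀ i : ι, Module.Finite Rpg ↥(F i) ∧ Algebra.Etale Rpg ↥(F i)) ∧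
            (∀ y : Tpg, ∃ i : ι, y ∈ F i)) := by
  haveI : Fact p.Prime := ⟨hp⟩
  obtain ⟨d', rfl⟩ : ∃ d', d = d' + 1 := ⟨d - 1, by omega⟩
  have hpm : (p : R) ∈ IsLocalRing.maximalIdeal R := hsop₁ (Ideal.subset_span ⟨_, hx0⟩)
  obtain ⟨A, _, _, _, D, ψ, hψ, hf, hX⟩ := cohen p R d' hdim x hx0 hsop₁ hsop₂
  have hinj : Function.Injective (algebraMap R (AlgebraicClosure (FractionRing R))) := by
    rw [IsScalarTower.algebraMap_eq R (FractionRing R) (AlgebraicClosure (FractionRing R))]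
    exact (algebraMap (FractionRing R) _).injective.comp (IsFractionRing.injective R (FractionRing R))
  haveI : CharZero A := ψ.charZero
  obtain ⟨g, hg0, hgX, hg⟩ := gchoice (Ω := AlgebraicClosure (FractionRing R)) ψ hf (hinj.comp hψ) (∏ i, D.X i) (Finset.prod_ne_zero_iff.mpr fun i _ => (hX i).2)
  have hpg : (p : A) * g ≠ 0 := mul_ne_zero (Nat.cast_ne_zero.mpr hp.ne_zero) hg0
  obtain ⟨B0, Rg, hB0, hT, hz, hRg⟩ := hg (p * g) hpg (Dvd.intro_left _ rfl)
  have hcc : ψ (p * g) = p * ψ g := by rw [map_mul, map_natCast]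
  rw [hcc] at hz hRg
  let E : TData R (AlgebraicClosure (FractionRing R)) := ⟨p * ψ g, by rw [← hcc]; exact (map_ne_zero_iff _ hψ).mpr hpg, hinj, Rg, hT.nrm hB0, hRg⟩
  have hpc := E.inv_U (a := (p : R)) (Dvd.intro _ rfl)
  have hgc := E.inv_U (a := ψ g) (Dvd.intro_left _ rfl)
  rw [map_natCast] at hpc
  obtain ⟨pr, hpr0, hpr⟩ := E.roots p hpc.2 hpc.1 (p : E.T) hpc.1 hpc.2
  obtain ⟨gr, hgr0, hgr⟩ := E.roots p hpc.2 hpc.1 (algebraMap R E.T (ψ g)) hgc.1 hgc.2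
  refine ⟨ψ g, (map_ne_zero_iff _ hψ).mpr hg0, E.T, E.T_le, pr, gr, ⟨hpr0, hpr⟩, ⟨hgr0, hgr⟩, E.frob_surj p hpm hpc.2 hpc.1,
    inferInstance, ?_, fun n _ i t ht => ?_, ?_⟩
  · exact E.not_mem_mT p (fun n => pr n * gr n) (by simp only [hpr0, hgr0]; change _ = algebraMap R E.T (p * ψ g); rw [map_mul, map_natCast])
      (fun n => by rw [mul_pow, hpr, hgr]) (Ideal.mul_mem_right _ _ hpm)
  · exact areg E D ψ hψ hf g hcc.symm hpm (fun i => (Finset.dvd_prod_of_mem _ (Finset.mem_univ i)).trans hgX) B0 hT hz pr gr hpr0 hpr hgr0 hgr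
      x hx0 (fun i => (hX i).1) n i t ht
  · intro Rpg Tpg _ _ _ _ _ hTl _ _ _ _
    haveI : IsLocalization.Away (algebraMap R E.T (p * ψ g)) Tpg := by rw [map_mul, map_natCast]; exact hTl
    exact etale_clause E.T (p * ψ g) hinj E.hc Rg (hT.nrm hB0) hRg E.U_iff Rpg Tpg
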